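/- arXiv:1501.00445 — 4 statements merged into one kernel-verified Lean document; each statement's English description precedes it below -/
import Mathlib

section
/- Let n ≥ 2, d ≥ 2 and P(X,S) = S^d + f_{d−1}(X)S^{d−1} + ⋯ + f_1(X)S + f_0(X) with f_i ∈ k[X], and let B_{n,P} = k[X,S,Y]/⟨X^nY − P(X,S)⟩ with x, s, y the classes of X, S, Y. Then ML(B_{n,P}) = k[x], and every locally nilpotent k-derivation of B_{n,P} has the form f(x)·∂ for some f ∈ k[x], where ∂ is the locally nilpotent derivation of B_{n,P} determined by ∂(x) = 0, ∂(s) = x^n, ∂(y) = (∂P/∂S)(x,s); in particular B_{n,P} is almost rigid. -/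
open MvPolynomial

/-- A locally nilpotent `k`-derivation. -/
def IsLND {k B : Type*} [CommRing k] [CommRing B] [Algebra k B]
    (D : Derivation k B B) : Prop :=
  ∀ a : B, ∃ n : ℕ, ((D.toLinearMap : Module.End k B) ^ n) a = 0

/-- Makar-Limanov invariant. -/
def ML (k B : Type*) [CommRing k] [CommRing B] [Algebra k B] : Set B :=
  {b : B | ∀ D : Derivation k B B, IsLND D → D b = 0}

noncomputable section

variable (k : Type*) [Field k] [CharZero k]

/-- `P(X,S) = S^d + f_{d-1}(X) S^{d-1} + ⋯ + f_0(X)` in `k[X,S,Y]` (variables X=0, S=1, Y=2). -/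
def Ppoly (d : ℕ) (f : ℕ → Polynomial k) : MvPolynomial (Fin 3) k :=
  X 1 ^ d + ∑ i ∈ Finset.range d, Polynomial.aeval (X 0) (f i) * X 1 ^ i

/-- The ideal `⟨X^n Y - P(X,S)⟩` of `k[X,S,Y]`. -/
def DanIdeal (n d : ℕ) (f : ℕ → Polynomial k) : Ideal (MvPolynomial (Fin 3) k) :=
  Ideal.span {X 0 ^ n * X 2 - Ppoly k d f}

/-- The Danielewski domain `B_{n,P} = k[X,S,Y]/⟨X^n Y - P(X,S)⟩`. -/
def DanRing (n d : ℕ) (f : ℕ → Polynomial k) : Type _ :=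
  MvPolynomial (Fin 3) k ⧸ DanIdeal k n d f

instance (n d : ℕ) (f : ℕ → Polynomial k) : CommRing (DanRing k n d f) :=
  Ideal.Quotient.commRing _

instance (n d : ℕ) (f : ℕ → Polynomial k) : Algebra k (DanRing k n d f) :=
  Ideal.Quotient.algebra k

/-- `z` has coefficient `c` at `m`, and no terms of degree larger than `m`. -/
def HasLead {R G : Type*} [Semiring R] [LT G] (z : AddMonoidAlgebra R G) (m : G) (c : R) : Prop :=
  z.coeff m = c ∧ ∀ m', m < m' → z.coeff m' = 0

namespace HasLead

variable {R G : Type*} [CommRing R] [LinearOrder G]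
  {z z₁ z₂ : AddMonoidAlgebra R G} {m m₁ m₂ : G} {c c₁ c₂ : R}

theorem single (m : G) (c : R) : HasLead (AddMonoidAlgebra.single m c) m c := by
  refine ⟨by simp, fun m' h => ?_⟩
  simp [h.ne]

theorem add (h₁ : HasLead z₁ m c₁) (h₂ : HasLead z₂ m c₂) :
    HasLead (z₁ + z₂) m (c₁ + c₂) :=
  ⟨by simp [h₁.1, h₂.1], fun m' h => by simp [h₁.2 m' h, h₂.2 m' h]⟩

theorem of_lt (h : HasLead z m c) {m' : G} (hm : m < m') : HasLead z m' 0 :=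
  ⟨h.2 _ hm, fun _ h' => h.2 _ (hm.trans h')⟩

theorem sum {ι : Type*} (s : Finset ι) (f : ι → AddMonoidAlgebra R G) (c : ι → R)
    (h : ∀ i ∈ s, HasLead (f i) m (c i)) : HasLead (∑ i ∈ s, f i) m (∑ i ∈ s, c i) := by
  classical
  induction s using Finset.induction_on with
  | empty => exact ⟨by simp, by simp⟩
  | insert a s ha ih =>
    rw [Finset.sum_insert ha, Finset.sum_insert ha]
    exact (h a (by simp)).add (ih fun i hi => h i (by simp [hi]))

theorem smul (h : HasLead z m c) (r : R) : HasLead (r • z) m (r * c) :=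
  ⟨by simp [h.1], fun m' hm => by simp [h.2 m' hm]⟩

theorem le_of_coeff_ne_zero (h : HasLead z m c) {m' : G} (hm : z.coeff m' ≠ 0) : m' ≤ m := by
  by_contra! hlt
  exact hm (h.2 _ hlt)

theorem unique (h₁ : HasLead z m₁ c₁) (h₂ : HasLead z m₂ c₂) (hc₁ : c₁ ≠ 0) (hc₂ : c₂ ≠ 0) :
    m₁ = m₂ :=
  le_antisymm (h₂.le_of_coeff_ne_zero (by rwa [h₁.1])) (h₁.le_of_coeff_ne_zero (by rwa [h₂.1]))

theorem congr (h : HasLead z m c) {m' : G} {c' : R} (hm : m = m') (hc : c = c') :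
    HasLead z m' c' :=
  hm ▸ hc ▸ h

theorem ne_zero (h : HasLead z m c) (hc : c ≠ 0) : z ≠ 0 := by
  rintro rfl
  exact hc (by simpa using h.1.symm)

variable [AddCommGroup G] [IsOrderedAddMonoid G]

theorem mul (h₁ : HasLead z₁ m₁ c₁) (h₂ : HasLead z₂ m₂ c₂) :
    HasLead (z₁ * z₂) (m₁ + m₂) (c₁ * c₂) := by
  classical
  have b₁ : ∀ a ∈ z₁.coeff.support, a ≤ m₁ := fun a ha => by
    by_contra! h
    exact (Finsupp.mem_support_iff.1 ha) (h₁.2 _ h)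
  have b₂ : ∀ a ∈ z₂.coeff.support, a ≤ m₂ := fun a ha => by
    by_contra! h
    exact (Finsupp.mem_support_iff.1 ha) (h₂.2 _ h)
  constructor
  · rw [AddMonoidAlgebra.coeff_mul, ← h₁.1, ← h₂.1]
    simp only [Finsupp.sum]
    have key : ∀ a ∈ z₁.coeff.support, ∀ b ∈ z₂.coeff.support,
        (if a + b = m₁ + m₂ then z₁.coeff a * z₂.coeff b else 0) =
          if a = m₁ then (if b = m₂ then z₁.coeff a * z₂.coeff b else 0) else 0 := by
      intro a ha b hb
      by_cases h : a + b = m₁ + m₂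
      · have e₁ : a = m₁ := by
          by_contra hne
          exact (add_lt_add_of_lt_of_le ((b₁ a ha).lt_of_ne hne) (b₂ b hb)).ne h
        subst e₁
        simp [add_left_cancel h]
      · rw [if_neg h]
        split_ifs with e₁ e₂
        · exact absurd (by rw [e₁, e₂]) h
        · rfl
        · rfl
    rw [Finset.sum_congr rfl fun a ha => Finset.sum_congr rfl fun b hb => key a ha b hb]
    have : ∀ a : G, ∑ b ∈ z₂.coeff.support,
        (if a = m₁ then (if b = m₂ then z₁.coeff a * z₂.coeff b else 0) else 0) =
        if a = m₁ then z₁.coeff a * z₂.coeff m₂ else 0 := by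
      intro a
      split_ifs
      · rw [Finset.sum_ite_eq']
        split_ifs with h
        · rfl
        · rw [Finsupp.notMem_support_iff.1 h, mul_zero]
      · simp
    rw [Finset.sum_congr rfl fun a _ => this a, Finset.sum_ite_eq']
    split_ifs with h
    · rfl
    · rw [Finsupp.notMem_support_iff.1 h, zero_mul]
  · intro m' hm'
    rw [AddMonoidAlgebra.coeff_mul]
    simp only [Finsupp.sum]
    refine Finset.sum_eq_zero fun a ha => Finset.sum_eq_zero fun b hb => if_neg fun h => ?_
    exact ((add_le_add (b₁ a ha) (b₂ b hb)).trans_lt hm').ne h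

theorem pow (h : HasLead z m c) (i : ℕ) : HasLead (z ^ i) (i • m) (c ^ i) := by
  induction i with
  | zero => simpa [AddMonoidAlgebra.one_def] using single (0 : G) (1 : R)
  | succ i ih => simpa only [pow_succ, succ_nsmul] using ih.mul h

end HasLead

/-- A linear combination of elements with distinct leading degrees has as leading degree the
largest degree occurring in it. -/
theorem exists_hasLead_sum {R G ι : Type*} [CommRing R] [LinearOrder G] (e : ι → G)
    (v : ι → AddMonoidAlgebra R G) (c : ι →₀ R) (hc : c ≠ 0)
    (he : Set.InjOn e c.support) (hv : ∀ t ∈ c.support, HasLead (v t) (e t) 1) :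
    ∃ t₀ ∈ c.support, (∀ t ∈ c.support, e t ≤ e t₀) ∧
      HasLead (∑ t ∈ c.support, c t • v t) (e t₀) (c t₀) := by
  classical
  obtain ⟨t₀, ht₀, hmax⟩ := c.support.exists_max_image e (Finsupp.support_nonempty_iff.2 hc)
  refine ⟨t₀, ht₀, hmax, ?_⟩
  have h := HasLead.sum (m := e t₀) c.support (fun t => c t • v t)
    (fun t => if t = t₀ then c t else 0) fun t ht => by
      split_ifs with h
      · subst h
        simpa using (hv t ht).smul (c t)
      · exact ((hv t ht).smul (c t)).of_lt
          ((hmax t ht).lt_of_ne fun h' => h (he ht ht₀ h'))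
  simpa [Finset.sum_ite_eq', Finsupp.mem_support_iff.1 ht₀] using h

/-- The derivation multiplying the coefficient at `g` by `ℓ g`. -/
def eulerDer {R G : Type*} [CommRing R] [AddCommGroup G] (ℓ : G →+ R)
    (z : AddMonoidAlgebra R G) : AddMonoidAlgebra R G :=
  .ofCoeff <| Finsupp.onFinset z.coeff.support (fun g => ℓ g * z.coeff g) fun g hg => by
    rw [Finsupp.mem_support_iff]
    exact right_ne_zero_of_mul hg

section eulerDer

variable {R G : Type*} [CommRing R] [AddCommGroup G] (ℓ : G →+ R)

@[simp]
theorem coeff_eulerDer (z : AddMonoidAlgebra R G) (g : G) :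
    (eulerDer ℓ z).coeff g = ℓ g * z.coeff g := rfl

theorem eulerDer_zero : eulerDer ℓ 0 = 0 := by
  ext; simp

theorem eulerDer_add (z w : AddMonoidAlgebra R G) :
    eulerDer ℓ (z + w) = eulerDer ℓ z + eulerDer ℓ w := by
  ext; simp [mul_add]

theorem eulerDer_single (g : G) (r : R) :
    eulerDer ℓ (AddMonoidAlgebra.single g r) = AddMonoidAlgebra.single g (ℓ g * r) := by
  classical
  ext g'
  by_cases h : g = g'
  · subst h; simp
  · simp [h]

theorem eulerDer_algebraMap (r : R) :
    eulerDer ℓ (algebraMap R (AddMonoidAlgebra R G) r) = 0 := by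
  rw [AddMonoidAlgebra.coe_algebraMap]
  simp [eulerDer_single]

theorem eulerDer_mul (z w : AddMonoidAlgebra R G) :
    eulerDer ℓ (z * w) = z * eulerDer ℓ w + w * eulerDer ℓ z := by
  induction z using AddMonoidAlgebra.induction_linear with
  | zero => simp [eulerDer_zero]
  | add z z' h h' => rw [add_mul, eulerDer_add, eulerDer_add, h, h']; ring
  | single g r =>
    induction w using AddMonoidAlgebra.induction_linear with
    | zero => simp [eulerDer_zero]
    | add w w' h h' => rw [mul_add, eulerDer_add, eulerDer_add, h, h']; ring
    | single g' r' =>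
      simp only [AddMonoidAlgebra.single_mul_single, eulerDer_single, map_add]
      rw [add_comm g' g, ← AddMonoidAlgebra.single_add]
      congr 1; ring

theorem HasLead.eulerDer [LinearOrder G] {z : AddMonoidAlgebra R G} {m : G} {c : R}
    (h : HasLead z m c) : HasLead (eulerDer ℓ z) m (ℓ m * c) :=
  ⟨by simp [h.1], fun m' hm => by simp [h.2 m' hm]⟩

end eulerDer

/-- The exponents `(q, -p)` of a monomial `x^p s^q`, ordered lexicographically. -/
abbrev LexGrid : Type := ℤ ×ₗ ℤ

theorem LexGrid.nsmul_toLex (j : ℕ) (a b : ℤ) :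
    j • (toLex (a, b) : LexGrid) = toLex (j * a, j * b) := by
  induction j with
  | zero => simp; rfl
  | succ j ih =>
    rw [succ_nsmul, ih, ← toLex_add, Prod.mk_add_mk]
    push_cast
    rw [add_mul, add_mul, one_mul, one_mul]

/-- Elements `x`, `s`, `y` generating the algebra `B` and satisfying the Danielewski equation,
together with the embedding `x ↦ x`, `s ↦ s` in the Laurent polynomials in `x` and `s`. -/
structure IsDanielewski {K B : Type*} [Field K] [CommRing B] [Algebra K B] (n d : ℕ)
    (f : ℕ → Polynomial K) (x s y : B) (φ : B →ₐ[K] AddMonoidAlgebra K LexGrid) : Prop where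
  rel : x ^ n * y = s ^ d + ∑ i ∈ Finset.range d, Polynomial.aeval x (f i) * s ^ i
  gen : Algebra.adjoin K {x, s, y} = ⊤
  map_x : φ x = AddMonoidAlgebra.single (toLex (0, -1)) 1
  map_s : φ s = AddMonoidAlgebra.single (toLex (1, 0)) 1

namespace IsDanielewski

variable {K B : Type*} [Field K] [CommRing B] [Algebra K B] {n d : ℕ}
  {f : ℕ → Polynomial K} {x s y : B} {φ : B →ₐ[K] AddMonoidAlgebra K LexGrid}

theorem hasLead_x (h : IsDanielewski n d f x s y φ) :
    HasLead (φ x) (toLex (0, -1)) 1 := by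
  rw [h.map_x]; exact .single _ _

theorem hasLead_s (h : IsDanielewski n d f x s y φ) :
    HasLead (φ s) (toLex (1, 0)) 1 := by
  rw [h.map_s]; exact .single _ _

theorem single_mul_map_x_pow (h : IsDanielewski n d f x s y φ) (j : ℕ) :
    AddMonoidAlgebra.single (toLex (0, (j : ℤ))) 1 * φ x ^ j = 1 := by
  rw [h.map_x, AddMonoidAlgebra.single_pow, AddMonoidAlgebra.single_mul_single,
    AddMonoidAlgebra.one_def, LexGrid.nsmul_toLex, ← toLex_add]
  simp
  rfl

theorem map_y (h : IsDanielewski n d f x s y φ) :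
    φ y = AddMonoidAlgebra.single (toLex (0, (n : ℤ))) 1 *
      (φ s ^ d + ∑ i ∈ Finset.range d, Polynomial.aeval (φ x) (f i) * φ s ^ i) := by
  have := congrArg φ h.rel
  simp only [map_mul, map_pow, map_add, map_sum, ← Polynomial.aeval_algHom_apply] at this
  rw [← this, ← mul_assoc, h.single_mul_map_x_pow, one_mul]

theorem hasLead_y (h : IsDanielewski n d f x s y φ) :
    HasLead (φ y) (toLex ((d : ℤ), (n : ℤ))) 1 := by
  have hpoly : ∀ p : Polynomial K, ∃ c, HasLead (Polynomial.aeval (φ x) p) (toLex (0, 0)) c := by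
    intro p
    rw [Polynomial.aeval_eq_sum_range]
    refine ⟨_, HasLead.sum _ _ (fun j => if j = 0 then p.coeff 0 else 0) fun j _ => ?_⟩
    have hj := ((h.hasLead_x).pow j).smul (p.coeff j)
    rw [LexGrid.nsmul_toLex] at hj
    split_ifs with h0
    · subst h0
      simpa using hj
    · refine hj.of_lt (Prod.Lex.toLex_lt_toLex.2 ?_)
      simp
      omega
  rw [h.map_y]
  have hs : HasLead (φ s ^ d + ∑ i ∈ Finset.range d, Polynomial.aeval (φ x) (f i) * φ s ^ i)
      (toLex ((d : ℤ), 0)) 1 := by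
    have h₁ := h.hasLead_s.pow d
    rw [LexGrid.nsmul_toLex] at h₁
    have h₂ := HasLead.sum (m := toLex ((d : ℤ), (0 : ℤ))) (Finset.range d)
      (fun i => Polynomial.aeval (φ x) (f i) * φ s ^ i) (fun _ => 0) fun i hi => by
        obtain ⟨c, hc⟩ := hpoly (f i)
        have := hc.mul (h.hasLead_s.pow i)
        rw [LexGrid.nsmul_toLex, ← toLex_add] at this
        refine this.of_lt (Prod.Lex.toLex_lt_toLex.2 ?_)
        have := Finset.mem_range.1 hi
        simp [this]
    exact (h₁.add (h₂.congr (by simp) rfl)).congr (by simp) (by simp)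
  simpa [← toLex_add] using (HasLead.single (toLex ((0 : ℤ), (n : ℤ))) (1 : K)).mul hs

/-- The degree of `x ^ a * s ^ i * y ^ j`, where `t = (a, i, j)`. -/
def expo (n d : ℕ) (t : ℕ × ℕ × ℕ) : LexGrid :=
  toLex ((t.2.1 + d * t.2.2 : ℤ), (n * t.2.2 - t.1 : ℤ))

/-- The monomial `x ^ a * s ^ i * y ^ j`, where `t = (a, i, j)`. -/
def mono (x s y : B) (t : ℕ × ℕ × ℕ) : B := x ^ t.1 * s ^ t.2.1 * y ^ t.2.2

theorem hasLead_mono (h : IsDanielewski n d f x s y φ) (t : ℕ × ℕ × ℕ) :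
    HasLead (φ (mono x s y t)) (expo n d t) 1 := by
  have := ((h.hasLead_x.pow t.1).mul (h.hasLead_s.pow t.2.1)).mul (h.hasLead_y.pow t.2.2)
  simp only [LexGrid.nsmul_toLex, ← toLex_add] at this
  rw [mono, expo, map_mul, map_mul, map_pow, map_pow, map_pow]
  refine this.congr (congrArg toLex (Prod.ext ?_ ?_)) (by simp)
  · simp only [Prod.fst_add]; ring
  · simp only [Prod.snd_add]; ring

theorem expo_injOn (n d : ℕ) : Set.InjOn (expo n d) {t | t.2.1 < d} := by
  rintro ⟨a, i, j⟩ hi ⟨a', i', j'⟩ hi' he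
  simp only [Set.mem_ofPred_eq] at hi hi'
  simp only [expo, EmbeddingLike.apply_eq_iff_eq, Prod.mk.injEq] at he
  obtain ⟨h₁, h₂⟩ := he
  have h₁' : i + d * j = i' + d * j' := by exact_mod_cast h₁
  have hj : j = j' := by
    have e := congrArg (· / d) h₁'
    have hd : 0 < d := by omega
    simpa [Nat.add_mul_div_left _ _ hd, Nat.div_eq_of_lt hi, Nat.div_eq_of_lt hi'] using e
  subst hj
  have hi : i = i' := by omega
  have h₂' : (n * j - a : ℤ) = n * j - a' := h₂
  exact Prod.ext (by dsimp only; omega) (Prod.ext hi rfl)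

theorem span_mono (h : IsDanielewski n d f x s y φ) (hd : 2 ≤ d) :
    Submodule.span K (mono x s y '' {t | t.2.1 < d}) = ⊤ := by
  set W := Submodule.span K (mono x s y '' {t | t.2.1 < d}) with hW
  have hmono : ∀ a i j, i < d → x ^ a * s ^ i * y ^ j ∈ W := fun a i j hi =>
    Submodule.subset_span ⟨(a, i, j), hi, rfl⟩
  have closed : ∀ b : B, (∀ a i j, i < d → b * (x ^ a * s ^ i * y ^ j) ∈ W) →
      ∀ w ∈ W, b * w ∈ W := by
    intro b hb w hw
    induction hw using Submodule.span_induction with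
    | mem w hw =>
      obtain ⟨⟨a, i, j⟩, hi, rfl⟩ := hw
      exact hb a i j hi
    | zero => simp
    | add u v _ _ hu hv => rw [mul_add]; exact W.add_mem hu hv
    | smul r u _ hu => rw [mul_smul_comm]; exact W.smul_mem r hu
  have hx : ∀ w ∈ W, x * w ∈ W := closed x fun a i j hi => by
    have := hmono (a + 1) i j hi
    rwa [pow_succ', mul_assoc, mul_assoc, ← mul_assoc (x ^ a)] at this
  have hy : ∀ w ∈ W, y * w ∈ W := closed y fun a i j hi => by
    have := hmono a i (j + 1) hi
    rwa [pow_succ', mul_left_comm] at this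
  have hp : ∀ (p : Polynomial K), ∀ w ∈ W, Polynomial.aeval x p * w ∈ W := by
    intro p w hw
    induction p using Polynomial.induction_on' with
    | add p q hp hq => rw [map_add, add_mul]; exact W.add_mem hp hq
    | monomial m r =>
      rw [Polynomial.aeval_monomial, mul_assoc, ← Algebra.smul_def]
      refine W.smul_mem r ?_
      induction m with
      | zero => simpa using hw
      | succ m ih => rw [pow_succ', mul_assoc]; exact hx _ ih
  have hs : ∀ w ∈ W, s * w ∈ W := closed s fun a i j hi => by
    have e : s * (x ^ a * s ^ i * y ^ j) = x ^ a * s ^ (i + 1) * y ^ j := by ring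
    rw [e]
    rcases (show i + 1 ≤ d from hi).lt_or_eq with hlt | heq
    · exact hmono _ _ _ hlt
    · have e' : x ^ a * s ^ (i + 1) * y ^ j = x ^ (a + n) * s ^ 0 * y ^ (j + 1) -
          ∑ l ∈ Finset.range d, Polynomial.aeval x (f l) * (x ^ a * s ^ l * y ^ j) := by
        have : s ^ d = x ^ n * y - ∑ l ∈ Finset.range d, Polynomial.aeval x (f l) * s ^ l := by
          rw [h.rel, add_sub_cancel_right]
        rw [heq, this, mul_sub, sub_mul, Finset.mul_sum, Finset.sum_mul]
        congr 1
        · ring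
        · exact Finset.sum_congr rfl fun l _ => by ring
      rw [e']
      exact W.sub_mem (hmono _ _ _ (by omega))
        (W.sum_mem fun l hl => hp _ _ (hmono _ _ _ (Finset.mem_range.1 hl)))
  rw [eq_top_iff]
  rintro b -
  have hb : b ∈ Algebra.adjoin K {x, s, y} := by rw [h.gen]; trivial
  suffices ∀ w ∈ W, b * w ∈ W by
    simpa using this 1 (by simpa using hmono 0 0 0 (by omega))
  induction hb using Algebra.adjoin_induction with
  | mem b hb =>
    rcases hb with rfl | rfl | rfl
    exacts [hx, hs, hy]
  | algebraMap r => intro w hw; rw [← Algebra.smul_def]; exact W.smul_mem r hw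
  | add u v _ _ hu hv => intro w hw; rw [add_mul]; exact W.add_mem (hu w hw) (hv w hw)
  | mul u v _ _ hu hv => intro w hw; rw [mul_assoc]; exact hu _ (hv w hw)

/-- Every nonzero element of a Danielewski algebra is a combination of the monomials
`x ^ a * s ^ i * y ^ j` with `i < d`, and its leading degree is the largest of their degrees. -/
theorem exists_expansion (h : IsDanielewski n d f x s y φ) (hd : 2 ≤ d) {z : B} (hz : z ≠ 0) :
    ∃ (c : (ℕ × ℕ × ℕ) →₀ K), z = ∑ t ∈ c.support, c t • mono x s y t ∧
      (∀ t ∈ c.support, t.2.1 < d) ∧ ∃ t₀ ∈ c.support,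
        (∀ t ∈ c.support, expo n d t ≤ expo n d t₀) ∧ HasLead (φ z) (expo n d t₀) (c t₀) := by
  have hmem : z ∈ Submodule.span K (mono x s y '' {t | t.2.1 < d}) := by
    rw [h.span_mono hd]; trivial
  obtain ⟨c, hc, rfl⟩ := (Finsupp.mem_span_image_iff_linearCombination K).1 hmem
  have hsupp : ∀ t ∈ c.support, t.2.1 < d := fun t ht => hc ht
  have hc0 : c ≠ 0 := by rintro rfl; simp at hz
  refine ⟨c, rfl, hsupp, ?_⟩
  obtain ⟨t₀, ht₀, hmax, hl⟩ := exists_hasLead_sum (expo n d) (fun t => φ (mono x s y t)) c hc0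
    ((expo_injOn n d).mono hsupp) fun t _ => h.hasLead_mono t
  refine ⟨t₀, ht₀, hmax, ?_⟩
  simpa [Finsupp.linearCombination_apply, Finsupp.sum] using hl

theorem injective (h : IsDanielewski n d f x s y φ) (hd : 2 ≤ d) : Function.Injective φ := by
  rw [injective_iff_map_eq_zero]
  intro z hz
  by_contra hne
  obtain ⟨c, -, -, t₀, ht₀, -, hl⟩ := h.exists_expansion hd hne
  exact hl.ne_zero (Finsupp.mem_support_iff.1 ht₀) hz

end IsDanielewski

/-- The exponent of `x` as an additive map. -/
def LexGrid.xExp (K : Type*) [Ring K] : LexGrid →+ K where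
  toFun m := -((ofLex m).2 : K)
  map_zero' := by simp
  map_add' a b := by simp [add_comm]

/-- The exponent of `s` as an additive map. -/
def LexGrid.sExp (K : Type*) [Ring K] : LexGrid →+ K where
  toFun m := ((ofLex m).1 : K)
  map_zero' := by simp
  map_add' a b := by simp

@[simp]
theorem LexGrid.xExp_toLex (K : Type*) [Ring K] (a b : ℤ) :
    LexGrid.xExp K (toLex (a, b)) = -(b : K) := rfl

@[simp]
theorem LexGrid.sExp_toLex (K : Type*) [Ring K] (a b : ℤ) :
    LexGrid.sExp K (toLex (a, b)) = (a : K) := rfl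

namespace IsDanielewski

variable {K B : Type*} [Field K] [CommRing B] [Algebra K B] {n d : ℕ}
  {f : ℕ → Polynomial K} {x s y : B} {φ : B →ₐ[K] AddMonoidAlgebra K LexGrid}

/-- A derivation of a Danielewski algebra, expressed in the Laurent polynomials. -/
theorem map_derivation (h : IsDanielewski n d f x s y φ) (E : Derivation K B B) (z : B) :
    φ (E z) =
      AddMonoidAlgebra.single (toLex (0, 1)) 1 * φ (E x) * eulerDer (LexGrid.xExp K) (φ z) +
      AddMonoidAlgebra.single (toLex (-1, 0)) 1 * φ (E s) * eulerDer (LexGrid.sExp K) (φ z) := by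
  set g := AddMonoidAlgebra.single (toLex (0, 1)) 1 * φ (E x) with hg
  set g' := AddMonoidAlgebra.single (toLex (-1, 0)) 1 * φ (E s) with hg'
  let Z : Subalgebra K B :=
    { carrier := {z | φ (E z) = g * eulerDer (LexGrid.xExp K) (φ z) +
        g' * eulerDer (LexGrid.sExp K) (φ z)}
      mul_mem' := by
        intro a b ha hb
        simp only [Set.mem_ofPred_eq] at ha hb ⊢
        simp only [Derivation.leibniz, map_add, smul_eq_mul, map_mul, eulerDer_mul, ha, hb]
        ring
      add_mem' := by
        intro a b ha hb
        simp only [Set.mem_ofPred_eq] at ha hb ⊢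
        simp only [map_add, eulerDer_add, ha, hb]
        ring
      algebraMap_mem' := by
        intro r
        simp only [Set.mem_ofPred_eq, Derivation.map_algebraMap, map_zero, AlgHom.commutes,
          eulerDer_algebraMap, mul_zero, add_zero] }
  have hZ : ∀ w, w ∈ Z ↔ φ (E w) = g * eulerDer (LexGrid.xExp K) (φ w) +
      g' * eulerDer (LexGrid.sExp K) (φ w) := fun w => Iff.rfl
  have hx : x ∈ Z := by
    rw [hZ, hg, h.map_x, eulerDer_single, eulerDer_single]
    rw [mul_right_comm, AddMonoidAlgebra.single_mul_single, ← toLex_add]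
    simp
    rw [show (toLex ((0 : ℤ), (0 : ℤ)) : LexGrid) = 0 from rfl, ← AddMonoidAlgebra.one_def, one_mul]
  have hs : s ∈ Z := by
    rw [hZ, hg', h.map_s, eulerDer_single, eulerDer_single]
    rw [mul_right_comm _ (φ (E s)), AddMonoidAlgebra.single_mul_single, ← toLex_add]
    simp
    rw [show (toLex ((0 : ℤ), (0 : ℤ)) : LexGrid) = 0 from rfl, ← AddMonoidAlgebra.one_def, one_mul]
  have hrel : x ^ n * y ∈ Z := by
    rw [h.rel]
    refine Z.add_mem (Z.pow_mem hs _) (Z.sum_mem fun i _ => Z.mul_mem ?_ (Z.pow_mem hs _))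
    exact Polynomial.aeval_mem_adjoin_singleton K x |> fun hm =>
      Algebra.adjoin_le (S := Z) (by simpa using hx) hm
  have hy : y ∈ Z := by
    have hxn : x ^ n ∈ Z := Z.pow_mem hx n
    rw [hZ] at hrel hxn ⊢
    simp only [Derivation.leibniz, map_add, smul_eq_mul, map_mul, eulerDer_mul, hxn] at hrel
    have hu := h.single_mul_map_x_pow n
    rw [← map_pow] at hu
    linear_combination AddMonoidAlgebra.single (toLex (0, (n : ℤ))) 1 * hrel -
      (φ (E y) - (g * eulerDer (LexGrid.xExp K) (φ y) +
        g' * eulerDer (LexGrid.sExp K) (φ y))) * hu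
  have : Algebra.adjoin K {x, s, y} ≤ Z := Algebra.adjoin_le fun w hw => by
    rcases hw with rfl | rfl | rfl
    exacts [hx, hs, hy]
  rw [h.gen] at this
  exact this (Algebra.mem_top (x := z))

theorem derivation_ext (h : IsDanielewski n d f x s y φ) (hd : 2 ≤ d) {E E' : Derivation K B B}
    (hx : E x = E' x) (hs : E s = E' s) : E = E' := by
  ext z
  apply h.injective hd
  rw [h.map_derivation E, h.map_derivation E', hx, hs]

/-- A nonzero derivation has a leading homogeneous component. -/
theorem exists_hasLead_derivation (h : IsDanielewski n d f x s y φ) (hd : 2 ≤ d)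
    {E : Derivation K B B} (hE : E ≠ 0) :
    ∃ (α β : K) (w : LexGrid), (α ≠ 0 ∨ β ≠ 0) ∧ ∀ z m c, HasLead (φ z) m c →
      HasLead (φ (E z)) (m + w) ((α * LexGrid.xExp K m + β * LexGrid.sExp K m) * c) := by
  classical
  set g := AddMonoidAlgebra.single (toLex (0, 1)) 1 * φ (E x) with hg
  set g' := AddMonoidAlgebra.single (toLex (-1, 0)) 1 * φ (E s) with hg'
  have hne : (g.coeff.support ∪ g'.coeff.support).Nonempty := by
    rw [Finset.nonempty_iff_ne_empty]
    intro h0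
    obtain ⟨h₁, h₂⟩ := Finset.union_eq_empty.1 h0
    rw [Finsupp.support_eq_empty, AddMonoidAlgebra.coeff_eq_zero] at h₁ h₂
    apply hE
    ext z
    apply h.injective hd
    rw [h.map_derivation E, ← hg, ← hg', h₁, h₂]
    simp
  obtain ⟨w, hw, hmax⟩ := Finset.exists_max_image _ id hne
  refine ⟨g.coeff w, g'.coeff w, w, ?_, fun z m c hz => ?_⟩
  · simpa using hw
  · have hl : ∀ u : AddMonoidAlgebra K LexGrid,
        u.coeff.support ⊆ g.coeff.support ∪ g'.coeff.support → HasLead u w (u.coeff w) := by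
      refine fun u hu => ⟨rfl, fun m' hm' => ?_⟩
      by_contra hne
      exact (hmax m' (hu (Finsupp.mem_support_iff.2 hne))).not_gt hm'
    rw [h.map_derivation E, ← hg, ← hg']
    refine (((hl g Finset.subset_union_left).mul (hz.eulerDer (LexGrid.xExp K))).add
      ((hl g' Finset.subset_union_right).mul (hz.eulerDer (LexGrid.sExp K)))).congr
        (add_comm _ _) (by ring)

/-- Iterating a locally nilpotent derivation must at some point kill the leading term. -/
theorem exists_weight_eq_zero {E : Derivation K B B} (hE : IsLND E) {w : LexGrid}
    (ℓ : LexGrid →+ K)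
    (hw : ∀ z m c, HasLead (φ z) m c → HasLead (φ (E z)) (m + w) (ℓ m * c))
    {z : B} {m : LexGrid} (hz : HasLead (φ z) m 1) : ∃ j : ℕ, ℓ m + j * ℓ w = 0 := by
  by_contra! hne
  have key : ∀ N : ℕ, ∃ c, c ≠ 0 ∧
      HasLead (φ (((E.toLinearMap : Module.End K B) ^ N) z)) (m + N • w) c := by
    intro N
    induction N with
    | zero => exact ⟨1, one_ne_zero, by simpa using hz⟩
    | succ N ih =>
      obtain ⟨c, hc, hl⟩ := ih
      refine ⟨ℓ (m + N • w) * c, mul_ne_zero ?_ hc, ?_⟩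
      · rw [map_add, map_nsmul, nsmul_eq_mul]
        exact hne N
      · rw [pow_succ']
        exact (hw _ _ _ hl).congr (by rw [add_assoc, succ_nsmul]) rfl
  obtain ⟨N, hN⟩ := hE z
  obtain ⟨c, hc, hl⟩ := key N
  exact hl.ne_zero hc (by rw [hN, map_zero])

end IsDanielewski

namespace IsDanielewski

variable {K B : Type*} [Field K] [CommRing B] [Algebra K B] {n d : ℕ}
  {f : ℕ → Polynomial K} {x s y : B} {φ : B →ₐ[K] AddMonoidAlgebra K LexGrid}

theorem mem_adjoin_of_expansion {c : (ℕ × ℕ × ℕ) →₀ K} {z : B}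
    (hz : z = ∑ t ∈ c.support, c t • mono x s y t) {N : ℕ}
    (hc : ∀ t ∈ c.support, N ≤ t.1 ∧ t.2.1 = 0 ∧ t.2.2 = 0) :
    ∃ b ∈ Algebra.adjoin K {x}, z = b * x ^ N := by
  refine ⟨∑ t ∈ c.support, c t • x ^ (t.1 - N), ?_, ?_⟩
  · exact Subalgebra.sum_mem _ fun t _ =>
      Subalgebra.smul_mem _ (Subalgebra.pow_mem _ (Algebra.self_mem_adjoin_singleton K x) _) _
  · rw [hz, Finset.sum_mul]
    refine Finset.sum_congr rfl fun t ht => ?_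
    obtain ⟨h₁, h₂, h₃⟩ := hc t ht
    rw [mono, h₂, h₃, pow_zero, pow_zero, mul_one, mul_one, smul_mul_assoc, ← pow_add,
      Nat.sub_add_cancel h₁]

theorem exponents_of_expo_le (hd : 2 ≤ d) {t : ℕ × ℕ × ℕ} {r : ℤ}
    (h : expo n d t ≤ toLex (0, r)) : -r ≤ t.1 ∧ t.2.1 = 0 ∧ t.2.2 = 0 := by
  rw [expo, Prod.Lex.toLex_le_toLex] at h
  have h₁ : (0 : ℤ) ≤ d * t.2.2 := by positivity
  have h₂ : (t.2.1 + d * t.2.2 : ℤ) = 0 := by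
    rcases h with h | ⟨h, -⟩
    · simp only at h; omega
    · exact h
  have h₃ : t.2.1 = 0 := by omega
  have h₄ : t.2.2 = 0 := by
    have : (d * t.2.2 : ℤ) = 0 := by omega
    rcases mul_eq_zero.1 this with h | h <;> omega
  refine ⟨?_, h₃, h₄⟩
  rcases h with h | ⟨-, h⟩
  · simp only at h; omega
  · simp only [h₄, Nat.cast_zero, mul_zero] at h; omega

variable [CharZero K]

/-- The degree `(v, -u)` of a nonzero locally nilpotent derivation of a Danielewski algebra has
`v = -1`, and its leading component is a multiple of `∂ / ∂s`. -/
theorem exists_hasLead_of_isLND (h : IsDanielewski n d f x s y φ) (hn : 2 ≤ n) (hd : 2 ≤ d)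
    {E : Derivation K B B} (hE : IsLND E) (hE0 : E ≠ 0) :
    ∃ (β : K) (u : ℤ), β ≠ 0 ∧ ∀ (z : B) (q r : ℤ) (c : K), HasLead (φ z) (toLex (q, r)) c →
      HasLead (φ (E z)) (toLex (q - 1, r - u)) (β * q * c) := by
  obtain ⟨α, β, w, hαβ, hw⟩ := h.exists_hasLead_derivation hd hE0
  obtain ⟨v, u, rfl⟩ : ∃ v u : ℤ, w = toLex (v, -u) :=
    ⟨(ofLex w).1, -(ofLex w).2, by rw [neg_neg]; rfl⟩
  let ℓ : LexGrid →+ K :=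
    (AddMonoidHom.mulLeft α).comp (LexGrid.xExp K) + (AddMonoidHom.mulLeft β).comp (LexGrid.sExp K)
  have hℓ : ∀ q r : ℤ, ℓ (toLex (q, r)) = α * -(r : K) + β * (q : K) := fun q r => rfl
  have hw' : ∀ z m c, HasLead (φ z) m c → HasLead (φ (E z)) (m + toLex (v, -u)) (ℓ m * c) := hw
  obtain ⟨j, hj⟩ := exists_weight_eq_zero hE ℓ hw' h.hasLead_x
  obtain ⟨j', hj'⟩ := exists_weight_eq_zero hE ℓ hw' h.hasLead_s
  obtain ⟨j'', hj''⟩ := exists_weight_eq_zero hE ℓ hw' h.hasLead_y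
  set L := ℓ (toLex (v, -u)) with hL
  rw [hℓ] at hj hj' hj'' hL
  push_cast at hj hj' hj'' hL
  have hα : α = -(j * L) := by linear_combination hj
  have hβ : β = -(j' * L) := by linear_combination hj'
  have hL0 : L ≠ 0 := by
    intro h0
    simp [hα, hβ, h0] at hαβ
  have e₁ : (j * u + j' * v : ℤ) = -1 := by
    have : (j * u + j' * v : K) = -1 := by
      apply mul_left_cancel₀ hL0
      rw [hα, hβ] at hL
      linear_combination hL
    exact_mod_cast this
  have e₂ : (d * j' : ℤ) = n * j + j'' := by
    have : (d * j' : K) = n * j + j'' := by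
      apply mul_left_cancel₀ hL0
      rw [hα, hβ] at hj''
      linear_combination -hj''
    exact_mod_cast this
  have hfin : ∀ z : B, ∀ m c, c ≠ 0 → HasLead (φ z) m c →
      ∃ a i b : ℕ, i < d ∧ m = toLex ((i + d * b : ℤ), (n * b - a : ℤ)) := by
    intro z m c hc hz
    obtain ⟨C, -, hC, t, ht, -, hl⟩ := h.exists_expansion hd (z := z) (by
      rintro rfl
      exact hz.ne_zero hc (map_zero φ))
    exact ⟨t.1, t.2.1, t.2.2, hC t ht, hz.unique hl hc (Finsupp.mem_support_iff.1 ht)⟩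
  have hj0 : j = 0 := by
    by_contra hj0
    have hj'0 : j' ≠ 0 := by
      rintro rfl
      have : (n * j : ℤ) + j'' = 0 := by rw [← e₂]; simp
      have : 0 < (n * j : ℤ) := by positivity
      omega
    have hα0 : α ≠ 0 := by
      rw [hα]
      simp [hj0, hL0]
    have hβ0 : β ≠ 0 := by
      rw [hβ]
      simp [hj'0, hL0]
    obtain ⟨a₁, i₁, b₁, hi₁, hm₁⟩ := hfin (E x) _ _ (by simpa [hℓ] using hα0)
      (hw' _ _ _ h.hasLead_x)
    obtain ⟨a₂, i₂, b₂, hi₂, hm₂⟩ := hfin (E s) _ _ (by simpa [hℓ] using hβ0)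
      (hw' _ _ _ h.hasLead_s)
    rw [← toLex_add, Prod.mk_add_mk, EmbeddingLike.apply_eq_iff_eq, Prod.mk.injEq] at hm₁ hm₂
    obtain ⟨hv₁, hu₁⟩ := hm₁
    obtain ⟨hv₂, hu₂⟩ := hm₂
    have hv : 0 ≤ v := by rw [zero_add] at hv₁; rw [hv₁]; positivity
    have hneg : d * u + n * v < 0 := by
      by_contra! hnn
      have : (j : ℤ) * (d * u + n * v) ≤ -d := by
        have : (0 : ℤ) ≤ j'' * v := by positivity
        linear_combination this + d * e₁ - v * e₂
      have : 0 ≤ (j : ℤ) * (d * u + n * v) := by positivity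
      omega
    have hb : (b₂ : ℤ) = b₁ ∨ (b₂ : ℤ) = b₁ + 1 ∧ (i₁ : ℤ) = d - 1 := by
      have hs : (d : ℤ) * (b₂ - b₁) = i₁ + 1 - i₂ := by linear_combination hv₁ - hv₂
      have h0 : (-1 : ℤ) < b₂ - b₁ := by
        by_contra! hle
        nlinarith
      have h1 : (b₂ - b₁ : ℤ) < 2 := by
        by_contra! hle
        nlinarith
      rcases (show (b₂ - b₁ : ℤ) = 0 ∨ (b₂ - b₁ : ℤ) = 1 by omega) with hb | hb
      · left; omega
      · right
        rw [hb] at hs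
        omega
    have ha₁ : (0 : ℤ) ≤ a₁ := by positivity
    have ha₂ : (0 : ℤ) ≤ a₂ := by positivity
    have hi₁' : (0 : ℤ) ≤ i₁ := by positivity
    have hnZ : (2 : ℤ) ≤ n := by exact_mod_cast hn
    have hdZ : (2 : ℤ) ≤ d := by exact_mod_cast hd
    have hv₁' : v = i₁ + d * b₁ := by linarith
    rcases hb with hb | ⟨hb, hi⟩
    · have hu : u = a₂ - n * b₁ := by rw [← hb]; linarith
      rw [hu, hv₁'] at hneg
      nlinarith [mul_nonneg (show (0 : ℤ) ≤ d by omega) ha₂,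
        mul_nonneg (show (0 : ℤ) ≤ n by omega) hi₁']
    · have hu : u = a₁ - 1 - n * b₁ := by linarith
      rw [hu, hv₁', hi] at hneg
      nlinarith [mul_nonneg (show (0 : ℤ) ≤ d by omega) ha₁,
        mul_nonneg (show (0 : ℤ) ≤ (n : ℤ) - 2 by omega) (show (0 : ℤ) ≤ (d : ℤ) - 2 by omega)]
  subst hj0
  have hv : v = -1 := by
    have e₃ : (j' : ℤ) * v = -1 := by simpa using e₁
    rcases Int.mul_eq_neg_one_iff_eq_one_or_neg_one.1 e₃ with ⟨-, h⟩ | ⟨h, -⟩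
    · exact h
    · omega
  subst hv
  have hα0 : α = 0 := by simpa using hα
  subst hα0
  refine ⟨β, u, by simpa using hαβ, fun z q r c hz => ?_⟩
  refine (hw' z _ c hz).congr ?_ (by simp [hℓ])
  rw [← toLex_add, Prod.mk_add_mk]
  rfl

/-- The structure of nonzero locally nilpotent derivations of a Danielewski algebra. -/
theorem derivation_of_isLND (h : IsDanielewski n d f x s y φ) (hn : 2 ≤ n) (hd : 2 ≤ d)
    {E : Derivation K B B} (hE : IsLND E) (hE0 : E ≠ 0) :
    E x = 0 ∧ (∃ b ∈ Algebra.adjoin K {x}, E s = b * x ^ n) ∧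
      ∀ z, E z = 0 → z ∈ Algebra.adjoin K {x} := by
  obtain ⟨β, u, hβ, hw⟩ := h.exists_hasLead_of_isLND hn hd hE hE0
  refine ⟨?_, ?_, fun z hz => ?_⟩
  · by_contra hne
    obtain ⟨c, -, -, t, ht, -, hl⟩ := h.exists_expansion hd hne
    have hlt := (hw x _ _ _ h.hasLead_x).2 (expo n d t) (by
      rw [expo, Prod.Lex.toLex_lt_toLex]
      left
      have h₁ : (0 : ℤ) ≤ d * t.2.2 := by positivity
      simp only
      omega)
    rw [hl.1] at hlt
    exact Finsupp.mem_support_iff.1 ht hlt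
  · have hs := hw s _ _ _ h.hasLead_s
    have hy := hw y _ _ _ h.hasLead_y
    have hs0 : β * ((1 : ℤ) : K) * 1 ≠ 0 := by simpa using hβ
    have hy0 : β * ((d : ℤ) : K) * 1 ≠ 0 := by
      have : d ≠ 0 := by omega
      simpa [hβ] using this
    obtain ⟨c, hc, -, t, ht, hmax, hl⟩ := h.exists_expansion hd (z := E s) (by
      intro h0; rw [h0] at hs; exact hs.ne_zero hs0 (map_zero φ))
    obtain ⟨c', -, hi', t', ht', -, hl'⟩ := h.exists_expansion hd (z := E y) (by
      intro h0; rw [h0] at hy; exact hy.ne_zero hy0 (map_zero φ))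
    have e := hs.unique hl hs0 (Finsupp.mem_support_iff.1 ht)
    have e' := hy.unique hl' hy0 (Finsupp.mem_support_iff.1 ht')
    have hu : (n : ℤ) ≤ u := by
      rw [expo, EmbeddingLike.apply_eq_iff_eq, Prod.mk.injEq] at e'
      obtain ⟨e₁, e₂⟩ := e'
      have hb : t'.2.2 = 0 := by
        by_contra hb
        have : (d : ℤ) * 1 ≤ d * t'.2.2 := by
          refine mul_le_mul_of_nonneg_left ?_ (by positivity)
          omega
        omega
      simp only [hb, Nat.cast_zero, mul_zero] at e₂
      omega
    obtain ⟨b, hb, hb'⟩ := mem_adjoin_of_expansion hc (N := n) fun t₁ ht₁ => by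
      have hle := hmax t₁ ht₁
      rw [← e, sub_self] at hle
      obtain ⟨h₁, h₂⟩ := exponents_of_expo_le hd hle
      exact ⟨by omega, h₂⟩
    exact ⟨b, hb, hb'⟩
  · rcases eq_or_ne z 0 with rfl | hz0
    · exact Subalgebra.zero_mem _
    obtain ⟨c, hc, -, t, ht, hmax, hl⟩ := h.exists_expansion hd hz0
    have hw' := hw z _ _ _ hl
    rw [hz, map_zero] at hw'
    have hq : (t.2.1 + d * t.2.2 : ℤ) = 0 := by
      have h0 : (t.2.1 + d * t.2.2 : K) = 0 := by
        simpa [hβ, Finsupp.mem_support_iff.1 ht] using hw'.1.symm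
      exact_mod_cast h0
    obtain ⟨b, hb, hb'⟩ := mem_adjoin_of_expansion hc (N := 0) fun t₁ ht₁ => by
      have hle := hmax t₁ ht₁
      rw [expo.eq_def n d t, hq] at hle
      exact ⟨by omega, (exponents_of_expo_le hd hle).2⟩
    rwa [hb', pow_zero, mul_one]

end IsDanielewski

/-- The elements killed by a power of a derivation form a subalgebra. -/
def Derivation.nilSubalgebra {K B : Type*} [CommRing K] [CommRing B] [Algebra K B]
    (D : Derivation K B B) : Subalgebra K B where
  carrier := {a | ∃ n : ℕ, ((D.toLinearMap : Module.End K B) ^ n) a = 0}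
  mul_mem' := by
    have key : ∀ N i j : ℕ, i + j ≤ N → ∀ a b : B,
        ((D.toLinearMap : Module.End K B) ^ i) a = 0 →
        ((D.toLinearMap : Module.End K B) ^ j) b = 0 →
        ((D.toLinearMap : Module.End K B) ^ N) (a * b) = 0 := by
      intro N
      induction N with
      | zero =>
        intro i j hij a b ha _
        obtain rfl : i = 0 := by omega
        have ha' : a = 0 := ha
        simp [ha']
      | succ N ih =>
        intro i j hij a b ha hb
        rcases i with _ | i
        · have ha' : a = 0 := ha
          simp [ha']
        rcases j with _ | j
        · have hb' : b = 0 := hb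
          simp [hb']
        have e : D.toLinearMap (a * b) = a * D b + b * D a := D.leibniz a b
        rw [pow_succ, Module.End.mul_apply, e, map_add,
          ih (i + 1) j (by omega) a (D b) ha (by rw [pow_succ] at hb; exact hb),
          ih (j + 1) i (by omega) b (D a) hb (by rw [pow_succ] at ha; exact ha), add_zero]
    rintro a b ⟨i, hi⟩ ⟨j, hj⟩
    exact ⟨i + j, key _ i j le_rfl a b hi hj⟩
  add_mem' := by
    rintro a b ⟨i, hi⟩ ⟨j, hj⟩
    refine ⟨i + j, ?_⟩
    rw [map_add]
    nth_rewrite 1 [add_comm i j]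
    rw [pow_add, pow_add, Module.End.mul_apply, Module.End.mul_apply, hi, hj]
    simp
  algebraMap_mem' r := ⟨1, by simp⟩

theorem Derivation.mem_nilSubalgebra_of_apply {K B : Type*} [CommRing K] [CommRing B]
    [Algebra K B] (D : Derivation K B B) {a : B} (h : D a ∈ D.nilSubalgebra) :
    a ∈ D.nilSubalgebra := by
  obtain ⟨i, hi⟩ := h
  exact ⟨i + 1, by rw [pow_succ]; exact hi⟩

namespace DanRing

variable {K : Type*} [Field K] (n d : ℕ) (f : ℕ → Polynomial K)

/-- The quotient map onto the Danielewski ring. -/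
def mk : MvPolynomial (Fin 3) K →ₐ[K] DanRing K n d f :=
  Ideal.Quotient.mkₐ K (DanIdeal K n d f)

theorem mk_surjective : Function.Surjective (mk n d f) :=
  Ideal.Quotient.mk_surjective

theorem mk_eq_zero_iff (p : MvPolynomial (Fin 3) K) : mk n d f p = 0 ↔
    X 0 ^ n * X 2 - Ppoly K d f ∣ p :=
  Ideal.Quotient.eq_zero_iff_mem.trans Ideal.mem_span_singleton

theorem relation : mk n d f (X 0) ^ n * mk n d f (X 2) = mk n d f (X 1) ^ d +
    ∑ i ∈ Finset.range d, Polynomial.aeval (mk n d f (X 0)) (f i) * mk n d f (X 1) ^ i := by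
  have h := (mk_eq_zero_iff n d f _).2 dvd_rfl
  simpa [Ppoly, sub_eq_zero, ← Polynomial.aeval_algHom_apply] using h

theorem adjoin_eq_top :
    Algebra.adjoin K {mk n d f (X 0), mk n d f (X 1), mk n d f (X 2)} = ⊤ := by
  have h := congrArg (Subalgebra.map (mk n d f)) (MvPolynomial.adjoin_range_X (R := K) (σ := Fin 3))
  rw [AlgHom.map_adjoin, Algebra.map_top, (AlgHom.range_eq_top _).2 (mk_surjective n d f)] at h
  rw [← h]
  congr 1
  ext b
  simp [Fin.exists_fin_succ, eq_comm]

/-- The images of `X`, `S` and `Y` in the Laurent polynomials in two variables. -/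
def laurentGen : Fin 3 → AddMonoidAlgebra K LexGrid :=
  ![.single (toLex (0, -1)) 1, .single (toLex (1, 0)) 1,
    .single (toLex (0, (n : ℤ))) 1 * (.single (toLex (1, 0)) 1 ^ d + ∑ i ∈ Finset.range d,
      Polynomial.aeval (.single (toLex (0, -1)) 1 : AddMonoidAlgebra K LexGrid) (f i) *
        .single (toLex (1, 0)) 1 ^ i)]

theorem aeval_laurentGen_relation :
    aeval (laurentGen n d f) (X 0 ^ n * X 2 - Ppoly K d f) = 0 := by
  have h : (AddMonoidAlgebra.single (toLex (0, -1)) 1 : AddMonoidAlgebra K LexGrid) ^ n *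
      AddMonoidAlgebra.single (toLex (0, (n : ℤ))) 1 = 1 := by
    rw [AddMonoidAlgebra.single_pow, AddMonoidAlgebra.single_mul_single,
      AddMonoidAlgebra.one_def, LexGrid.nsmul_toLex, ← toLex_add]
    simp
    rfl
  simp only [Ppoly, map_sub, map_mul, map_pow, map_add, map_sum, aeval_X,
    ← Polynomial.aeval_algHom_apply]
  simp only [laurentGen, Matrix.cons_val]
  rw [← mul_assoc, h, one_mul, sub_self]

/-- The embedding of the Danielewski ring in the Laurent polynomials in `x` and `s`. -/
def toLaurent : DanRing K n d f →ₐ[K] AddMonoidAlgebra K LexGrid :=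
  Ideal.Quotient.liftₐ (DanIdeal K n d f) (aeval (laurentGen n d f)) fun p hp => by
    obtain ⟨q, rfl⟩ := Ideal.mem_span_singleton.1 hp
    rw [map_mul, aeval_laurentGen_relation, zero_mul]

theorem toLaurent_mk (p : MvPolynomial (Fin 3) K) :
    toLaurent n d f (mk n d f p) = aeval (laurentGen n d f) p := rfl

theorem isDanielewski : IsDanielewski n d f (mk n d f (X 0)) (mk n d f (X 1)) (mk n d f (X 2))
    (toLaurent n d f) where
  rel := relation n d f
  gen := adjoin_eq_top n d f
  map_x := by rw [toLaurent_mk, aeval_X]; rfl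
  map_s := by rw [toLaurent_mk, aeval_X]; rfl

/-- The partial derivative of `P` with respect to `S`. -/
def partialS : MvPolynomial (Fin 3) K :=
  (d : MvPolynomial (Fin 3) K) * X 1 ^ (d - 1) + ∑ i ∈ Finset.range d,
    (i : MvPolynomial (Fin 3) K) * Polynomial.aeval (X 0) (f i) * X 1 ^ (i - 1)

/-- The derivation `X ↦ 0`, `S ↦ X ^ n`, `Y ↦ ∂P/∂S` of the polynomial ring. -/
def polyDer : Derivation K (MvPolynomial (Fin 3) K) (MvPolynomial (Fin 3) K) :=
  mkDerivation K ![0, X 0 ^ n, partialS d f]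

theorem polyDer_relation : polyDer n d f (X 0 ^ n * X 2 - Ppoly K d f) = 0 := by
  have h₀ : polyDer n d f (X 0) = 0 := mkDerivation_X _ _ _
  have h₁ : polyDer n d f (X 1) = X 0 ^ n := mkDerivation_X _ _ _
  have h₂ : polyDer n d f (X 2) = partialS d f := mkDerivation_X _ _ _
  have h₃ : ∀ p : Polynomial K, polyDer n d f (Polynomial.aeval (X 0) p) = 0 := fun p => by
    rw [Derivation.map_aeval, h₀, smul_zero]
  simp only [Ppoly, partialS, map_sub, map_add, map_sum, Derivation.leibniz,
    Derivation.leibniz_pow, h₀, h₁, h₂, h₃, smul_eq_mul, nsmul_eq_mul, mul_zero, add_zero]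
  rw [mul_add, Finset.mul_sum, sub_eq_zero]
  congr 1
  · ring
  · exact Finset.sum_congr rfl fun i _ => by ring

theorem mk_polyDer_eq_zero (p : MvPolynomial (Fin 3) K) (hp : mk n d f p = 0) :
    mk n d f (polyDer n d f p) = 0 := by
  obtain ⟨q, rfl⟩ := (mk_eq_zero_iff n d f p).1 hp
  rw [Derivation.leibniz, polyDer_relation, smul_zero, add_zero, smul_eq_mul, map_mul,
    (mk_eq_zero_iff n d f _).2 dvd_rfl, zero_mul]

/-- The locally nilpotent derivation `x ↦ 0`, `s ↦ x ^ n`, `y ↦ ∂P/∂S` of the Danielewski ring. -/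
def der : Derivation K (DanRing K n d f) (DanRing K n d f) :=
  Derivation.liftOfSurjective (f := mk n d f) (mk_surjective n d f) (d := polyDer n d f)
    (mk_polyDer_eq_zero n d f)

theorem der_mk (p : MvPolynomial (Fin 3) K) :
    der n d f (mk n d f p) = mk n d f (polyDer n d f p) :=
  Derivation.liftOfSurjective_apply (f := mk n d f) (mk_surjective n d f)
    (hd := mk_polyDer_eq_zero n d f) p

theorem der_x : der n d f (mk n d f (X 0)) = 0 := by
  rw [der_mk, polyDer, mkDerivation_X]
  simp

theorem der_s : der n d f (mk n d f (X 1)) = mk n d f (X 0) ^ n := by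
  rw [der_mk, polyDer, mkDerivation_X]
  simp

theorem der_y : der n d f (mk n d f (X 2)) =
    (d : DanRing K n d f) * mk n d f (X 1) ^ (d - 1) + ∑ i ∈ Finset.range d,
      (i : DanRing K n d f) * Polynomial.aeval (mk n d f (X 0)) (f i) *
        mk n d f (X 1) ^ (i - 1) := by
  rw [der_mk, polyDer, mkDerivation_X]
  simp [partialS, ← Polynomial.aeval_algHom_apply]

theorem isLND_der : IsLND (der n d f) := by
  have hx : mk n d f (X 0) ∈ (der n d f).nilSubalgebra :=
    ⟨1, by rw [pow_one]; exact der_x n d f⟩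
  have hs : mk n d f (X 1) ∈ (der n d f).nilSubalgebra :=
    Derivation.mem_nilSubalgebra_of_apply _ (by rw [der_s]; exact Subalgebra.pow_mem _ hx _)
  have hp : ∀ p : Polynomial K,
      Polynomial.aeval (mk n d f (X 0)) p ∈ (der n d f).nilSubalgebra := fun p =>
    Algebra.adjoin_le (by simpa using hx) (Polynomial.aeval_mem_adjoin_singleton K _)
  have hy : mk n d f (X 2) ∈ (der n d f).nilSubalgebra := by
    refine Derivation.mem_nilSubalgebra_of_apply _ ?_
    rw [der_y]
    exact Subalgebra.add_mem _ (Subalgebra.mul_mem _ (natCast_mem _ _) (Subalgebra.pow_mem _ hs _))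
      (Subalgebra.sum_mem _ fun i _ => Subalgebra.mul_mem _
        (Subalgebra.mul_mem _ (natCast_mem _ _) (hp _)) (Subalgebra.pow_mem _ hs _))
  have h : Algebra.adjoin K {mk n d f (X 0), mk n d f (X 1), mk n d f (X 2)} ≤
      (der n d f).nilSubalgebra := Algebra.adjoin_le fun w hw => by
    rcases hw with rfl | rfl | rfl
    exacts [hx, hs, hy]
  rw [adjoin_eq_top] at h
  exact fun a => h (Algebra.mem_top (x := a))

theorem der_ne_zero : der n d f ≠ 0 := by
  intro h
  have h₁ := congrArg (toLaurent n d f) (der_s n d f)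
  rw [h, Derivation.zero_apply, map_zero, map_pow] at h₁
  have h₂ := (isDanielewski n d f).single_mul_map_x_pow n
  rw [← h₁, mul_zero] at h₂
  exact zero_ne_one h₂

end DanRing

theorem stmt3 (n d : ℕ) (hn : 2 ≤ n) (hd : 2 ≤ d) (f : ℕ → Polynomial k) :
    ∀ (x s y : DanRing k n d f),
      x = Ideal.Quotient.mk (DanIdeal k n d f) (X 0) →
      s = Ideal.Quotient.mk (DanIdeal k n d f) (X 1) →
      y = Ideal.Quotient.mk (DanIdeal k n d f) (X 2) →
      -- the Makar-Limanov invariant is k[x]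
      ML k (DanRing k n d f) = ((Algebra.adjoin k {x} : Subalgebra k (DanRing k n d f)) : Set (DanRing k n d f)) ∧
      -- there is a locally nilpotent derivation ∂ with ∂x = 0, ∂s = xⁿ, ∂y = (∂P/∂S)(x,s),
      -- and every locally nilpotent derivation is f(x)·∂; in particular B_{n,P} is almost rigid
      ∃ D : Derivation k (DanRing k n d f) (DanRing k n d f),
        IsLND D ∧ D x = 0 ∧ D s = x ^ n ∧
        D y = (d : DanRing k n d f) * s ^ (d - 1) +
          ∑ i ∈ Finset.range d, (i : DanRing k n d f) * Polynomial.aeval x (f i) * s ^ (i - 1) ∧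
        ∀ E : Derivation k (DanRing k n d f) (DanRing k n d f), IsLND E →
          ∃ c : DanRing k n d f, c ∈ Algebra.adjoin k {x} ∧ E = c • D := by
  rintro x s y rfl rfl rfl
  have h := DanRing.isDanielewski n d f
  have hkill : ∀ E : Derivation k (DanRing k n d f) (DanRing k n d f), IsLND E →
      E (DanRing.mk n d f (X 0)) = 0 := by
    intro E hE
    rcases eq_or_ne E 0 with rfl | hE0
    · rfl
    · exact (h.derivation_of_isLND hn hd hE hE0).1
  refine ⟨Set.Subset.antisymm (fun b hb => ?_) fun b hb D hD => ?_, DanRing.der n d f,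
    DanRing.isLND_der n d f, DanRing.der_x n d f, DanRing.der_s n d f, DanRing.der_y n d f,
    fun E hE => ?_⟩
  · exact (h.derivation_of_isLND hn hd (DanRing.isLND_der n d f)
      (DanRing.der_ne_zero n d f)).2.2 b (hb _ (DanRing.isLND_der n d f))
  · obtain ⟨p, rfl⟩ := Algebra.adjoin_singleton_eq_range_aeval k (DanRing.mk n d f (X 0)) ▸ hb
    refine (Derivation.map_aeval D p _).trans ?_
    exact (congrArg _ (hkill D hD)).trans (smul_zero _)
  · rcases eq_or_ne E 0 with rfl | hE0
    · exact ⟨0, Subalgebra.zero_mem _, (zero_smul _ _).symm⟩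
    · obtain ⟨hx, ⟨c, hc, hs⟩, -⟩ := h.derivation_of_isLND hn hd hE hE0
      refine ⟨c, hc, h.derivation_ext hd ?_ ?_⟩
      · rw [hx, Derivation.smul_apply, DanRing.der_x, smul_zero]
      · rw [hs, Derivation.smul_apply, DanRing.der_s, smul_eq_mul]
end
end

section
/- Let R = R_{n,e,P,Q} with x, y, z the classes of X, Y, Z and s := Q(x,y) − x^e z. Then the rule ∂(x) = 0, ∂(y) = x^e (∂P/∂S)(x,s), ∂(z) = (∂Q/∂Y)(x,y)·(∂P/∂S)(x,s) − x^n defines a locally nilpotent k-derivation ∂ of R with ∂(s) = x^{n+e} and ker ∂ = k[x], and the ∂-filtration F_r = ker ∂^{r+1} is given as follows: for every r ∈ ℕ, writing r = mdi + dj + l with i ∈ ℕ, j ∈ {0,…,m−1}, l ∈ {0,…,d−1}, one has F_r = k[x]·s^l y^j z^i + F_{r−1} (with F_{−1} = 0); equivalently F_r is the k[x]-submodule of R spanned by the monomials s^{l'} y^{j'} z^{i'} with mdi' + dj' + l' ≤ r, i' ∈ ℕ, j' ∈ {0,…,m−1}, l' ∈ {0,…,d−1}. -/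
open MvPolynomial

noncomputable section

variable (k : Type*) [Field k] [CharZero k]

/-- `P(X,T) = T^d + f_{d-1}(X) T^{d-1} + ⋯ + f_0(X)` evaluated at `T`, inside `k[X,Y,Z]`
(the variable `X` has index 0). -/
def Pat (d : ℕ) (f : ℕ → Polynomial k) (T : MvPolynomial (Fin 3) k) :
    MvPolynomial (Fin 3) k :=
  T ^ d + ∑ i ∈ Finset.range d, Polynomial.aeval (X 0) (f i) * T ^ i

/-- `Q(X,Y) = Y^m + g_{m-1}(X) Y^{m-1} + ⋯ + g_0(X)` in `k[X,Y,Z]`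
(variables `X = 0`, `Y = 1`, `Z = 2`). -/
def Qpoly (m : ℕ) (g : ℕ → Polynomial k) : MvPolynomial (Fin 3) k :=
  X 1 ^ m + ∑ j ∈ Finset.range m, Polynomial.aeval (X 0) (g j) * X 1 ^ j

/-- The ideal `⟨XⁿY - P(X, Q(X,Y) - XᵉZ)⟩` of `k[X,Y,Z]` (variables `X = 0`, `Y = 1`, `Z = 2`). -/
def RIdeal (n e d m : ℕ) (f g : ℕ → Polynomial k) : Ideal (MvPolynomial (Fin 3) k) :=
  Ideal.span {X 0 ^ n * X 1 - Pat k d f (Qpoly k m g - X 0 ^ e * X 2)}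

/-- `R_{n,e,P,Q} = k[X,Y,Z]/⟨XⁿY - P(X, Q(X,Y) - XᵉZ)⟩`. -/
def RRing (n e d m : ℕ) (f g : ℕ → Polynomial k) : Type _ :=
  MvPolynomial (Fin 3) k ⧸ RIdeal k n e d m f g

instance (n e d m : ℕ) (f g : ℕ → Polynomial k) : CommRing (RRing k n e d m f g) :=
  Ideal.Quotient.commRing _

instance (n e d m : ℕ) (f g : ℕ → Polynomial k) : Algebra k (RRing k n e d m f g) :=
  Ideal.Quotient.algebra k

variable (n e d m : ℕ) (f g : ℕ → Polynomial k)

/-- The class `x` of `X` in `R_{n,e,P,Q}`. -/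
def xel : RRing k n e d m f g := Ideal.Quotient.mk _ (X 0)

/-- The class `y` of `Y` in `R_{n,e,P,Q}`. -/
def yel : RRing k n e d m f g := Ideal.Quotient.mk _ (X 1)

/-- The class `z` of `Z` in `R_{n,e,P,Q}`. -/
def zel : RRing k n e d m f g := Ideal.Quotient.mk _ (X 2)

/-- The element `s = Q(x,y) - xᵉz` of `R_{n,e,P,Q}`. -/
def sel : RRing k n e d m f g := Ideal.Quotient.mk _ (Qpoly k m g - X 0 ^ e * X 2)

/-- `(∂P/∂S)(x,s)` in `R_{n,e,P,Q}`. -/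
def PSel : RRing k n e d m f g :=
  (d : RRing k n e d m f g) * sel k n e d m f g ^ (d - 1) +
    ∑ i ∈ Finset.range d, (i : RRing k n e d m f g) *
      Polynomial.aeval (xel k n e d m f g) (f i) * sel k n e d m f g ^ (i - 1)

/-- `(∂Q/∂Y)(x,y)` in `R_{n,e,P,Q}`. -/
def QYel : RRing k n e d m f g :=
  (m : RRing k n e d m f g) * yel k n e d m f g ^ (m - 1) +
    ∑ j ∈ Finset.range m, (j : RRing k n e d m f g) *
      Polynomial.aeval (xel k n e d m f g) (g j) * yel k n e d m f g ^ (j - 1)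

end

section filtration

variable {k R K : Type*} [Field k] [CommRing R] [Algebra k R] [Field K] [Algebra k K]

lemma Polynomial.natDegree_X_pow_add_sum (d : ℕ) (a : ℕ → K) :
    (Polynomial.X ^ d + ∑ i ∈ Finset.range d, Polynomial.C (a i) * Polynomial.X ^ i).natDegree
      = d := by
  suffices h : (∑ i ∈ Finset.range d,
      Polynomial.C (a i) * Polynomial.X ^ i : Polynomial K).degree < d by
    refine Polynomial.natDegree_eq_of_degree_eq_some ?_
    rw [Polynomial.degree_add_eq_left_of_degree_lt] <;> rw [Polynomial.degree_X_pow]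
    exact h
  rw [← Polynomial.mem_degreeLT]
  refine Submodule.sum_mem _ fun i hi => ?_
  rw [Polynomial.mem_degreeLT]
  refine (Polynomial.degree_C_mul_X_pow_le _ _).trans_lt ?_
  exact_mod_cast Finset.mem_range.1 hi

lemma Polynomial.natDegree_pow_add_sum (d : ℕ) (a : ℕ → K) (q : Polynomial K) :
    (q ^ d + ∑ i ∈ Finset.range d, Polynomial.C (a i) * q ^ i).natDegree = d * q.natDegree := by
  have h : q ^ d + ∑ i ∈ Finset.range d, Polynomial.C (a i) * q ^ i =
      (Polynomial.X ^ d +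
        ∑ i ∈ Finset.range d, Polynomial.C (a i) * Polynomial.X ^ i).comp q := by
    simp [Polynomial.sum_comp]
  rw [h, Polynomial.natDegree_comp, Polynomial.natDegree_X_pow_add_sum]

lemma Polynomial.iterate_derivative_succ_eq_zero_iff [CharZero K] (p : Polynomial K) (r : ℕ) :
    Polynomial.derivative^[r + 1] p = 0 ↔ p.natDegree ≤ r := by
  refine ⟨fun h => ?_, fun h => Polynomial.iterate_derivative_eq_zero (Nat.lt_succ_of_le h)⟩
  by_contra! hlt
  have hc := congrArg (fun q => q.coeff (p.natDegree - (r + 1))) h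
  simp only [Polynomial.coeff_iterate_derivative, Polynomial.coeff_zero,
    Nat.sub_add_cancel (Nat.succ_le_of_lt hlt), nsmul_eq_mul, mul_eq_zero, Nat.cast_eq_zero,
    Nat.descFactorial_eq_zero_iff_lt] at hc
  rcases hc with hc | hc
  · omega
  · rw [Polynomial.coeff_natDegree, Polynomial.leadingCoeff_eq_zero] at hc
    simp [hc] at hlt

/-- The span of the reduced monomials `xᵃ sˡ yʲ zⁱ` of weight at most `r`. -/
def weightSpan (k : Type*) {R : Type*} [Field k] [CommRing R] [Algebra k R]
    (d m : ℕ) (x y z s : R) (r : ℕ) : Submodule k R :=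
  Submodule.span k {w : R | ∃ a i j l : ℕ, j < m ∧ l < d ∧ m * d * i + d * j + l ≤ r ∧
    w = x ^ a * s ^ l * y ^ j * z ^ i}

/-- The span of all reduced monomials `xᵃ sˡ yʲ zⁱ`. -/
def reducedSpan (k : Type*) {R : Type*} [Field k] [CommRing R] [Algebra k R]
    (d m : ℕ) (x y z s : R) : Submodule k R :=
  Submodule.span k {w : R | ∃ a i j l : ℕ, j < m ∧ l < d ∧
    w = x ^ a * s ^ l * y ^ j * z ^ i}

lemma weightSpan_mono {d m : ℕ} {x y z s : R} {r r' : ℕ} (h : r ≤ r') :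
    weightSpan k d m x y z s r ≤ weightSpan k d m x y z s r' := by
  refine Submodule.span_mono ?_
  rintro w ⟨a, i, j, l, hj, hl, hw, rfl⟩
  exact ⟨a, i, j, l, hj, hl, hw.trans h, rfl⟩

lemma exists_mem_weightSpan {d m : ℕ} {x y z s w : R} (hw : w ∈ reducedSpan k d m x y z s) :
    ∃ r, w ∈ weightSpan k d m x y z s r := by
  induction hw using Submodule.span_induction with
  | mem w h =>
    obtain ⟨a, i, j, l, hj, hl, rfl⟩ := h
    exact ⟨_, Submodule.subset_span ⟨a, i, j, l, hj, hl, le_rfl, rfl⟩⟩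
  | zero => exact ⟨0, zero_mem _⟩
  | add u v _ _ hu hv =>
    obtain ⟨a, ha⟩ := hu
    obtain ⟨b, hb⟩ := hv
    exact ⟨max a b, add_mem (weightSpan_mono (le_max_left a b) ha)
      (weightSpan_mono (le_max_right a b) hb)⟩
  | smul c u _ hu =>
    obtain ⟨a, ha⟩ := hu
    exact ⟨a, Submodule.smul_mem _ _ ha⟩

/-- To multiply `reducedSpan` into itself by `u`, it suffices to treat reduced monomials. -/
lemma mul_mem_reducedSpan_of_monomial {d m : ℕ} {x y z s u : R}
    (h : ∀ i j l : ℕ, j < m → l < d →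
      ∀ a, u * (x ^ a * s ^ l * y ^ j * z ^ i) ∈ reducedSpan k d m x y z s)
    {w : R} (hw : w ∈ reducedSpan k d m x y z s) : u * w ∈ reducedSpan k d m x y z s := by
  induction hw using Submodule.span_induction with
  | mem w hw =>
    obtain ⟨a, i, j, l, hj, hl, rfl⟩ := hw
    exact h i j l hj hl a
  | zero => simp
  | add u v _ _ hu hv => rw [mul_add]; exact add_mem hu hv
  | smul c u _ hu => rw [mul_smul_comm]; exact Submodule.smul_mem _ _ hu

lemma monomial_mem_reducedSpan {d m : ℕ} {x y z s : R} {j l : ℕ} (a i : ℕ) (hj : j < m)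
    (hl : l < d) : x ^ a * s ^ l * y ^ j * z ^ i ∈ reducedSpan k d m x y z s :=
  Submodule.subset_span ⟨a, i, j, l, hj, hl, rfl⟩

lemma x_mul_mem_reducedSpan {d m : ℕ} {x y z s w : R} (hw : w ∈ reducedSpan k d m x y z s) :
    x * w ∈ reducedSpan k d m x y z s := by
  refine mul_mem_reducedSpan_of_monomial (fun i j l hj hl a => ?_) hw
  convert monomial_mem_reducedSpan (k := k) (x := x) (y := y) (z := z) (s := s) (a + 1) i hj hl
    using 1
  ring

lemma z_mul_mem_reducedSpan {d m : ℕ} {x y z s w : R} (hw : w ∈ reducedSpan k d m x y z s) :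
    z * w ∈ reducedSpan k d m x y z s := by
  refine mul_mem_reducedSpan_of_monomial (fun i j l hj hl a => ?_) hw
  convert monomial_mem_reducedSpan (k := k) (x := x) (y := y) (z := z) (s := s) a (i + 1) hj hl
    using 1
  ring

lemma aeval_mul_mem_of_mul_mem {U : Submodule k R} {x : R} (hx : ∀ w ∈ U, x * w ∈ U)
    (p : Polynomial k) {w : R} (hw : w ∈ U) : Polynomial.aeval x p * w ∈ U := by
  have hpow : ∀ a : ℕ, x ^ a * w ∈ U := by
    intro a
    induction a with
    | zero => simpa using hw
    | succ a ih => rw [pow_succ', mul_assoc]; exact hx _ ih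
  induction p using Polynomial.induction_on' with
  | add p q hp hq => rw [map_add, add_mul]; exact add_mem hp hq
  | monomial a c =>
    rw [Polynomial.aeval_monomial, mul_assoc, ← Algebra.smul_def]
    exact Submodule.smul_mem _ _ (hpow a)

lemma aeval_mul_mem_reducedSpan {d m : ℕ} {x y z s w : R} (p : Polynomial k)
    (hw : w ∈ reducedSpan k d m x y z s) :
    Polynomial.aeval x p * w ∈ reducedSpan k d m x y z s :=
  aeval_mul_mem_of_mul_mem (fun _ => x_mul_mem_reducedSpan) p hw

lemma pow_mul_mem_reducedSpan {d m : ℕ} {x y z s w : R} (a : ℕ)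
    (hw : w ∈ reducedSpan k d m x y z s) : x ^ a * w ∈ reducedSpan k d m x y z s := by
  simpa using aeval_mul_mem_reducedSpan (Polynomial.X ^ a) hw

section relations

variable {n e d m : ℕ} {f g : ℕ → Polynomial k} {x y z s : R}

lemma y_mul_yz_mem_reducedSpan (hd : 2 ≤ d) (hm : 2 ≤ m)
    (hQ : x ^ e * z = y ^ m + ∑ j ∈ Finset.range m, Polynomial.aeval x (g j) * y ^ j - s)
    (a i : ℕ) {j : ℕ} (hj : j < m) :
    x ^ a * y ^ (j + 1) * z ^ i ∈ reducedSpan k d m x y z s := by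
  rw [mul_assoc]
  apply pow_mul_mem_reducedSpan
  have h0 : ∀ i j, j < m → y ^ j * z ^ i ∈ reducedSpan k d m x y z s := fun i j hj => by
    simpa using monomial_mem_reducedSpan (k := k) (x := x) (y := y) (z := z) (s := s) 0 i hj
      (show 0 < d by omega)
  rcases Nat.lt_or_ge (j + 1) m with h | h
  · exact h0 i _ h
  · obtain rfl : m = j + 1 := by omega
    have hs : s * z ^ i ∈ reducedSpan k d (j + 1) x y z s := by
      simpa using monomial_mem_reducedSpan (k := k) (x := x) (y := y) (z := z) (s := s) 0 i
        (show 0 < j + 1 by omega) (show 1 < d by omega)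
    have hz : z ^ (i + 1) ∈ reducedSpan k d (j + 1) x y z s := by
      simpa using h0 (i + 1) 0 (by omega)
    have key : y ^ (j + 1) * z ^ i = x ^ e * z ^ (i + 1) + s * z ^ i -
        ∑ j ∈ Finset.range (j + 1), Polynomial.aeval x (g j) * (y ^ j * z ^ i) := by
      simp only [← mul_assoc, ← Finset.sum_mul]
      linear_combination -z ^ i * hQ
    rw [key]
    refine sub_mem (add_mem (pow_mul_mem_reducedSpan _ hz) hs) (sum_mem fun b hb => ?_)
    exact aeval_mul_mem_reducedSpan _ (h0 i b (Finset.mem_range.1 hb))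

lemma s_mul_mem_reducedSpan (hd : 2 ≤ d) (hm : 2 ≤ m)
    (hP : x ^ n * y = s ^ d + ∑ i ∈ Finset.range d, Polynomial.aeval x (f i) * s ^ i)
    (hQ : x ^ e * z = y ^ m + ∑ j ∈ Finset.range m, Polynomial.aeval x (g j) * y ^ j - s)
    {w : R} (hw : w ∈ reducedSpan k d m x y z s) : s * w ∈ reducedSpan k d m x y z s := by
  refine mul_mem_reducedSpan_of_monomial (fun i j l hj hl a => ?_) hw
  have h : s * (x ^ a * s ^ l * y ^ j * z ^ i) = x ^ a * (s ^ (l + 1) * y ^ j * z ^ i) := by ring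
  rw [h]
  apply pow_mul_mem_reducedSpan
  have h0 : ∀ l, l < d → s ^ l * y ^ j * z ^ i ∈ reducedSpan k d m x y z s := fun l hl => by
    simpa using monomial_mem_reducedSpan (k := k) (x := x) (y := y) (z := z) (s := s) 0 i hj hl
  rcases Nat.lt_or_ge (l + 1) d with h | h
  · exact h0 _ h
  · obtain rfl : d = l + 1 := by omega
    have key : s ^ (l + 1) * y ^ j * z ^ i = x ^ n * y ^ (j + 1) * z ^ i -
        ∑ b ∈ Finset.range (l + 1), Polynomial.aeval x (f b) * (s ^ b * y ^ j * z ^ i) := by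
      simp only [← mul_assoc, ← Finset.sum_mul]
      linear_combination -y ^ j * z ^ i * hP
    rw [key]
    refine sub_mem (y_mul_yz_mem_reducedSpan hd hm hQ n i hj) (sum_mem fun b hb => ?_)
    exact aeval_mul_mem_reducedSpan _ (h0 b (Finset.mem_range.1 hb))

lemma y_mul_mem_reducedSpan (hd : 2 ≤ d) (hm : 2 ≤ m)
    (hP : x ^ n * y = s ^ d + ∑ i ∈ Finset.range d, Polynomial.aeval x (f i) * s ^ i)
    (hQ : x ^ e * z = y ^ m + ∑ j ∈ Finset.range m, Polynomial.aeval x (g j) * y ^ j - s)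
    {w : R} (hw : w ∈ reducedSpan k d m x y z s) : y * w ∈ reducedSpan k d m x y z s := by
  refine mul_mem_reducedSpan_of_monomial (fun i j l hj hl a => ?_) hw
  have h : y * (x ^ a * s ^ l * y ^ j * z ^ i) = s ^ l * (x ^ a * y ^ (j + 1) * z ^ i) := by ring
  rw [h]
  clear h hl
  induction l with
  | zero => simpa using y_mul_yz_mem_reducedSpan hd hm hQ a i hj
  | succ l ih =>
    rw [pow_succ', mul_assoc]
    exact s_mul_mem_reducedSpan hd hm hP hQ ih

lemma mem_reducedSpan (hd : 2 ≤ d) (hm : 2 ≤ m)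
    (hgen : Algebra.adjoin k {x, y, z} = ⊤)
    (hP : x ^ n * y = s ^ d + ∑ i ∈ Finset.range d, Polynomial.aeval x (f i) * s ^ i)
    (hQ : x ^ e * z = y ^ m + ∑ j ∈ Finset.range m, Polynomial.aeval x (g j) * y ^ j - s)
    (w : R) : w ∈ reducedSpan k d m x y z s := by
  have h1 : (1 : R) ∈ reducedSpan k d m x y z s := by
    simpa using monomial_mem_reducedSpan (k := k) (x := x) (y := y) (z := z) (s := s) 0 0
      (show 0 < m by omega) (show 0 < d by omega)
  suffices h : ∀ v ∈ reducedSpan k d m x y z s, w * v ∈ reducedSpan k d m x y z s by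
    simpa using h 1 h1
  have hw : w ∈ Algebra.adjoin k {x, y, z} := hgen ▸ Algebra.mem_top
  induction hw using Algebra.adjoin_induction with
  | mem u hu =>
    intro v hv
    rcases hu with rfl | rfl | rfl
    · exact x_mul_mem_reducedSpan hv
    · exact y_mul_mem_reducedSpan hd hm hP hQ hv
    · exact z_mul_mem_reducedSpan hv
  | algebraMap c =>
    intro v hv
    rw [← Algebra.smul_def]
    exact Submodule.smul_mem _ _ hv
  | add a b _ _ ha hb => intro v hv; rw [add_mul]; exact add_mem (ha v hv) (hb v hv)
  | mul a b _ _ ha hb => intro v hv; rw [mul_assoc]; exact ha _ (hb v hv)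

variable {φ : R →ₐ[k] Polynomial K} {t : K}

lemma natDegree_map_y (ht : t ≠ 0) (hφx : φ x = Polynomial.C t) (hφs : φ s = Polynomial.X)
    (hP : x ^ n * y = s ^ d + ∑ i ∈ Finset.range d, Polynomial.aeval x (f i) * s ^ i) :
    (φ y).natDegree = d := by
  have h := congrArg φ hP
  have hC : ∀ p : Polynomial k, Polynomial.aeval (Polynomial.C t) p =
      Polynomial.C (Polynomial.aeval t p) := fun p => by
    simpa using Polynomial.aeval_algebraMap_apply (Polynomial K) t p
  simp only [map_mul, map_pow, hφx, map_add, hφs, map_sum, ← Polynomial.aeval_algHom_apply,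
    hC] at h
  rw [← Polynomial.C_pow] at h
  rw [← Polynomial.natDegree_C_mul (pow_ne_zero n ht), h, Polynomial.natDegree_X_pow_add_sum]

lemma natDegree_map_z (hd : 2 ≤ d) (hm : 2 ≤ m) (ht : t ≠ 0) (hφx : φ x = Polynomial.C t)
    (hφs : φ s = Polynomial.X) (hy : (φ y).natDegree = d)
    (hQ : x ^ e * z = y ^ m + ∑ j ∈ Finset.range m, Polynomial.aeval x (g j) * y ^ j - s) :
    (φ z).natDegree = m * d := by
  have h := congrArg φ hQ
  have hC : ∀ p : Polynomial k, Polynomial.aeval (Polynomial.C t) p =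
      Polynomial.C (Polynomial.aeval t p) := fun p => by
    simpa using Polynomial.aeval_algebraMap_apply (Polynomial K) t p
  simp only [map_mul, map_pow, hφx, map_add, map_sub, hφs, map_sum,
    ← Polynomial.aeval_algHom_apply, hC] at h
  rw [← Polynomial.C_pow] at h
  rw [← Polynomial.natDegree_C_mul (pow_ne_zero e ht), h,
    Polynomial.natDegree_sub_eq_left_of_natDegree_lt] <;>
  rw [Polynomial.natDegree_pow_add_sum, hy]
  rw [Polynomial.natDegree_X]
  nlinarith

lemma map_monomial_natDegree (ht : t ≠ 0) (hφx : φ x = Polynomial.C t)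
    (hφs : φ s = Polynomial.X) (hd : 2 ≤ d) (hm : 2 ≤ m) (hy : (φ y).natDegree = d)
    (hz : (φ z).natDegree = m * d) (a i j l : ℕ) :
    (φ (x ^ a * s ^ l * y ^ j * z ^ i)).natDegree = m * d * i + d * j + l ∧
      φ (x ^ a * s ^ l * y ^ j * z ^ i) ≠ 0 := by
  have hy0 : φ y ≠ 0 := by rintro h; simp [h] at hy; omega
  have hz0 : φ z ≠ 0 := by
    rintro h
    rw [h, Polynomial.natDegree_zero] at hz
    nlinarith
  have hx0 : (Polynomial.C t : Polynomial K) ≠ 0 := Polynomial.C_ne_zero.2 ht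
  have hX0 : (Polynomial.X : Polynomial K) ≠ 0 := Polynomial.X_ne_zero
  simp only [map_mul, map_pow, hφx, hφs]
  constructor
  · rw [Polynomial.natDegree_mul (by positivity) (by positivity),
      Polynomial.natDegree_mul (by positivity) (by positivity),
      Polynomial.natDegree_mul (by positivity) (by positivity)]
    simp only [Polynomial.natDegree_pow, Polynomial.natDegree_C, Polynomial.natDegree_X, hy, hz]
    ring
  · positivity


lemma natDegree_map_le_of_mem_weightSpan (ht : t ≠ 0) (hφx : φ x = Polynomial.C t)
    (hφs : φ s = Polynomial.X) (hd : 2 ≤ d) (hm : 2 ≤ m) (hy : (φ y).natDegree = d)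
    (hz : (φ z).natDegree = m * d) {r : ℕ} {w : R} (hw : w ∈ weightSpan k d m x y z s r) :
    (φ w).natDegree ≤ r := by
  induction hw using Submodule.span_induction with
  | mem w h =>
    obtain ⟨a, i, j, l, -, -, hr, rfl⟩ := h
    rwa [(map_monomial_natDegree ht hφx hφs hd hm hy hz a i j l).1]
  | zero => simp
  | add u v _ _ hu hv =>
    rw [map_add]
    exact (Polynomial.natDegree_add_le _ _).trans (max_le hu hv)
  | smul c u _ hu =>
    rw [map_smul]
    exact (Polynomial.natDegree_smul_le _ _).trans hu

lemma exists_aeval_of_mem_weightSpan_zero (hd : 2 ≤ d) (hm : 2 ≤ m) {w : R}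
    (hw : w ∈ weightSpan k d m x y z s 0) : ∃ c : Polynomial k, w = Polynomial.aeval x c := by
  induction hw using Submodule.span_induction with
  | mem w h =>
    obtain ⟨a, i, j, l, -, -, hr, rfl⟩ := h
    have hmd : m * d ≠ 0 := by positivity
    have hd0 : d ≠ 0 := by positivity
    rw [Nat.le_zero, Nat.add_eq_zero_iff, Nat.add_eq_zero_iff, mul_eq_zero_iff_left hmd,
      mul_eq_zero_iff_left hd0] at hr
    obtain ⟨⟨rfl, rfl⟩, rfl⟩ := hr
    exact ⟨Polynomial.X ^ a, by simp⟩
  | zero => exact ⟨0, by simp⟩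
  | add u v _ _ hu hv =>
    obtain ⟨a, rfl⟩ := hu
    obtain ⟨b, rfl⟩ := hv
    exact ⟨a + b, by simp⟩
  | smul c u _ hu =>
    obtain ⟨a, rfl⟩ := hu
    exact ⟨c • a, by simp⟩

lemma exists_sub_mem_weightSpan_of_succ (N : ℕ) {w : R}
    (hw : w ∈ weightSpan k d m x y z s (N + 1)) : ∃ c : Polynomial k,
    w - Polynomial.aeval x c * (s ^ ((N + 1) % d) * y ^ ((N + 1) / d % m) *
      z ^ ((N + 1) / d / m)) ∈ weightSpan k d m x y z s N := by
  induction hw using Submodule.span_induction with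
  | mem w h =>
    obtain ⟨a, i, j, l, hj, hl, hr, rfl⟩ := h
    rcases Nat.lt_or_ge N (m * d * i + d * j + l) with h | h
    · have hN : N + 1 = l + d * (j + m * i) := by
        rw [← le_antisymm hr h]; ring
      have h1 : (N + 1) % d = l := by rw [hN, Nat.add_mul_mod_self_left, Nat.mod_eq_of_lt hl]
      have h2 : (N + 1) / d = j + m * i := by
        rw [hN, Nat.add_mul_div_left _ _ (by omega), Nat.div_eq_of_lt hl, zero_add]
      have h3 : (N + 1) / d % m = j := by
        rw [h2, Nat.add_mul_mod_self_left, Nat.mod_eq_of_lt hj]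
      have h4 : (N + 1) / d / m = i := by
        rw [h2, Nat.add_mul_div_left _ _ (by omega), Nat.div_eq_of_lt hj, zero_add]
      refine ⟨Polynomial.X ^ a, ?_⟩
      rw [h1, h3, h4]
      convert zero_mem (weightSpan k d m x y z s N) using 1
      simp only [map_pow, Polynomial.aeval_X]
      ring
    · refine ⟨0, ?_⟩
      rw [map_zero, zero_mul, sub_zero]
      exact Submodule.subset_span ⟨a, i, j, l, hj, hl, h, rfl⟩
  | zero => exact ⟨0, by simp⟩
  | add u v _ _ hu hv =>
    obtain ⟨a, ha⟩ := hu
    obtain ⟨b, hb⟩ := hv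
    refine ⟨a + b, ?_⟩
    convert add_mem ha hb using 1
    rw [map_add]
    ring
  | smul c u _ hu =>
    obtain ⟨a, ha⟩ := hu
    refine ⟨c • a, ?_⟩
    convert Submodule.smul_mem _ c ha using 1
    rw [map_smul, smul_sub, smul_mul_assoc]

lemma map_aeval_eq_C (hφx : φ x = Polynomial.C t) (c : Polynomial k) :
    φ (Polynomial.aeval x c) = Polynomial.C (Polynomial.aeval t c) := by
  rw [← Polynomial.aeval_algHom_apply, hφx]
  simpa using Polynomial.aeval_algebraMap_apply (Polynomial K) t c

lemma mem_weightSpan_of_natDegree_map_le (ht : Transcendental k t)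
    (hφx : φ x = Polynomial.C t)
    (hφs : φ s = Polynomial.X) (hd : 2 ≤ d) (hm : 2 ≤ m) (hy : (φ y).natDegree = d)
    (hz : (φ z).natDegree = m * d) {r : ℕ} {w : R} (hr : (φ w).natDegree ≤ r) (N : ℕ)
    (hw : w ∈ weightSpan k d m x y z s N) : w ∈ weightSpan k d m x y z s r := by
  have ht0 : t ≠ 0 := by rintro rfl; exact ht isAlgebraic_zero
  induction N with
  | zero => exact weightSpan_mono (Nat.zero_le r) hw
  | succ N ih =>
    rcases Nat.lt_or_ge r (N + 1) with h | h
    · refine ih ?_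
      obtain ⟨c, hc⟩ := exists_sub_mem_weightSpan_of_succ N hw
      have hle := natDegree_map_le_of_mem_weightSpan ht0 hφx hφs hd hm hy hz hc
      set b := s ^ ((N + 1) % d) * y ^ ((N + 1) / d % m) * z ^ ((N + 1) / d / m) with hb
      obtain ⟨hbdeg, hb0⟩ := map_monomial_natDegree ht0 hφx hφs hd hm hy hz 0
        ((N + 1) / d / m) ((N + 1) / d % m) ((N + 1) % d)
      rw [pow_zero, one_mul, ← hb] at hbdeg hb0
      have hN : m * d * ((N + 1) / d / m) + d * ((N + 1) / d % m) + (N + 1) % d = N + 1 := by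
        have h1 := Nat.div_add_mod (N + 1) d
        have h2 := Nat.div_add_mod ((N + 1) / d) m
        calc _ = d * (m * ((N + 1) / d / m) + (N + 1) / d % m) + (N + 1) % d := by ring
          _ = N + 1 := by rw [h2, h1]
      rw [hN] at hbdeg
      have hcoeff := Polynomial.coeff_eq_zero_of_natDegree_lt (Nat.lt_succ_of_le hle)
      rw [map_sub, map_mul, map_aeval_eq_C hφx, Polynomial.coeff_sub, Polynomial.coeff_C_mul,
        Polynomial.coeff_eq_zero_of_natDegree_lt (hr.trans_lt h), zero_sub, neg_eq_zero,
        mul_eq_zero, Nat.succ_eq_add_one, ← hbdeg, Polynomial.coeff_natDegree,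
        Polynomial.leadingCoeff_eq_zero, or_iff_left hb0] at hcoeff
      have hc0 : c = 0 := by
        by_contra hne
        exact ht ⟨c, hne, hcoeff⟩
      simpa [hc0] using hc
    · exact weightSpan_mono h hw

lemma injective_of_weightSpan (ht : Transcendental k t)
    (hφx : φ x = Polynomial.C t)
    (hφs : φ s = Polynomial.X) (hd : 2 ≤ d) (hm : 2 ≤ m) (hy : (φ y).natDegree = d)
    (hz : (φ z).natDegree = m * d) (hspan : ∀ w, w ∈ reducedSpan k d m x y z s) :
    Function.Injective φ := by
  rw [injective_iff_map_eq_zero]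
  intro w hw
  obtain ⟨N, hN⟩ := exists_mem_weightSpan (hspan w)
  obtain ⟨c, rfl⟩ := exists_aeval_of_mem_weightSpan_zero hd hm
    (mem_weightSpan_of_natDegree_map_le ht hφx hφs hd hm hy hz (by simp [hw]) N hN)
  rw [map_aeval_eq_C hφx, Polynomial.C_eq_zero] at hw
  have hc0 : c = 0 := by
    by_contra hne
    exact ht ⟨c, hne, hw⟩
  simp [hc0]

/-- The subalgebra on which `φ` intertwines `D` with `u · d/dS`. -/
def intertwiner (φ : R →ₐ[k] Polynomial K) (D : Derivation k R R) (u : K) : Subalgebra k R where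
  carrier := {a | φ (D a) = Polynomial.C u * Polynomial.derivative (φ a)}
  mul_mem' {a b} ha hb := by
    simp only [Set.mem_ofPred_eq] at ha hb ⊢
    rw [Derivation.leibniz, smul_eq_mul, smul_eq_mul, map_add, map_mul, map_mul, map_mul, ha, hb,
      Polynomial.derivative_mul]
    ring
  add_mem' {a b} ha hb := by
    simp only [Set.mem_ofPred_eq] at ha hb ⊢
    rw [map_add, map_add, map_add, ha, hb, Polynomial.derivative_add]
    ring
  algebraMap_mem' c := by
    simp [Polynomial.algebraMap_apply]

lemma mem_intertwiner {D : Derivation k R R} {u : K} {a : R} :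
    a ∈ intertwiner φ D u ↔ φ (D a) = Polynomial.C u * Polynomial.derivative (φ a) := Iff.rfl

lemma mem_intertwiner_of_pow_mul (ht : t ≠ 0) (hφx : φ x = Polynomial.C t)
    {D : Derivation k R R} {u : K} (hD : D x = 0) {a : R}
    (h : x ^ n * a ∈ intertwiner φ D u) : a ∈ intertwiner φ D u := by
  rw [mem_intertwiner] at h ⊢
  have hDx : D (x ^ n) = 0 := by simp [Derivation.leibniz_pow, hD]
  rw [Derivation.leibniz, hDx, smul_zero, add_zero, smul_eq_mul, map_mul, map_mul, map_pow, hφx,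
    ← Polynomial.C_pow, Polynomial.derivative_C_mul, mul_left_comm] at h
  exact mul_left_cancel₀ (Polynomial.C_ne_zero.2 (pow_ne_zero n ht)) h

lemma intertwiner_eq_top (ht : t ≠ 0) (hφx : φ x = Polynomial.C t)
    (hφs : φ s = Polynomial.X) (hgen : Algebra.adjoin k {x, y, z} = ⊤)
    (hP : x ^ n * y = s ^ d + ∑ i ∈ Finset.range d, Polynomial.aeval x (f i) * s ^ i)
    (hQ : x ^ e * z = y ^ m + ∑ j ∈ Finset.range m, Polynomial.aeval x (g j) * y ^ j - s)
    {D : Derivation k R R} (hDx : D x = 0) (hDs : D s = x ^ (n + e)) :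
    intertwiner φ D (t ^ (n + e)) = ⊤ := by
  set S := intertwiner φ D (t ^ (n + e)) with hS
  have hx : x ∈ S := by simp [hS, mem_intertwiner, hDx, hφx]
  have hs : s ∈ S := by simp [hS, mem_intertwiner, hDs, hφx, hφs]
  have hxp : ∀ p : Polynomial k, Polynomial.aeval x p ∈ S := fun p =>
    Algebra.adjoin_le (Set.singleton_subset_iff.2 hx) (Polynomial.aeval_mem_adjoin_singleton k x)
  have hy : y ∈ S := by
    refine mem_intertwiner_of_pow_mul (n := n) ht hφx hDx ?_
    rw [hP]
    exact add_mem (pow_mem hs d) (sum_mem fun i _ => mul_mem (hxp _) (pow_mem hs i))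
  have hz : z ∈ S := by
    refine mem_intertwiner_of_pow_mul (n := e) ht hφx hDx ?_
    rw [hQ]
    exact sub_mem (add_mem (pow_mem hy m)
      (sum_mem fun i _ => mul_mem (hxp _) (pow_mem hy i))) hs
  rw [eq_top_iff, ← hgen]
  refine Algebra.adjoin_le ?_
  rintro w (rfl | rfl | rfl) <;> assumption

lemma map_pow_apply_of_intertwiner {D : Derivation k R R} {u : K}
    (h : intertwiner φ D u = ⊤) (r : ℕ) (w : R) :
    φ (((D.toLinearMap : Module.End k R) ^ r) w) =
      Polynomial.C (u ^ r) * Polynomial.derivative^[r] (φ w) := by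
  induction r with
  | zero => simp
  | succ r ih =>
    have h1 : (D.toLinearMap ^ r) w ∈ intertwiner φ D u := h ▸ Algebra.mem_top
    rw [mem_intertwiner] at h1
    rw [pow_succ', Module.End.mul_apply, Function.iterate_succ_apply']
    refine h1.trans ?_
    rw [ih, Polynomial.derivative_C_mul, pow_succ', Polynomial.C_mul, mul_assoc]

lemma ker_pow_eq_weightSpan [CharZero K] (hd : 2 ≤ d) (hm : 2 ≤ m) (ht : Transcendental k t)
    (hφx : φ x = Polynomial.C t)
    (hφs : φ s = Polynomial.X) (hgen : Algebra.adjoin k {x, y, z} = ⊤)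
    (hP : x ^ n * y = s ^ d + ∑ i ∈ Finset.range d, Polynomial.aeval x (f i) * s ^ i)
    (hQ : x ^ e * z = y ^ m + ∑ j ∈ Finset.range m, Polynomial.aeval x (g j) * y ^ j - s)
    {D : Derivation k R R} (hDx : D x = 0) (hDs : D s = x ^ (n + e)) (r : ℕ) :
    LinearMap.ker ((D.toLinearMap : Module.End k R) ^ (r + 1)) = weightSpan k d m x y z s r := by
  have ht0 : t ≠ 0 := by rintro rfl; exact ht isAlgebraic_zero
  have hy := natDegree_map_y ht0 hφx hφs hP
  have hz := natDegree_map_z hd hm ht0 hφx hφs hy hQ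
  have hspan := mem_reducedSpan (k := k) hd hm hgen hP hQ
  have hinj := injective_of_weightSpan ht hφx hφs hd hm hy hz hspan
  ext w
  rw [LinearMap.mem_ker, ← map_eq_zero_iff φ hinj,
    map_pow_apply_of_intertwiner (intertwiner_eq_top ht0 hφx hφs hgen hP hQ hDx hDs), mul_eq_zero,
    or_iff_right (Polynomial.C_ne_zero.2 (pow_ne_zero _ (pow_ne_zero _ ht0))),
    Polynomial.iterate_derivative_succ_eq_zero_iff]
  refine ⟨fun h => ?_, natDegree_map_le_of_mem_weightSpan ht0 hφx hφs hd hm hy hz⟩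
  obtain ⟨N, hN⟩ := exists_mem_weightSpan (hspan w)
  exact mem_weightSpan_of_natDegree_map_le ht hφx hφs hd hm hy hz h N hN

end relations

lemma Derivation.map_pow_add_sum (D : Derivation k R R) {x : R} (hD : D x = 0) (s : R) (d : ℕ)
    (f : ℕ → Polynomial k) :
    D (s ^ d + ∑ i ∈ Finset.range d, Polynomial.aeval x (f i) * s ^ i) =
      ((d : R) * s ^ (d - 1) +
        ∑ i ∈ Finset.range d, (i : R) * Polynomial.aeval x (f i) * s ^ (i - 1)) * D s := by
  simp only [map_add, map_sum, Derivation.leibniz, Derivation.leibniz_pow, Derivation.map_aeval,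
    hD, smul_eq_mul, nsmul_eq_mul, add_mul, Finset.sum_mul]
  congr 1
  · ring
  · exact Finset.sum_congr rfl fun i _ => by ring

end filtration

section ring

variable {k : Type*} [Field k] (n e d m : ℕ) (f g : ℕ → Polynomial k)

lemma Pat_mem_RIdeal : X 0 ^ n * X 1 - Pat k d f (Qpoly k m g - X 0 ^ e * X 2) ∈
    RIdeal k n e d m f g :=
  Ideal.subset_span rfl

/-- The quotient map `k[X,Y,Z] → R_{n,e,P,Q}`. -/
noncomputable def RRing.mk : MvPolynomial (Fin 3) k →ₐ[k] RRing k n e d m f g :=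
  Ideal.Quotient.mkₐ k (RIdeal k n e d m f g)

lemma RRing.mk_surjective : Function.Surjective (RRing.mk n e d m f g) :=
  Ideal.Quotient.mk_surjective

lemma RRing.mk_eq_zero_iff (w : MvPolynomial (Fin 3) k) :
    RRing.mk n e d m f g w = 0 ↔ w ∈ RIdeal k n e d m f g :=
  Ideal.Quotient.eq_zero_iff_mem

lemma RRing.mk_X_zero : RRing.mk n e d m f g (X 0) = xel k n e d m f g := rfl

lemma RRing.mk_X_one : RRing.mk n e d m f g (X 1) = yel k n e d m f g := rfl

lemma RRing.mk_X_two : RRing.mk n e d m f g (X 2) = zel k n e d m f g := rfl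

lemma RRing.mk_s : RRing.mk n e d m f g (Qpoly k m g - X 0 ^ e * X 2) = sel k n e d m f g := rfl

lemma RRing.mk_aeval (p : Polynomial k) : RRing.mk n e d m f g (Polynomial.aeval (X 0) p) =
    Polynomial.aeval (xel k n e d m f g) p := by
  rw [← Polynomial.aeval_algHom_apply, RRing.mk_X_zero]

lemma adjoin_xyz_eq_top :
    Algebra.adjoin k {xel k n e d m f g, yel k n e d m f g, zel k n e d m f g} = ⊤ := by
  rw [eq_top_iff, ← (AlgHom.range_eq_top (RRing.mk n e d m f g)).2 (RRing.mk_surjective n e d m f g),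
    ← Algebra.map_top, ← MvPolynomial.adjoin_range_X, AlgHom.map_adjoin]
  refine Algebra.adjoin_mono ?_
  rintro _ ⟨_, ⟨i, rfl⟩, rfl⟩
  fin_cases i
  · exact Or.inl rfl
  · exact Or.inr (Or.inl rfl)
  · exact Or.inr (Or.inr rfl)

lemma xel_pow_mul_yel : xel k n e d m f g ^ n * yel k n e d m f g =
    sel k n e d m f g ^ d + ∑ i ∈ Finset.range d,
      Polynomial.aeval (xel k n e d m f g) (f i) * sel k n e d m f g ^ i := by
  have h := (RRing.mk_eq_zero_iff n e d m f g _).2 (Pat_mem_RIdeal n e d m f g)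
  simpa only [Pat, map_sub, map_add, map_sum, map_mul, map_pow, RRing.mk_aeval, RRing.mk_X_zero,
    RRing.mk_X_one, ← RRing.mk_s, sub_eq_zero] using h

lemma xel_pow_mul_zel : xel k n e d m f g ^ e * zel k n e d m f g =
    yel k n e d m f g ^ m + ∑ j ∈ Finset.range m,
      Polynomial.aeval (xel k n e d m f g) (g j) * yel k n e d m f g ^ j - sel k n e d m f g := by
  rw [← RRing.mk_s]
  simp only [Qpoly, map_sub, map_add, map_sum, map_mul, map_pow, RRing.mk_aeval, RRing.mk_X_zero,
    RRing.mk_X_one, RRing.mk_X_two]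
  ring

lemma exists_algHom_polynomial {K : Type*} [Field K] [Algebra k K] {t : K} (ht : t ≠ 0) :
    ∃ φ : RRing k n e d m f g →ₐ[k] Polynomial K,
      φ (xel k n e d m f g) = Polynomial.C t ∧ φ (sel k n e d m f g) = Polynomial.X := by
  have hinv : ∀ a : ℕ, (Polynomial.C t : Polynomial K) ^ a * Polynomial.C (t ^ a)⁻¹ = 1 :=
    fun a => by
      rw [← Polynomial.C_pow, ← Polynomial.C_mul, mul_inv_cancel₀ (pow_ne_zero a ht),
        Polynomial.C_1]
  set p : Polynomial K := Polynomial.X ^ d +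
    ∑ i ∈ Finset.range d, Polynomial.aeval (Polynomial.C t) (f i) * Polynomial.X ^ i
  set v := Polynomial.C (t ^ n)⁻¹ * p
  set q : Polynomial K := v ^ m +
    ∑ j ∈ Finset.range m, Polynomial.aeval (Polynomial.C t) (g j) * v ^ j
  set ψ : MvPolynomial (Fin 3) k →ₐ[k] Polynomial K :=
    MvPolynomial.aeval ![Polynomial.C t, v, Polynomial.C (t ^ e)⁻¹ * (q - Polynomial.X)]
  have h0 : ψ (X 0) = Polynomial.C t := by simp [ψ]
  have h1 : ψ (X 1) = v := by simp [ψ]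
  have h2 : ψ (X 2) = Polynomial.C (t ^ e)⁻¹ * (q - Polynomial.X) := by simp [ψ]
  have hs : ψ (Qpoly k m g - X 0 ^ e * X 2) = Polynomial.X := by
    simp only [Qpoly, map_sub, map_add, map_sum, map_mul, map_pow, ← Polynomial.aeval_algHom_apply,
      h0, h1, h2]
    rw [← mul_assoc, hinv, one_mul, sub_sub_cancel]
  have hrel : ψ (X 0 ^ n * X 1 - Pat k d f (Qpoly k m g - X 0 ^ e * X 2)) = 0 := by
    simp only [Pat, map_sub (f := ψ) (X 0 ^ n * X 1), map_add, map_sum, map_mul, map_pow,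
      ← Polynomial.aeval_algHom_apply, h0, h1, hs]
    rw [← mul_assoc, hinv, one_mul, sub_self]
  have hker : ∀ a ∈ RIdeal k n e d m f g, ψ a = 0 := fun a ha => by
    have hle : RIdeal k n e d m f g ≤ RingHom.ker ψ :=
      Ideal.span_le.2 (Set.singleton_subset_iff.2 hrel)
    exact hle ha
  exact ⟨Ideal.Quotient.liftₐ (RIdeal k n e d m f g) ψ hker, h0, hs⟩

lemma exists_derivation : ∃ D : Derivation k (RRing k n e d m f g) (RRing k n e d m f g),
    D (xel k n e d m f g) = 0 ∧
    D (yel k n e d m f g) = xel k n e d m f g ^ e * PSel k n e d m f g ∧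
    D (zel k n e d m f g) = QYel k n e d m f g * PSel k n e d m f g - xel k n e d m f g ^ n ∧
    D (sel k n e d m f g) = xel k n e d m f g ^ (n + e) := by
  set σ : MvPolynomial (Fin 3) k := Qpoly k m g - X 0 ^ e * X 2 with hσ
  set p : MvPolynomial (Fin 3) k := (d : MvPolynomial (Fin 3) k) * σ ^ (d - 1) +
    ∑ i ∈ Finset.range d, (i : MvPolynomial (Fin 3) k) *
      Polynomial.aeval (X 0) (f i) * σ ^ (i - 1) with hp
  set q : MvPolynomial (Fin 3) k := (m : MvPolynomial (Fin 3) k) * X 1 ^ (m - 1) +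
    ∑ j ∈ Finset.range m, (j : MvPolynomial (Fin 3) k) *
      Polynomial.aeval (X 0) (g j) * X 1 ^ (j - 1) with hq
  set E : Derivation k (MvPolynomial (Fin 3) k) (MvPolynomial (Fin 3) k) :=
    MvPolynomial.mkDerivation k ![0, X 0 ^ e * p, q * p - X 0 ^ n]
  have h0 : E (X 0) = 0 := by simp [E]
  have h1 : E (X 1) = X 0 ^ e * p := by simp [E]
  have h2 : E (X 2) = q * p - X 0 ^ n := by simp [E]
  have hpow : ∀ a : ℕ, E (X 0 ^ a) = 0 := fun a => by simp [Derivation.leibniz_pow, h0]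
  have hs : E σ = X 0 ^ (n + e) := by
    rw [hσ, map_sub, Qpoly, Derivation.map_pow_add_sum E h0, ← hq, Derivation.leibniz, hpow, h1,
      h2, smul_eq_mul, smul_zero]
    ring
  have hrel : E (X 0 ^ n * X 1 - Pat k d f σ) = 0 := by
    rw [map_sub, Pat, Derivation.map_pow_add_sum E h0, ← hp, Derivation.leibniz, hpow, h1, hs,
      smul_eq_mul, smul_zero]
    ring
  have hker : ∀ a, RRing.mk n e d m f g a = 0 → RRing.mk n e d m f g (E a) = 0 := by
    intro a ha
    rw [RRing.mk_eq_zero_iff, RIdeal, Ideal.mem_span_singleton'] at ha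
    obtain ⟨c, rfl⟩ := ha
    rw [RRing.mk_eq_zero_iff, Derivation.leibniz, hrel, smul_zero, zero_add, smul_eq_mul]
    exact Ideal.mul_mem_right _ _ (Pat_mem_RIdeal n e d m f g)
  have hP : RRing.mk n e d m f g p = PSel k n e d m f g := by
    simp only [hp, map_add, map_sum, map_mul, map_pow, map_natCast, RRing.mk_aeval, hσ,
      RRing.mk_s, PSel]
  have hQ : RRing.mk n e d m f g q = QYel k n e d m f g := by
    simp only [hq, map_add, map_sum, map_mul, map_pow, map_natCast, RRing.mk_aeval,
      RRing.mk_X_one, QYel]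
  refine ⟨Derivation.liftOfSurjective (RRing.mk_surjective n e d m f g) hker, ?_, ?_, ?_, ?_⟩
  · rw [← RRing.mk_X_zero, Derivation.liftOfSurjective_apply, h0, map_zero]
  · rw [← RRing.mk_X_one, Derivation.liftOfSurjective_apply, h1, map_mul, map_pow, hP,
      RRing.mk_X_zero]
  · rw [← RRing.mk_X_two, Derivation.liftOfSurjective_apply, h2, map_sub, map_mul, map_pow, hP,
      hQ, RRing.mk_X_zero]
  · rw [← RRing.mk_s, Derivation.liftOfSurjective_apply, hs, map_pow, RRing.mk_X_zero]

end ring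

theorem stmt9 {k : Type*} [Field k] [CharZero k]
    (n e d m : ℕ) (hn : 1 ≤ n) (hne : ¬(n = 1 ∧ e = 0)) (hd : 2 ≤ d) (hm : 2 ≤ m)
    (f g : ℕ → Polynomial k) :
    ∃ D : Derivation k (RRing k n e d m f g) (RRing k n e d m f g),
      D (xel k n e d m f g) = 0 ∧
      D (yel k n e d m f g) = xel k n e d m f g ^ e * PSel k n e d m f g ∧
      D (zel k n e d m f g) =
        QYel k n e d m f g * PSel k n e d m f g - xel k n e d m f g ^ n ∧
      IsLND D ∧
      D (sel k n e d m f g) = xel k n e d m f g ^ (n + e) ∧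
      (∀ w : RRing k n e d m f g, D w = 0 ↔ w ∈ Algebra.adjoin k {xel k n e d m f g}) ∧
      ∀ r : ℕ,
        LinearMap.ker ((D.toLinearMap : Module.End k (RRing k n e d m f g)) ^ (r + 1)) =
          Submodule.span k {w : RRing k n e d m f g | ∃ a i j l : ℕ,
            j < m ∧ l < d ∧ m * d * i + d * j + l ≤ r ∧
            w = xel k n e d m f g ^ a * sel k n e d m f g ^ l *
              yel k n e d m f g ^ j * zel k n e d m f g ^ i} := by
  obtain ⟨D, hDx, hDy, hDz, hDs⟩ := exists_derivation n e d m f g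
  have ht := RatFunc.transcendental_X (K := k)
  obtain ⟨φ, hφx, hφs⟩ := exists_algHom_polynomial n e d m f g (RatFunc.X_ne_zero (K := k))
  have : CharZero (RatFunc k) := charZero_of_injective_algebraMap (algebraMap k _).injective
  have hP := xel_pow_mul_yel n e d m f g
  have hQ := xel_pow_mul_zel n e d m f g
  have hgen := adjoin_xyz_eq_top n e d m f g
  have hker := ker_pow_eq_weightSpan hd hm ht hφx hφs hgen hP hQ hDx hDs
  refine ⟨D, hDx, hDy, hDz, fun w => ?_, hDs, fun w => ⟨fun hw => ?_, fun hw => ?_⟩, hker⟩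
  · obtain ⟨r, hr⟩ := exists_mem_weightSpan (mem_reducedSpan (k := k) hd hm hgen hP hQ w)
    rw [← hker] at hr
    exact ⟨r + 1, hr⟩
  · have h : w ∈ LinearMap.ker
        ((D.toLinearMap : Module.End k (RRing k n e d m f g)) ^ (0 + 1)) := by simpa using hw
    rw [hker] at h
    obtain ⟨c, rfl⟩ := exists_aeval_of_mem_weightSpan_zero hd hm h
    exact Polynomial.aeval_mem_adjoin_singleton k _
  · rw [Algebra.adjoin_singleton_eq_range_aeval] at hw
    obtain ⟨c, rfl⟩ := hw
    simp [Derivation.map_aeval, hDx]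
end

section
/- Let R = k[X,Y,Z]/⟨X²Y − (Y²−XZ)²⟩ with x, y, z the classes of X, Y, Z and s := y² − xz, and let ∂ be the locally nilpotent derivation of R induced by 2XS·∂_Y + (4YS − X²)·∂_Z where S := Y² − XZ (so ∂(x) = 0 and ∂(s) = x³). Then for every r ∈ ℕ, writing r = 4i + 2j + l with i ∈ ℕ and j, l ∈ {0,1}, the ∂-filtration F_r = ker ∂^{r+1} satisfies F_r = k[x]·s^l y^j z^i + F_{r−1} (with F_{−1} = 0); equivalently F_r is the k[x]-submodule of R spanned by the monomials s^{l'} y^{j'} z^{i'} with 4i' + 2j' + l' ≤ r, i' ∈ ℕ, j', l' ∈ {0,1}. -/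
open MvPolynomial

noncomputable section

variable (k : Type*) [Field k] [CharZero k]

/-- The ideal `⟨X²Y - (Y² - XZ)²⟩` of `k[X,Y,Z]` (variables `X = 0`, `Y = 1`, `Z = 2`). -/
def toyIdeal : Ideal (MvPolynomial (Fin 3) k) :=
  Ideal.span {X 0 ^ 2 * X 1 - (X 1 ^ 2 - X 0 * X 2) ^ 2}

/-- The toy example `R = k[X,Y,Z]/⟨X²Y - (Y² - XZ)²⟩`. -/
def ToyRing : Type _ := MvPolynomial (Fin 3) k ⧸ toyIdeal k

instance : CommRing (ToyRing k) := Ideal.Quotient.commRing _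

instance : Algebra k (ToyRing k) := Ideal.Quotient.algebra k

/-- The class of `X` in `R`. -/
def tx : ToyRing k := Ideal.Quotient.mk _ (X 0)

/-- The class of `Y` in `R`. -/
def ty : ToyRing k := Ideal.Quotient.mk _ (X 1)

/-- The class of `Z` in `R`. -/
def tz : ToyRing k := Ideal.Quotient.mk _ (X 2)

/-- The element `s = y² - xz` of `R`. -/
def ts : ToyRing k := ty k ^ 2 - tx k * tz k

theorem Derivation.iterate_mul_of_left_const {R A : Type*} [CommRing R] [CommRing A] [Algebra R A]
    (D : Derivation R A A) {c : A} (hc : D c = 0) (n : ℕ) (f : A) :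
    D^[n] (c * f) = c * D^[n] f := by
  induction n generalizing f with
  | zero => rfl
  | succ n ih => simp [Function.iterate_succ_apply, Derivation.leibniz, hc, ih]

/-- If the `a`-th and `b`-th iterates of `D` send `f` and `g` to constants, then the `(a + b)`-th
iterate sends `f * g` to a binomial multiple of the product of these constants. -/
theorem Derivation.iterate_add_mul {R A : Type*} [CommRing R] [CommRing A] [Algebra R A]
    (D : Derivation R A A) {p q : A} (hp : D p = 0) (hq : D q = 0) (a b : ℕ) {f g : A}
    (hf : D^[a] f = p) (hg : D^[b] g = q) :
    D^[a + b] (f * g) = (a + b).choose a * (p * q) := by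
  induction a generalizing f b g with
  | zero =>
    obtain rfl : f = p := hf
    simp [D.iterate_mul_of_left_const hp, hg]
  | succ a iha =>
    induction b generalizing g with
    | zero =>
      obtain rfl : g = q := hg
      rw [mul_comm f, add_zero, D.iterate_mul_of_left_const hq, hf, Nat.choose_self]
      push_cast
      ring
    | succ b ihb =>
      have h1 := iha (b + 1) (f := D f) hf hg
      have h2 := ihb (g := D g) hg
      rw [show a + 1 + (b + 1) = a + (b + 1) + 1 by ring, Function.iterate_succ_apply,
        Derivation.leibniz, iterate_map_add, Nat.choose_succ_succ, smul_eq_mul, smul_eq_mul,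
        mul_comm g, h1]
      rw [show a + 1 + b = a + (b + 1) by ring] at h2
      rw [h2]
      push_cast
      ring

omit [CharZero k] in
theorem toyRing_relation : ts k ^ 2 = tx k ^ 2 * ty k := by
  have h : (Ideal.Quotient.mk (toyIdeal k)
      (X 0 ^ 2 * X 1 - (X 1 ^ 2 - X 0 * X 2) ^ 2)) = 0 :=
    Ideal.Quotient.eq_zero_iff_mem.mpr (Ideal.subset_span rfl)
  exact (sub_eq_zero.mp h).symm

/-- The quotient map `k[X,Y,Z] → R`. -/
def toyMk : MvPolynomial (Fin 3) k →ₐ[k] ToyRing k := Ideal.Quotient.mkₐ k (toyIdeal k)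

omit [CharZero k] in
theorem toyMk_surjective : Function.Surjective (toyMk k) := Ideal.Quotient.mkₐ_surjective k _

omit [CharZero k] in
theorem toyMk_eq_zero_iff (p : MvPolynomial (Fin 3) k) : toyMk k p = 0 ↔ p ∈ toyIdeal k :=
  Ideal.Quotient.eq_zero_iff_mem

omit [CharZero k] in
theorem exists_toyDerivation : ∃ D : Derivation k (ToyRing k) (ToyRing k),
    D (tx k) = 0 ∧ D (ty k) = 2 * tx k * ts k ∧
      D (tz k) = 4 * ty k * ts k - tx k ^ 2 := by
  let S : MvPolynomial (Fin 3) k := X 1 ^ 2 - X 0 * X 2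
  let d : Derivation k (MvPolynomial (Fin 3) k) (MvPolynomial (Fin 3) k) :=
    mkDerivation k ![0, 2 * X 0 * S, 4 * X 1 * S - X 0 ^ 2]
  have h0 : d (X 0) = 0 := by simp [d, mkDerivation_X]
  have h1 : d (X 1) = 2 * X 0 * S := by simp [d, mkDerivation_X]
  have h2 : d (X 2) = 4 * X 1 * S - X 0 ^ 2 := by simp [d, mkDerivation_X]
  have hd : d (X 0 ^ 2 * X 1 - S ^ 2) = 0 := by
    simp only [S, map_sub, Derivation.leibniz, Derivation.leibniz_pow, h0, h1, h2, smul_eq_mul,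
      nsmul_eq_mul]
    push_cast
    ring
  have hker (p : MvPolynomial (Fin 3) k) (hp : toyMk k p = 0) : toyMk k (d p) = 0 := by
    rw [toyMk_eq_zero_iff] at hp ⊢
    obtain ⟨q, rfl⟩ := Ideal.mem_span_singleton'.mp hp
    rw [Derivation.leibniz, hd, smul_zero, zero_add, smul_eq_mul]
    exact Ideal.mul_mem_right _ _ (Ideal.subset_span rfl)
  refine ⟨Derivation.liftOfSurjective (toyMk_surjective k) hker, ?_, ?_, ?_⟩
  · exact (Derivation.liftOfSurjective_apply (toyMk_surjective k) hker (X 0)).trans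
      (by rw [h0, map_zero])
  · refine (Derivation.liftOfSurjective_apply (toyMk_surjective k) hker (X 1)).trans ?_
    rw [h1]
    simp only [S, map_sub, map_mul, map_pow, map_ofNat]
    rfl
  · refine (Derivation.liftOfSurjective_apply (toyMk_surjective k) hker (X 2)).trans ?_
    rw [h2]
    simp only [S, map_sub, map_mul, map_pow, map_ofNat]
    rfl

/-- The monomial `s^l y^j z^i` with `4i + 2j + l = n` and `j, l < 2`. -/
def toyMonomial (n : ℕ) : ToyRing k := ts k ^ (n % 2) * ty k ^ (n / 2 % 2) * tz k ^ (n / 4)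

/-- The `k[x]`-span of the monomials of degree at most `n`, as a `k`-subspace. -/
def toySpan (n : ℕ) : Submodule k (ToyRing k) :=
  Submodule.span k {w | ∃ a d : ℕ, d ≤ n ∧ w = tx k ^ a * toyMonomial k d}

omit [CharZero k] in
theorem toyMonomial_eq {i j l : ℕ} (hj : j < 2) (hl : l < 2) :
    toyMonomial k (4 * i + 2 * j + l) = ts k ^ l * ty k ^ j * tz k ^ i := by
  rw [toyMonomial, show (4 * i + 2 * j + l) % 2 = l by lia,
    show (4 * i + 2 * j + l) / 2 % 2 = j by lia, show (4 * i + 2 * j + l) / 4 = i by lia]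

omit [CharZero k] in
theorem exists_toyMonomial_eq (n : ℕ) : ∃ i j l : ℕ, j < 2 ∧ l < 2 ∧ n = 4 * i + 2 * j + l :=
  ⟨n / 4, n / 2 % 2, n % 2, by lia, by lia, by lia⟩

omit [CharZero k] in
theorem toySpan_eq_span (r : ℕ) : toySpan k r =
    Submodule.span k {w : ToyRing k | ∃ a i j l : ℕ,
      j < 2 ∧ l < 2 ∧ 4 * i + 2 * j + l ≤ r ∧
      w = tx k ^ a * ts k ^ l * ty k ^ j * tz k ^ i} := by
  rw [toySpan]
  congr 1
  ext w
  constructor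
  · rintro ⟨a, d, hd, rfl⟩
    obtain ⟨i, j, l, hj, hl, rfl⟩ := exists_toyMonomial_eq d
    exact ⟨a, i, j, l, hj, hl, hd, by rw [toyMonomial_eq k hj hl]; ring⟩
  · rintro ⟨a, i, j, l, hj, hl, h, rfl⟩
    exact ⟨a, _, h, by rw [toyMonomial_eq k hj hl]; ring⟩

omit [CharZero k] in
theorem toySpan_mono : Monotone (toySpan k) := fun _ _ h =>
  Submodule.span_mono fun _ ⟨a, d, hd, hw⟩ => ⟨a, d, hd.trans h, hw⟩

omit [CharZero k] in
theorem monomial_mem_toySpan {i j l n : ℕ} (a : ℕ) (hj : j < 2) (hl : l < 2)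
    (h : 4 * i + 2 * j + l ≤ n) :
    tx k ^ a * ts k ^ l * ty k ^ j * tz k ^ i ∈ toySpan k n := by
  rw [toySpan_eq_span]
  exact Submodule.subset_span ⟨a, i, j, l, hj, hl, h, rfl⟩

omit [CharZero k] in
/-- To bound the product of `v` with elements of `toySpan k n` it suffices to treat monomials. -/
theorem mul_mem_toySpan {v : ToyRing k} {n m : ℕ}
    (hv : ∀ a i j l : ℕ, j < 2 → l < 2 → 4 * i + 2 * j + l ≤ n →
      tx k ^ a * ts k ^ l * ty k ^ j * tz k ^ i * v ∈ toySpan k m)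
    {f : ToyRing k} (hf : f ∈ toySpan k n) : f * v ∈ toySpan k m := by
  rw [toySpan_eq_span] at hf
  induction hf using Submodule.span_induction with
  | mem f hf =>
    obtain ⟨a, i, j, l, hj, hl, h, rfl⟩ := hf
    exact hv a i j l hj hl h
  | zero => simp
  | add f g _ _ hf hg => rw [add_mul]; exact add_mem hf hg
  | smul c f _ hf => rw [smul_mul_assoc]; exact Submodule.smul_mem _ c hf

omit [CharZero k] in
theorem mul_tx_mem_toySpan {n : ℕ} {f : ToyRing k} (hf : f ∈ toySpan k n) :
    f * tx k ∈ toySpan k n := by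
  refine mul_mem_toySpan k (fun a i j l hj hl h => ?_) hf
  convert monomial_mem_toySpan k (a + 1) hj hl h using 1
  ring

omit [CharZero k] in
theorem mul_tz_mem_toySpan {n : ℕ} {f : ToyRing k} (hf : f ∈ toySpan k n) :
    f * tz k ∈ toySpan k (n + 4) := by
  refine mul_mem_toySpan k (fun a i j l hj hl h => ?_) hf
  convert monomial_mem_toySpan k (i := i + 1) (n := n + 4) a hj hl (by lia) using 1
  ring

omit [CharZero k] in
theorem mul_ty_mem_toySpan {n : ℕ} {f : ToyRing k} (hf : f ∈ toySpan k n) :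
    f * ty k ∈ toySpan k (n + 2) := by
  have hyy : ty k ^ 2 = ts k + tx k * tz k := by rw [ts]; ring
  refine mul_mem_toySpan k (fun a i j l hj hl h => ?_) hf
  interval_cases j
  · convert monomial_mem_toySpan k (j := 1) (i := i) (n := n + 2) a (by lia) hl (by lia) using 1
    ring
  · have hx := monomial_mem_toySpan k (j := 0) (i := i + 1) (n := n + 2) (a + 1) (by lia) hl
      (by lia)
    rw [show tx k ^ a * ts k ^ l * ty k ^ 1 * tz k ^ i * ty k =
      tx k ^ a * ts k ^ (l + 1) * tz k ^ i +
        tx k ^ (a + 1) * ts k ^ l * ty k ^ 0 * tz k ^ (i + 1) by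
      linear_combination (tx k ^ a * ts k ^ l * tz k ^ i) * hyy]
    refine add_mem ?_ hx
    interval_cases l
    · convert monomial_mem_toySpan k (j := 0) (l := 1) (i := i) (n := n + 2) a (by lia)
        (by lia) (by lia) using 1
      ring
    · convert monomial_mem_toySpan k (j := 1) (l := 0) (i := i) (n := n + 2) (a + 2) (by lia)
        (by lia) (by lia) using 1
      linear_combination (tx k ^ a * tz k ^ i) * toyRing_relation k

omit [CharZero k] in
theorem exists_mem_toySpan (f : ToyRing k) : ∃ n, f ∈ toySpan k n := by
  obtain ⟨p, rfl⟩ := toyMk_surjective k f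
  induction p using MvPolynomial.induction_on with
  | C c =>
    refine ⟨0, ?_⟩
    have h := monomial_mem_toySpan k (i := 0) (j := 0) (l := 0) (n := 0) 0 (by lia) (by lia) le_rfl
    convert Submodule.smul_mem _ c h using 1
    rw [← MvPolynomial.algebraMap_eq, AlgHom.commutes, Algebra.algebraMap_eq_smul_one]
    simp
  | add p q hp hq =>
    obtain ⟨n, hn⟩ := hp
    obtain ⟨m, hm⟩ := hq
    rw [map_add]
    exact ⟨max n m, add_mem (toySpan_mono k (le_max_left n m) hn)
      (toySpan_mono k (le_max_right n m) hm)⟩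
  | mul_X p i hp =>
    obtain ⟨n, hn⟩ := hp
    rw [map_mul]
    fin_cases i
    · exact ⟨n, mul_tx_mem_toySpan k hn⟩
    · exact ⟨n + 2, mul_ty_mem_toySpan k hn⟩
    · exact ⟨n + 4, mul_tz_mem_toySpan k hn⟩

omit [CharZero k] in
theorem aeval_tx_injective : Function.Injective (Polynomial.aeval (R := k) (tx k)) := by
  let e : MvPolynomial (Fin 3) k →ₐ[k] Polynomial k := aeval ![Polynomial.X, 0, 0]
  have he : ∀ p ∈ toyIdeal k, e p = 0 := by
    intro p hp
    obtain ⟨q, rfl⟩ := Ideal.mem_span_singleton'.mp hp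
    simp [e]
  let φ : ToyRing k →ₐ[k] Polynomial k := Ideal.Quotient.liftₐ (toyIdeal k) e he
  have hφ : φ (tx k) = Polynomial.X := by
    change e (X 0) = _
    simp [e]
  refine Function.LeftInverse.injective (g := φ) fun p => ?_
  rw [← Polynomial.aeval_algHom_apply, hφ, Polynomial.aeval_X_left_apply]

omit [CharZero k] in
theorem exists_of_mem_toySpan_succ {n : ℕ} {f : ToyRing k} (hf : f ∈ toySpan k (n + 1)) :
    ∃ p : Polynomial k, ∃ g ∈ toySpan k n,
      f = Polynomial.aeval (tx k) p * toyMonomial k (n + 1) + g := by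
  induction hf using Submodule.span_induction with
  | mem f hf =>
    obtain ⟨a, d, hd, rfl⟩ := hf
    rcases hd.lt_or_eq with h | rfl
    · exact ⟨0, _, Submodule.subset_span ⟨a, d, Nat.lt_succ_iff.mp h, rfl⟩, by simp⟩
    · exact ⟨Polynomial.X ^ a, 0, zero_mem _, by simp⟩
  | zero => exact ⟨0, 0, zero_mem _, by simp⟩
  | add f₁ f₂ _ _ h₁ h₂ =>
    obtain ⟨p₁, g₁, hg₁, rfl⟩ := h₁
    obtain ⟨p₂, g₂, hg₂, rfl⟩ := h₂
    exact ⟨p₁ + p₂, g₁ + g₂, add_mem hg₁ hg₂, by rw [map_add]; ring⟩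
  | smul c f _ h =>
    obtain ⟨p, g, hg, rfl⟩ := h
    exact ⟨c • p, c • g, Submodule.smul_mem _ c hg, by
      rw [map_smul, smul_add, smul_mul_assoc]⟩

section Iterates

variable {D : Derivation k (ToyRing k) (ToyRing k)} (hx : D (tx k) = 0)
  (hy : D (ty k) = 2 * tx k * ts k) (hz : D (tz k) = 4 * ty k * ts k - tx k ^ 2)
  (hs : D (ts k) = tx k ^ 3)

omit [CharZero k]

include hx hy hz in
theorem derivation_ts : D (ts k) = tx k ^ 3 := by
  rw [ts, map_sub, Derivation.leibniz, Derivation.leibniz_pow, hx, hy, hz]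
  simp only [smul_eq_mul, nsmul_eq_mul]
  push_cast
  ring

include hx in
theorem derivation_aeval_tx (p : Polynomial k) : D (Polynomial.aeval (tx k) p) = 0 := by
  rw [Derivation.map_aeval, hx, smul_zero]

include hx in
theorem derivation_natCast_mul_tx_pow (c N : ℕ) : D (c * tx k ^ N) = 0 := by
  simp [Derivation.leibniz, Derivation.leibniz_pow, hx]

include hx in
/-- Elements whose `a`-th iterated derivative is a nonzero multiple of a power of `x` are stable
under products. -/
theorem exists_iterate_mul_eq {a b : ℕ} {f g : ToyRing k}
    (hf : ∃ c N : ℕ, c ≠ 0 ∧ D^[a] f = c * tx k ^ N)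
    (hg : ∃ c N : ℕ, c ≠ 0 ∧ D^[b] g = c * tx k ^ N) :
    ∃ c N : ℕ, c ≠ 0 ∧ D^[a + b] (f * g) = c * tx k ^ N := by
  obtain ⟨c, N, hc, hf⟩ := hf
  obtain ⟨c', N', hc', hg⟩ := hg
  refine ⟨(a + b).choose a * (c * c'), N + N', ?_, ?_⟩
  · exact mul_ne_zero (Nat.choose_pos (Nat.le_add_right a b)).ne' (mul_ne_zero hc hc')
  · rw [D.iterate_add_mul (derivation_natCast_mul_tx_pow k hx c N)
      (derivation_natCast_mul_tx_pow k hx c' N') a b hf hg]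
    push_cast
    ring

include hx in
theorem exists_iterate_pow_eq {a : ℕ} {f : ToyRing k}
    (hf : ∃ c N : ℕ, c ≠ 0 ∧ D^[a] f = c * tx k ^ N) (m : ℕ) :
    ∃ c N : ℕ, c ≠ 0 ∧ D^[a * m] (f ^ m) = c * tx k ^ N := by
  induction m with
  | zero => exact ⟨1, 0, one_ne_zero, by simp⟩
  | succ m ih =>
    rw [pow_succ, mul_add_one]
    exact exists_iterate_mul_eq k hx ih hf

include hx hy hz hs in
theorem exists_iterate_toyMonomial_eq (n : ℕ) :
    ∃ c N : ℕ, c ≠ 0 ∧ D^[n] (toyMonomial k n) = c * tx k ^ N := by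
  have hDy : D^[2] (ty k) = (2 : ℕ) * tx k ^ 4 := by
    rw [Function.iterate_succ_apply, Function.iterate_one, hy,
      show 2 * tx k * ts k = (2 : ℕ) * tx k ^ 1 * ts k by push_cast; ring,
      Derivation.leibniz, derivation_natCast_mul_tx_pow k hx, hs]
    simp only [smul_eq_mul]
    push_cast
    ring
  have h1 : ∃ c N : ℕ, c ≠ 0 ∧ D^[1] (ts k) = c * tx k ^ N :=
    ⟨1, 3, one_ne_zero, by simp [hs]⟩
  have h2 : ∃ c N : ℕ, c ≠ 0 ∧ D^[2] (ty k) = c * tx k ^ N :=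
    ⟨2, 4, two_ne_zero, hDy⟩
  have h4 : ∃ c N : ℕ, c ≠ 0 ∧ D^[4] (tz k) = c * tx k ^ N := by
    refine ⟨24, 7, by norm_num, ?_⟩
    have hDD : D^[2] (tz k) = ((12 : ℕ) * tx k ^ 3) * ty k := by
      rw [Function.iterate_succ_apply, Function.iterate_one, hz, map_sub,
        show 4 * ty k * ts k = ((4 : ℕ) * tx k ^ 0) * (ty k * ts k) by push_cast; ring,
        Derivation.leibniz _ ((4 : ℕ) * tx k ^ 0 : ToyRing k),
        derivation_natCast_mul_tx_pow k hx, Derivation.leibniz, hy, hs,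
        Derivation.leibniz_pow, hx]
      simp only [smul_eq_mul]
      push_cast
      linear_combination (8 * tx k) * toyRing_relation k
    rw [show 4 = 2 + 2 from rfl, Function.iterate_add_apply, hDD,
      D.iterate_mul_of_left_const (derivation_natCast_mul_tx_pow k hx 12 3), hDy]
    push_cast
    ring
  obtain ⟨i, j, l, hj, hl, rfl⟩ := exists_toyMonomial_eq n
  rw [toyMonomial_eq k hj hl, show 4 * i + 2 * j + l = 1 * l + 2 * j + 4 * i by ring]
  exact exists_iterate_mul_eq k hx (exists_iterate_mul_eq k hx (exists_iterate_pow_eq k hx h1 l)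
    (exists_iterate_pow_eq k hx h2 j)) (exists_iterate_pow_eq k hx h4 i)

include hx hy hz hs in
theorem iterate_eq_zero_of_mem_toySpan {n m : ℕ} {f : ToyRing k} (hf : f ∈ toySpan k n)
    (hnm : n < m) : D^[m] f = 0 := by
  induction hf using Submodule.span_induction with
  | mem f hf =>
    obtain ⟨a, d, hd, rfl⟩ := hf
    obtain ⟨e, rfl⟩ : ∃ e, m = e + (d + 1) := ⟨m - (d + 1), by lia⟩
    obtain ⟨c, N, -, h⟩ := exists_iterate_toyMonomial_eq k hx hy hz hs d
    rw [D.iterate_mul_of_left_const (by simp [Derivation.leibniz_pow, hx]),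
      Function.iterate_add_apply, Function.iterate_succ_apply', h,
      derivation_natCast_mul_tx_pow k hx, iterate_map_zero, mul_zero]
  | zero => exact iterate_map_zero D m
  | add f g _ _ hf hg => rw [iterate_map_add, hf, hg, add_zero]
  | smul c f _ hf =>
    change (D.toLinearMap)^[m] f = 0 at hf
    change (D.toLinearMap)^[m] (c • f) = 0
    rw [← Module.End.pow_apply] at hf ⊢
    rw [map_smul, hf, smul_zero]

end Iterates

theorem mem_toySpan_of_iterate_eq_zero {D : Derivation k (ToyRing k) (ToyRing k)}
    (hx : D (tx k) = 0) (hy : D (ty k) = 2 * tx k * ts k)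
    (hz : D (tz k) = 4 * ty k * ts k - tx k ^ 2) (hs : D (ts k) = tx k ^ 3) {n r : ℕ} {f : ToyRing k} (hn : f ∈ toySpan k n)
    (hf : D^[r + 1] f = 0) : f ∈ toySpan k r := by
  induction n generalizing f with
  | zero => exact toySpan_mono k (Nat.zero_le r) hn
  | succ n ih =>
    rcases le_or_gt (n + 1) r with h | h
    · exact toySpan_mono k h hn
    obtain ⟨p, g, hg, rfl⟩ := exists_of_mem_toySpan_succ k hn
    obtain ⟨c, N, hc, hcN⟩ := exists_iterate_toyMonomial_eq k hx hy hz hs (n + 1)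
    have h0 : D^[n + 1] (Polynomial.aeval (tx k) p * toyMonomial k (n + 1) + g) = 0 := by
      rw [show n + 1 = (n - r) + (r + 1) by lia] at hf ⊢
      rw [Function.iterate_add_apply, hf, iterate_map_zero]
    rw [iterate_map_add, D.iterate_mul_of_left_const (derivation_aeval_tx k hx p), hcN,
      iterate_eq_zero_of_mem_toySpan k hx hy hz hs hg n.lt_succ_self, add_zero] at h0
    have hp : p * ((c : Polynomial k) * Polynomial.X ^ N) = 0 :=
      aeval_tx_injective k (by simpa using h0)
    obtain rfl : p = 0 := by simpa [hc] using hp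
    rw [map_zero, zero_mul, zero_add] at hf ⊢
    exact ih hg hf

theorem stmt10 :
    ∃ D : Derivation k (ToyRing k) (ToyRing k),
      -- `D` is the derivation induced by `2XS ∂_Y + (4YS - X²) ∂_Z`
      D (tx k) = 0 ∧ D (ty k) = 2 * tx k * ts k ∧
      D (tz k) = 4 * ty k * ts k - tx k ^ 2 ∧
      IsLND D ∧ D (ts k) = tx k ^ 3 ∧
      -- the `D`-filtration `F_r = ker D^{r+1}` is the `k[x]`-module spanned by the
      -- monomials `s^l y^j z^i` with `4i + 2j + l ≤ r`, `j, l ∈ {0,1}`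
      ∀ r : ℕ,
        LinearMap.ker ((D.toLinearMap : Module.End k (ToyRing k)) ^ (r + 1)) =
          Submodule.span k {w : ToyRing k | ∃ a i j l : ℕ,
            j < 2 ∧ l < 2 ∧ 4 * i + 2 * j + l ≤ r ∧
            w = tx k ^ a * ts k ^ l * ty k ^ j * tz k ^ i} := by
  obtain ⟨D, hx, hy, hz⟩ := exists_toyDerivation k
  have hs : D (ts k) = tx k ^ 3 := derivation_ts k hx hy hz
  have hker (n : ℕ) : ∀ f ∈ toySpan k n, D^[n + 1] f = 0 :=
    fun f hf => iterate_eq_zero_of_mem_toySpan k hx hy hz hs hf n.lt_succ_self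
  refine ⟨D, hx, hy, hz, fun f => ?_, hs, fun r => ?_⟩
  · obtain ⟨n, hn⟩ := exists_mem_toySpan k f
    exact ⟨n + 1, by rw [Module.End.pow_apply]; exact hker n f hn⟩
  · rw [← toySpan_eq_span]
    ext f
    rw [LinearMap.mem_ker, Module.End.pow_apply]
    refine ⟨fun hf => ?_, hker r f⟩
    obtain ⟨n, hn⟩ := exists_mem_toySpan k f
    exact mem_toySpan_of_iterate_eq_zero k hx hy hz hs hn hf

end
end

section
/- Let R = R_{n,e,P,Q} with the locally nilpotent derivation ∂ determined by ∂(x) = 0, ∂(s) = x^{n+e}. Then: (1) ML(R) = k[x]; consequently R is semi-rigid and its unique LND-filtration is the ∂-filtration ker ∂^{i+1}; (2) every locally nilpotent k-derivation D of R has the form D = f(x)·∂ for some f ∈ k[x]; in particular R is almost rigid. -/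
open MvPolynomial

/-- `B` is semi-rigid. -/
def SemiRigid (k B : Type*) [CommRing k] [CommRing B] [Algebra k B] : Prop :=
  ∀ (D E : Derivation k B B), IsLND D → IsLND E → D ≠ 0 → E ≠ 0 →
    ∀ i : ℕ, LinearMap.ker ((D.toLinearMap : Module.End k B) ^ (i + 1)) =
      LinearMap.ker ((E.toLinearMap : Module.End k B) ^ (i + 1))

section LeadingExponents

set_option linter.unusedSectionVars false

variable {k Γ : Type*} [Field k] [AddCommGroup Γ] [LinearOrder Γ] [IsOrderedAddMonoid Γ]

/-- All exponents occurring in `u` are at most `w`. -/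
def ExpLE (u : AddMonoidAlgebra k Γ) (w : Γ) : Prop := ∀ w', w < w' → u.coeff w' = 0

/-- The largest exponent occurring in `u` is `w`. -/
def Lead (u : AddMonoidAlgebra k Γ) (w : Γ) : Prop := ExpLE u w ∧ u.coeff w ≠ 0

theorem ExpLE.mono {u : AddMonoidAlgebra k Γ} {w w' : Γ} (h : ExpLE u w) (hw : w ≤ w') :
    ExpLE u w' := fun _ ht => h _ (hw.trans_lt ht)

theorem ExpLE.add {u v : AddMonoidAlgebra k Γ} {w : Γ} (h : ExpLE u w) (h' : ExpLE v w) :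
    ExpLE (u + v) w := fun t ht => by simp [h t ht, h' t ht]

theorem ExpLE.sum {ι : Type*} {s : Finset ι} {u : ι → AddMonoidAlgebra k Γ} {w : Γ}
    (h : ∀ i ∈ s, ExpLE (u i) w) : ExpLE (∑ i ∈ s, u i) w := by
  classical
  induction s using Finset.induction_on with
  | empty => intro t _; simp
  | insert a s ha ih =>
    rw [Finset.sum_insert ha]
    exact (h a (by simp)).add (ih fun i hi => h i (by simp [hi]))

theorem ExpLE.coeff_mul_add {u v : AddMonoidAlgebra k Γ} {w w' : Γ} (h : ExpLE u w)
    (h' : ExpLE v w') : (u * v).coeff (w + w') = u.coeff w * v.coeff w' := by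
  classical
  rw [AddMonoidAlgebra.coeff_mul, Finsupp.sum, Finset.sum_eq_single w]
  · rw [Finsupp.sum, Finset.sum_eq_single w']
    · simp
    · intro b _ hb
      simp [hb]
    · intro hb
      simp [Finsupp.notMem_support_iff.1 hb]
  · intro b hb hbw
    refine Finset.sum_eq_zero fun c hc => if_neg fun hbc => ?_
    have hb' : b ≤ w := not_lt.1 fun hlt => Finsupp.mem_support_iff.1 hb (h b hlt)
    have hc' : c ≤ w' := not_lt.1 fun hlt => Finsupp.mem_support_iff.1 hc (h' c hlt)
    exact absurd hbc (add_lt_add_of_lt_of_le (lt_of_le_of_ne hb' hbw) hc').ne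
  · intro hb
    simp [Finsupp.notMem_support_iff.1 hb]

theorem ExpLE.mul {u v : AddMonoidAlgebra k Γ} {w w' : Γ} (h : ExpLE u w) (h' : ExpLE v w') :
    ExpLE (u * v) (w + w') := by
  classical
  intro t ht
  rw [AddMonoidAlgebra.coeff_mul]
  refine Finset.sum_eq_zero fun b hb => Finset.sum_eq_zero fun c hc => if_neg fun hbc => ?_
  have hb' : b ≤ w := not_lt.1 fun hlt => Finsupp.mem_support_iff.1 hb (h b hlt)
  have hc' : c ≤ w' := not_lt.1 fun hlt => Finsupp.mem_support_iff.1 hc (h' c hlt)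
  exact absurd (add_le_add hb' hc') (not_le.2 (hbc ▸ ht))

theorem lead_single (w : Γ) : Lead (AddMonoidAlgebra.single w (1 : k)) w := by
  refine ⟨fun t ht => ?_, by simp⟩
  simp [ht.ne]

theorem Lead.mul {u v : AddMonoidAlgebra k Γ} {w w' : Γ} (h : Lead u w) (h' : Lead v w') :
    Lead (u * v) (w + w') :=
  ⟨h.1.mul h'.1, by rw [h.1.coeff_mul_add h'.1]; exact mul_ne_zero h.2 h'.2⟩

theorem Lead.pow {u : AddMonoidAlgebra k Γ} {w : Γ} (h : Lead u w) (i : ℕ) :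
    Lead (u ^ i) (i • w) := by
  induction i with
  | zero => simpa [AddMonoidAlgebra.one_def] using lead_single (k := k) (0 : Γ)
  | succ i ih => rw [pow_succ, succ_nsmul]; exact ih.mul h

theorem Lead.add {u v : AddMonoidAlgebra k Γ} {w w' : Γ} (h : Lead u w) (h' : ExpLE v w')
    (hw : w' < w) : Lead (u + v) w :=
  ⟨h.1.add (h'.mono hw.le), by simpa [h' w hw] using h.2⟩

theorem Lead.ne_zero {u : AddMonoidAlgebra k Γ} {w : Γ} (h : Lead u w) : u ≠ 0 := by
  rintro rfl
  exact h.2 (by simp)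

theorem exists_lead {u : AddMonoidAlgebra k Γ} (hu : u ≠ 0) : ∃ w, Lead u w := by
  have hne : u.coeff.support.Nonempty := by
    rw [Finsupp.support_nonempty_iff]
    exact fun h => hu (by ext t; simp [h])
  refine ⟨u.coeff.support.max' hne, fun t ht => ?_,
    Finsupp.mem_support_iff.1 (Finset.max'_mem _ hne)⟩
  by_contra h
  exact absurd (Finset.le_max' _ t (Finsupp.mem_support_iff.2 h)) (not_le.2 ht)

theorem Lead.unique {u : AddMonoidAlgebra k Γ} {w w' : Γ} (h : Lead u w) (h' : Lead u w') :
    w = w' :=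
  le_antisymm (not_lt.1 fun hlt => h.2 (h'.1 _ hlt)) (not_lt.1 fun hlt => h'.2 (h.1 _ hlt))

theorem Lead.le {u : AddMonoidAlgebra k Γ} {w w' : Γ} (h : Lead u w) (h' : ExpLE u w') :
    w ≤ w' := not_lt.1 fun hlt => h.2 (h' _ hlt)

theorem exists_common_lead {u v : AddMonoidAlgebra k Γ} (huv : u ≠ 0 ∨ v ≠ 0) :
    ∃ w, ExpLE u w ∧ ExpLE v w ∧ (u.coeff w ≠ 0 ∨ v.coeff w ≠ 0) := by
  by_cases hu : u = 0
  · obtain ⟨w, hw⟩ := exists_lead (huv.resolve_left (not_not.2 hu))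
    exact ⟨w, fun t _ => by simp [hu], hw.1, .inr hw.2⟩
  by_cases hv : v = 0
  · obtain ⟨w, hw⟩ := exists_lead hu
    exact ⟨w, hw.1, fun t _ => by simp [hv], .inl hw.2⟩
  obtain ⟨w, hw⟩ := exists_lead hu
  obtain ⟨w', hw'⟩ := exists_lead hv
  rcases le_total w w' with hle | hle
  · exact ⟨w', hw.1.mono hle, hw'.1, .inr hw'.2⟩
  · exact ⟨w, hw.1, hw'.1.mono hle, .inl hw.2⟩

/-- A nontrivial linear combination of elements with pairwise distinct leading exponents has one
of these as its leading exponent. -/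
theorem exists_lead_sum {ι : Type*} {u : ι → AddMonoidAlgebra k Γ} {Λ : ι → Γ}
    (hΛ : Function.Injective Λ) (hu : ∀ i, Lead (u i) (Λ i)) (c : ι →₀ k) (hc : c ≠ 0) :
    ∃ i, Lead (c.sum fun i a => a • u i) (Λ i) ∧ ∀ j ∈ c.support, Λ j ≤ Λ i := by
  obtain ⟨i, hi, hmax⟩ := c.support.exists_max_image Λ (Finsupp.support_nonempty_iff.2 hc)
  have hcoeff (t : Γ) : (c.sum fun i a => a • u i).coeff t =
      ∑ j ∈ c.support, c j * (u j).coeff t := by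
    simp [Finsupp.sum, AddMonoidAlgebra.coeff_sum, Finsupp.finsetSum_apply]
  refine ⟨i, ⟨fun t ht => ?_, ?_⟩, hmax⟩
  · rw [hcoeff]
    exact Finset.sum_eq_zero fun j hj => by
      rw [(hu j).1 t ((hmax j hj).trans_lt ht), mul_zero]
  · rw [hcoeff, Finset.sum_eq_single i]
    · exact mul_ne_zero (Finsupp.mem_support_iff.1 hi) (hu i).2
    · intro j hj hji
      rw [(hu j).1 _ (lt_of_le_of_ne (hmax j hj) fun h => hji (hΛ h)), mul_zero]
    · exact fun h => absurd hi h

end LeadingExponents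

section LogDerivation

variable {k Γ : Type*} [Field k] [AddCommGroup Γ]

/-- The linear map multiplying the monomial of exponent `w` by `ℓ w`. -/
noncomputable def logDerLinear (ℓ : Γ →+ k) :
    AddMonoidAlgebra k Γ →ₗ[k] AddMonoidAlgebra k Γ where
  toFun u := .ofCoeff ((ℓ : Γ → k) • u.coeff)
  map_add' u v := by ext; simp
  map_smul' c u := by ext; simp [mul_left_comm]

theorem coeff_logDerLinear (ℓ : Γ →+ k) (u : AddMonoidAlgebra k Γ) (w : Γ) :
    (logDerLinear ℓ u).coeff w = ℓ w * u.coeff w := rfl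

theorem logDerLinear_single (ℓ : Γ →+ k) (w : Γ) (c : k) :
    logDerLinear ℓ (.single w c) = .single w (ℓ w * c) := by
  classical
  ext t
  rw [coeff_logDerLinear]
  by_cases h : w = t <;> simp [h]

/-- The derivation multiplying the monomial of exponent `w` by `ℓ w`. -/
noncomputable def logDer (ℓ : Γ →+ k) :
    Derivation k (AddMonoidAlgebra k Γ) (AddMonoidAlgebra k Γ) :=
  Derivation.mk' (logDerLinear ℓ) fun u v => by
    induction u using AddMonoidAlgebra.induction_linear with
    | zero => simp
    | add a b ha hb => simp only [add_mul, map_add, ha, hb, smul_eq_mul, mul_add]; ring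
    | single w c =>
      induction v using AddMonoidAlgebra.induction_linear with
      | zero => simp
      | add a b ha hb => simp only [mul_add, map_add, ha, hb, smul_eq_mul, add_mul]; ring
      | single w' c' =>
        simp only [AddMonoidAlgebra.single_mul_single, logDerLinear_single, smul_eq_mul, map_add]
        rw [add_comm w' w, ← AddMonoidAlgebra.single_add]
        congr 1
        ring

theorem coeff_logDer (ℓ : Γ →+ k) (u : AddMonoidAlgebra k Γ) (w : Γ) :
    (logDer ℓ u).coeff w = ℓ w * u.coeff w := rfl

theorem logDer_single (ℓ : Γ →+ k) (w : Γ) (c : k) :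
    logDer ℓ (.single w c) = .single w (ℓ w * c) := logDerLinear_single ℓ w c

theorem ExpLE.logDer [LinearOrder Γ] {u : AddMonoidAlgebra k Γ} {w : Γ} (h : ExpLE u w)
    (ℓ : Γ →+ k) : ExpLE (logDer ℓ u) w := fun t ht => by rw [coeff_logDer, h t ht, mul_zero]

end LogDerivation

section Lattice

/-- The exponent of `s ^ v * x ^ (-t)`, ordered by `v` first and then by `t`. -/
def expo (v t : ℤ) : ℤ ×ₗ ℤ := toLex (v, t)

theorem expo_add (v t v' t' : ℤ) : expo v t + expo v' t' = expo (v + v') (t + t') := rfl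

theorem nsmul_expo (i : ℕ) (v t : ℤ) : i • expo v t = expo (i * v) (i * t) := by
  rw [← nsmul_eq_mul, ← nsmul_eq_mul]; rfl

theorem expo_zero : expo 0 0 = 0 := rfl

theorem expo_inj {v t v' t' : ℤ} : expo v t = expo v' t' ↔ v = v' ∧ t = t' := by
  simp [expo]

theorem expo_lt {v t v' t' : ℤ} : expo v t < expo v' t' ↔ v < v' ∨ v = v' ∧ t < t' := by
  simp [expo, Prod.Lex.toLex_lt_toLex]

theorem expo_le {v t v' t' : ℤ} : expo v t ≤ expo v' t' ↔ v < v' ∨ v = v' ∧ t ≤ t' := by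
  simp [expo, Prod.Lex.toLex_le_toLex]

theorem exists_expo (w : ℤ ×ₗ ℤ) : ∃ v t, w = expo v t := ⟨(ofLex w).1, (ofLex w).2, rfl⟩

/-- The additive map `v, t ↦ v * b + t * a` on exponents. -/
def expoHom {k : Type*} [Field k] (b a : k) : (ℤ ×ₗ ℤ) →+ k where
  toFun w := (ofLex w).1 * b + (ofLex w).2 * a
  map_zero' := by simp
  map_add' w w' := by simp; ring

theorem expoHom_expo {k : Type*} [Field k] (b a : k) (v t : ℤ) :
    expoHom b a (expo v t) = v * b + t * a := rfl

end Lattice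

section MonicAt

variable {k B : Type*} [Field k] [CommRing B] [Algebra k B]

/-- The value at `t` of the monic polynomial of degree `d` with lower coefficients `f i`, each
evaluated at `a`. -/
noncomputable def monicAt (f : ℕ → Polynomial k) (d : ℕ) (a t : B) : B :=
  t ^ d + ∑ i ∈ Finset.range d, Polynomial.aeval a (f i) * t ^ i

/-- The value at `t` of the derivative in `t` of `monicAt f d a t`. -/
noncomputable def monicDerivAt (f : ℕ → Polynomial k) (d : ℕ) (a t : B) : B :=
  (d : B) * t ^ (d - 1) +
    ∑ i ∈ Finset.range d, (i : B) * Polynomial.aeval a (f i) * t ^ (i - 1)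

theorem map_monicAt {C : Type*} [CommRing C] [Algebra k C] (φ : B →ₐ[k] C)
    (f : ℕ → Polynomial k) (d : ℕ) (a t : B) :
    φ (monicAt f d a t) = monicAt f d (φ a) (φ t) := by
  simp [monicAt, Polynomial.aeval_algHom_apply]

theorem map_monicDerivAt {C : Type*} [CommRing C] [Algebra k C] (φ : B →ₐ[k] C)
    (f : ℕ → Polynomial k) (d : ℕ) (a t : B) :
    φ (monicDerivAt f d a t) = monicDerivAt f d (φ a) (φ t) := by
  simp [monicDerivAt, Polynomial.aeval_algHom_apply]

theorem monicAt_mem (S : Subalgebra k B) (f : ℕ → Polynomial k) (d : ℕ) {a t : B} (ha : a ∈ S)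
    (ht : t ∈ S) : monicAt f d a t ∈ S :=
  add_mem (pow_mem ht _) (sum_mem fun _ _ =>
    mul_mem (Algebra.adjoin_singleton_le ha (Polynomial.aeval_mem_adjoin_singleton k a))
      (pow_mem ht _))

theorem Derivation.map_aeval_eq_zero (D : Derivation k B B) {a : B} (ha : D a = 0)
    (p : Polynomial k) : D (Polynomial.aeval a p) = 0 := by
  rw [Polynomial.aeval_eq_sum_range, map_sum]
  exact Finset.sum_eq_zero fun i _ => by simp [Derivation.leibniz_pow, ha]

theorem Derivation.map_monicAt (D : Derivation k B B) (f : ℕ → Polynomial k) (d : ℕ) {a : B}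
    (ha : D a = 0) (t : B) : D (monicAt f d a t) = monicDerivAt f d a t * D t := by
  simp only [monicAt, monicDerivAt, map_add, map_sum, Derivation.leibniz_pow, Derivation.leibniz,
    D.map_aeval_eq_zero ha, smul_eq_mul, nsmul_eq_mul, mul_zero, add_zero, add_mul,
    Finset.sum_mul]
  congr 1
  · ring
  · exact Finset.sum_congr rfl fun i _ => by ring

end MonicAt

/-- Elements `x, y, z, s` generating `R` and satisfying the defining relations of
`R_{n,e,P,Q}`, together with a map `φ` to the Laurent polynomials in `s` and `x`. -/
structure IsDanielewski_s11 {k R : Type*} [Field k] [CommRing R] [Algebra k R] (n e d m : ℕ)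
    (f g : ℕ → Polynomial k) (φ : R →ₐ[k] AddMonoidAlgebra k (ℤ ×ₗ ℤ)) (x y z s : R) : Prop where
  adjoin_eq_top : Algebra.adjoin k {x, y, z} = ⊤
  rel_y : x ^ n * y = monicAt f d x s
  rel_z : x ^ e * z = monicAt g m x y - s
  map_x : φ x = .single (expo 0 (-1)) 1
  map_s : φ s = .single (expo 1 0) 1

namespace IsDanielewski_s11

variable {k R : Type*} [Field k] [CommRing R] [Algebra k R] {n e d m : ℕ}
  {f g : ℕ → Polynomial k} {φ : R →ₐ[k] AddMonoidAlgebra k (ℤ ×ₗ ℤ)} {x y z s : R}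

section Map

variable (h : IsDanielewski_s11 n e d m f g φ x y z s)
include h

theorem map_x_pow (i : ℕ) : φ (x ^ i) = .single (expo 0 (-i)) 1 := by
  rw [map_pow, h.map_x, AddMonoidAlgebra.single_pow, nsmul_expo]
  simp

theorem lead_x : Lead (φ x) (expo 0 (-1)) := h.map_x ▸ lead_single _

theorem lead_s : Lead (φ s) (expo 1 0) := h.map_s ▸ lead_single _

theorem expLE_aeval (p : Polynomial k) : ExpLE (φ (Polynomial.aeval x p)) (expo 0 0) := by
  rw [Polynomial.aeval_eq_sum_range, map_sum]
  refine ExpLE.sum fun i _ t ht => ?_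
  have : expo 0 (-i) ≠ t := (lt_of_le_of_lt (expo_le.2 (by simp)) ht).ne
  rw [map_smul, h.map_x_pow]
  simp [this]

theorem coeff_aeval (p : Polynomial k) (i : ℕ) :
    (φ (Polynomial.aeval x p)).coeff (expo 0 (-i)) = p.coeff i := by
  classical
  have hne (j : ℕ) : expo 0 (-j) = expo 0 (-i) ↔ j = i := by simp [expo_inj]
  rw [Polynomial.aeval_eq_sum_range, map_sum, AddMonoidAlgebra.coeff_sum,
    Finsupp.finsetSum_apply, Finset.sum_congr rfl fun j _ => by rw [map_smul, h.map_x_pow]]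
  simp only [AddMonoidAlgebra.coeff_smul_apply, AddMonoidAlgebra.coeff_single,
    Finsupp.single_apply, hne, smul_eq_mul, mul_ite, mul_one, mul_zero]
  rw [Finset.sum_ite_eq' (Finset.range _) i]
  simp only [Finset.mem_range, ite_eq_left_iff, not_lt]
  exact fun hi => (Polynomial.coeff_eq_zero_of_natDegree_lt (by omega)).symm

theorem lead_monicAt {t : R} {v w : ℤ} (ht : Lead (φ t) (expo v w)) (hv : 0 < v)
    (q : ℕ → Polynomial k) (r : ℕ) : Lead (φ (monicAt q r x t)) (expo (r * v) (r * w)) := by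
  rw [monicAt, map_add, map_pow, map_sum, ← nsmul_expo]
  rcases Nat.eq_zero_or_pos r with rfl | hr
  · simpa using ht.pow 0
  refine (ht.pow r).add (w' := expo (r * v) (r * w) + expo (-1) (|w| * r + |w| * r)) ?_ ?_
  · refine ExpLE.sum fun i hi => ?_
    have hi : (i : ℤ) + 1 ≤ r := by simpa using Finset.mem_range.1 hi
    rw [map_mul, map_pow]
    refine ((h.expLE_aeval (q i)).mul (ht.pow i).1).mono ?_
    rw [nsmul_expo, expo_add, expo_add, expo_le]
    rcases lt_or_eq_of_le (show 0 + i * v ≤ r * v + -1 by nlinarith) with h1 | h1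
    · exact .inl h1
    · refine .inr ⟨h1, ?_⟩
      have h2 := neg_abs_le w
      have h3 := le_abs_self w
      have h4 := abs_nonneg w
      nlinarith
  · rw [nsmul_expo, expo_add, expo_lt]
    exact .inl (by omega)

theorem eq_single_mul {i : ℕ} {u u' : R} (hu : x ^ i * u = u') :
    φ u = .single (expo 0 i) 1 * φ u' := by
  rw [← hu, map_mul, h.map_x_pow, ← mul_assoc, AddMonoidAlgebra.single_mul_single, expo_add]
  simp [expo_zero, ← AddMonoidAlgebra.one_def]

theorem lead_y : Lead (φ y) (expo d n) := by
  have := (lead_single (k := k) (expo 0 n)).mul (h.lead_monicAt h.lead_s one_pos f d)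
  rw [← h.eq_single_mul h.rel_y, expo_add] at this
  simpa using this

theorem lead_z (hd : 2 ≤ d) (hm : 2 ≤ m) : Lead (φ z) (expo (d * m) (n * m + e)) := by
  have h1 : Lead (φ (monicAt g m x y - s)) (expo (m * d) (m * n)) := by
    rw [sub_eq_add_neg, map_add]
    refine (h.lead_monicAt h.lead_y (by omega) g m).add (w' := expo 1 0) ?_ ?_
    · intro t ht
      simp [h.lead_s.1 t ht]
    · rw [expo_lt]
      left
      have : (2 : ℤ) ≤ d := by exact_mod_cast hd
      have : (2 : ℤ) ≤ m := by exact_mod_cast hm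
      nlinarith
  have := (lead_single (k := k) (expo 0 e)).mul h1
  rw [← h.eq_single_mul h.rel_z, expo_add] at this
  convert this using 2 <;> ring

end Map

variable {k R : Type*} [Field k] [CommRing R] [Algebra k R] {n e d m : ℕ}
  {f g : ℕ → Polynomial k} {φ : R →ₐ[k] AddMonoidAlgebra k (ℤ ×ₗ ℤ)} {x y z s : R}

section Basis

/-- The monomials `x ^ c * s ^ i * y ^ j * z ^ b` with `i < d` and `j < m`, indexed by
`(c, i, j, b)`. -/
def basisMonomial (x y z s : R) (d m : ℕ) (ι : ℕ × Fin d × Fin m × ℕ) : R :=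
  x ^ ι.1 * s ^ (ι.2.1 : ℕ) * y ^ (ι.2.2.1 : ℕ) * z ^ ι.2.2.2

/-- The leading exponents of the basis monomials. -/
def basisExpo (n e d m : ℕ) (ι : ℕ × Fin d × Fin m × ℕ) : ℤ ×ₗ ℤ :=
  expo (((ι.2.1 : ℕ) + d * (ι.2.2.1 : ℕ) + d * m * ι.2.2.2 : ℕ) : ℤ)
    ((n * (ι.2.2.1 : ℕ) + (n * m + e) * ι.2.2.2 : ℕ) - ι.1)

theorem digits_unique {d m i j b i' j' b' : ℕ} (hi : i < d) (hj : j < m) (hi' : i' < d)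
    (hj' : j' < m) (h : i + d * j + d * m * b = i' + d * j' + d * m * b') :
    i = i' ∧ j = j' ∧ b = b' := by
  have key {a c p q r : ℕ} (hp : p < r) (hq : q < r) (hpq : p + r * a = q + r * c) :
      p = q ∧ a = c := by
    have h1 := congrArg (· % r) hpq
    have h2 := congrArg (· / r) hpq
    have hr : 0 < r := by omega
    simp only [Nat.add_mul_mod_self_left, Nat.mod_eq_of_lt hp, Nat.mod_eq_of_lt hq] at h1
    simp only [Nat.add_mul_div_left _ _ hr, Nat.div_eq_of_lt hp, Nat.div_eq_of_lt hq] at h2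
    omega
  obtain ⟨h1, h2⟩ := key hi hi' (by linarith : i + d * (j + m * b) = i' + d * (j' + m * b'))
  exact ⟨h1, key hj hj' h2⟩

theorem basisExpo_injective : Function.Injective (basisExpo n e d m) := by
  rintro ⟨c, i, j, b⟩ ⟨c', i', j', b'⟩ h
  obtain ⟨h1, h2⟩ := expo_inj.1 h
  obtain ⟨hi, hj, rfl⟩ := digits_unique i.2 j.2 i'.2 j'.2 (by exact_mod_cast h1)
  obtain rfl := Fin.ext hi
  obtain rfl := Fin.ext hj
  simp at h2
  simp [h2]

theorem aeval_mul_mem_span {M : Submodule k R} {u : R} (hu : ∀ c, x ^ c * u ∈ M)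
    (p : Polynomial k) : Polynomial.aeval x p * u ∈ M := by
  rw [Polynomial.aeval_eq_sum_range, Finset.sum_mul]
  exact sum_mem fun i _ => by rw [smul_mul_assoc]; exact M.smul_mem _ (hu i)

variable (h : IsDanielewski_s11 n e d m f g φ x y z s)
include h

theorem lead_basisMonomial (hd : 2 ≤ d) (hm : 2 ≤ m) (ι : ℕ × Fin d × Fin m × ℕ) :
    Lead (φ (basisMonomial x y z s d m ι)) (basisExpo n e d m ι) := by
  have := (((h.lead_x.pow ι.1).mul (h.lead_s.pow ι.2.1)).mul (h.lead_y.pow ι.2.2.1)).mul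
    ((h.lead_z hd hm).pow ι.2.2.2)
  simp only [nsmul_expo, expo_add, ← map_pow, ← map_mul] at this
  refine (congrArg _ (expo_inj.2 ⟨?_, ?_⟩)).mp this <;> push_cast <;> ring

theorem monomial_mem_span (hd : 2 ≤ d) (hm : 2 ≤ m) (N : ℕ) :
    ∀ L c i j b : ℕ, i + d * j + d * m * b = N → i + j = L →
      x ^ c * s ^ i * y ^ j * z ^ b ∈ Submodule.span k (Set.range (basisMonomial x y z s d m)) := by
  have hdm : 1 < d * m := by nlinarith
  induction N using Nat.strong_induction_on with
  | _ N ihN =>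
  intro L
  induction L using Nat.strong_induction_on with
  | _ L ihL =>
  intro c i j b hN hL
  rcases le_or_gt d i with hi | hi
  · obtain ⟨i, rfl⟩ := Nat.exists_eq_add_of_le' hi
    have hrel : x ^ c * s ^ (i + d) * y ^ j * z ^ b = x ^ (c + n) * s ^ i * y ^ (j + 1) * z ^ b -
        ∑ l ∈ Finset.range d,
          Polynomial.aeval x (f l) * (x ^ c * s ^ (i + l) * y ^ j * z ^ b) := by
      have hP := h.rel_y
      rw [monicAt] at hP
      calc _ = x ^ c * s ^ i * y ^ j * z ^ b * (x ^ n * y -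
            ∑ l ∈ Finset.range d, Polynomial.aeval x (f l) * s ^ l) := by rw [hP]; ring
        _ = _ := by
          rw [mul_sub, Finset.mul_sum]
          congr 1
          · ring
          · exact Finset.sum_congr rfl fun l _ => by ring
    rw [hrel]
    refine sub_mem (ihL (i + (j + 1)) (by omega) _ _ _ _ (by rw [← hN]; ring) rfl)
      (sum_mem fun l hl => aeval_mul_mem_span (fun c' => ?_) _)
    have hl := Finset.mem_range.1 hl
    rw [← mul_assoc, ← mul_assoc, ← mul_assoc, ← pow_add]
    exact ihN _ (by omega) _ _ _ _ _ rfl rfl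
  rcases le_or_gt m j with hj | hj
  · obtain ⟨j, rfl⟩ := Nat.exists_eq_add_of_le' hj
    have hrel : x ^ c * s ^ i * y ^ (j + m) * z ^ b =
        x ^ (c + e) * s ^ i * y ^ j * z ^ (b + 1) + x ^ c * s ^ (i + 1) * y ^ j * z ^ b -
        ∑ l ∈ Finset.range m,
          Polynomial.aeval x (g l) * (x ^ c * s ^ i * y ^ (j + l) * z ^ b) := by
      have hQ := h.rel_z
      rw [monicAt] at hQ
      calc _ = x ^ c * s ^ i * y ^ j * z ^ b * (x ^ e * z + s -
            ∑ l ∈ Finset.range m, Polynomial.aeval x (g l) * y ^ l) := by rw [hQ]; ring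
        _ = _ := by
          rw [mul_sub, Finset.mul_sum]
          congr 1
          · ring
          · exact Finset.sum_congr rfl fun l _ => by ring
    rw [hrel]
    refine sub_mem (add_mem (ihL (i + j) (by omega) _ _ _ _ (by rw [← hN]; ring) rfl)
      (ihN (i + 1 + d * j + d * m * b) (by rw [← hN, mul_add]; omega) _ _ _ _ _ rfl rfl))
      (sum_mem fun l hl => aeval_mul_mem_span (fun c' => ?_) _)
    have hl := Finset.mem_range.1 hl
    rw [← mul_assoc, ← mul_assoc, ← mul_assoc, ← pow_add]
    refine ihN (i + d * (j + l) + d * m * b) ?_ _ _ _ _ _ rfl rfl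
    have : d * (j + l) < d * (j + m) := Nat.mul_lt_mul_of_pos_left (by omega) (by omega)
    omega
  · exact Submodule.subset_span ⟨(c, ⟨i, hi⟩, ⟨j, hj⟩, b), rfl⟩

theorem span_basisMonomial (hd : 2 ≤ d) (hm : 2 ≤ m) :
    Submodule.span k (Set.range (basisMonomial x y z s d m)) = ⊤ := by
  have hcl : ∀ u ∈ Submonoid.closure ({x, y, z} : Set R),
      ∃ c j b : ℕ, u = x ^ c * y ^ j * z ^ b := by
    intro u hu
    induction hu using Submonoid.closure_induction with
    | mem u hu =>
      rcases hu with rfl | rfl | rfl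
      · exact ⟨1, 0, 0, by simp⟩
      · exact ⟨0, 1, 0, by simp⟩
      · exact ⟨0, 0, 1, by simp⟩
    | one => exact ⟨0, 0, 0, by simp⟩
    | mul u v _ _ hu hv =>
      obtain ⟨c, j, b, rfl⟩ := hu
      obtain ⟨c', j', b', rfl⟩ := hv
      exact ⟨c + c', j + j', b + b', by ring⟩
  rw [eq_top_iff, ← Algebra.top_toSubmodule, ← h.adjoin_eq_top, Algebra.adjoin_eq_span,
    Submodule.span_le]
  intro u hu
  obtain ⟨c, j, b, rfl⟩ := hcl u hu
  simpa using h.monomial_mem_span hd hm _ _ c 0 j b rfl rfl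

theorem exists_repr (hd : 2 ≤ d) (hm : 2 ≤ m) (u : R) : ∃ c : (ℕ × Fin d × Fin m × ℕ) →₀ k,
    (c.sum fun ι a => a • basisMonomial x y z s d m ι) = u :=
  Finsupp.mem_span_range_iff_exists_finsupp.1 (h.span_basisMonomial hd hm ▸ Submodule.mem_top)

theorem exists_lead_repr (hd : 2 ≤ d) (hm : 2 ≤ m) {c : (ℕ × Fin d × Fin m × ℕ) →₀ k}
    (hc : c ≠ 0) : ∃ ι, Lead (φ (c.sum fun ι a => a • basisMonomial x y z s d m ι))
      (basisExpo n e d m ι) ∧ ∀ κ ∈ c.support, basisExpo n e d m κ ≤ basisExpo n e d m ι := by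
  have := exists_lead_sum basisExpo_injective (h.lead_basisMonomial hd hm) c hc
  simpa only [Finsupp.sum, map_sum, map_smul] using this

theorem injective_s11 (hd : 2 ≤ d) (hm : 2 ≤ m) : Function.Injective φ := by
  rw [injective_iff_map_eq_zero]
  intro u hu
  obtain ⟨c, rfl⟩ := h.exists_repr hd hm u
  by_contra hne
  obtain ⟨ι, hι, -⟩ := h.exists_lead_repr hd hm (c := c) (by rintro rfl; simp at hne)
  exact hι.ne_zero hu

theorem exists_basisExpo (hd : 2 ≤ d) (hm : 2 ≤ m) {u : R} {w : ℤ ×ₗ ℤ} (hu : Lead (φ u) w) :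
    ∃ ι, w = basisExpo n e d m ι := by
  obtain ⟨c, rfl⟩ := h.exists_repr hd hm u
  obtain ⟨ι, hι, -⟩ := h.exists_lead_repr hd hm (c := c) (by
    rintro rfl
    exact hu.ne_zero (by simp))
  exact ⟨ι, hu.unique hι⟩

theorem mem_adjoin_of_expLE (hd : 2 ≤ d) (hm : 2 ≤ m) {u : R} {t : ℤ}
    (hu : ExpLE (φ u) (expo 0 t)) : u ∈ Algebra.adjoin k {x} := by
  obtain ⟨c, rfl⟩ := h.exists_repr hd hm u
  by_cases hc : c = 0
  · simp [hc]
  obtain ⟨ι, hι, hmax⟩ := h.exists_lead_repr hd hm hc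
  refine sum_mem fun κ hκ => Subalgebra.smul_mem _ ?_ _
  have hle := (hmax κ hκ).trans (hι.le hu)
  obtain ⟨c, i, j, b⟩ := κ
  rw [basisExpo, expo_le] at hle
  have hz : (i : ℕ) + d * j + d * m * b = 0 := by
    dsimp only at hle
    omega
  obtain ⟨hi, hj, rfl⟩ := digits_unique i.2 j.2 (by omega : 0 < d) (by omega : 0 < m)
    (by simpa using hz : (i : ℕ) + d * j + d * m * b = 0 + d * 0 + d * m * 0)
  simpa [basisMonomial, hi, hj] using pow_mem (Algebra.self_mem_adjoin_singleton k x) c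

end Basis

end IsDanielewski_s11

theorem le_one_of_root {n e d m p q : ℤ} (he : 0 ≤ e) (hd : 2 ≤ d) (hm : 2 ≤ m) (hp : 0 < p)
    (hz : (n * m + e) * p ≤ d * m * q) (hq : q * (d - 1) + 1 ≤ p) : n ≤ 1 := by
  by_contra! hn
  have h1 : (n * m + e) * p * (d - 1) ≤ d * m * q * (d - 1) :=
    mul_le_mul_of_nonneg_right hz (by omega)
  have h2 : d * m * (q * (d - 1)) < d * m * p :=
    mul_lt_mul_of_pos_left (by omega) (by positivity)
  have h3 : d * m ≤ (n * m + e) * (d - 1) := by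
    have h4 : 2 * m ≤ n * m := mul_le_mul_of_nonneg_right hn (by omega)
    have h5 : 2 * m * (d - 1) ≤ (n * m + e) * (d - 1) :=
      mul_le_mul_of_nonneg_right (by omega) (by omega)
    nlinarith
  linarith [mul_le_mul_of_nonneg_right h3 hp.le]

theorem lt_of_root {e d m p q : ℤ} (he : 1 ≤ e) (hd : 2 ≤ d) (hm : 2 ≤ m) (hp : 0 < p)
    (hz : (m + e) * p ≤ d * m * q) : p * m < q * (d * m - 1) + 1 := by
  by_contra! hq
  have hdm : 2 * m ≤ d * m := mul_le_mul_of_nonneg_right hd (by omega)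
  have h1 : (m + e) * p * (d * m - 1) ≤ d * m * q * (d * m - 1) :=
    mul_le_mul_of_nonneg_right hz (by omega)
  have h2 : d * m * (q * (d * m - 1)) < d * m * (p * m) :=
    mul_lt_mul_of_pos_left (by omega) (by positivity)
  have h3 : d * m * m ≤ (m + e) * (d * m - 1) := by
    have h4 : 1 * (d * m - 1) ≤ e * (d * m - 1) := mul_le_mul_of_nonneg_right he (by omega)
    nlinarith
  linarith [mul_le_mul_of_nonneg_right h3 hp.le]

/-- The numerical constraints on a root `δ = expo b a` of the semigroup of leading exponents, for
which `(v, t) ↦ q * v - p * t` has value `-1`, exclude `p > 0`. -/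
theorem no_root {n e d m : ℕ} (hn : 1 ≤ n) (hne : ¬(n = 1 ∧ e = 0)) (hd : 2 ≤ d) (hm : 2 ≤ m)
    {p q a b : ℤ} (hp : 0 < p) (hz : (n * m + e) * p ≤ d * m * q) (hab : p * a = q * b + 1)
    (hx : ∃ ι, expo b (a - 1) = IsDanielewski_s11.basisExpo n e d m ι)
    (hs : ∃ ι, expo (b + 1) a = IsDanielewski_s11.basisExpo n e d m ι)
    (hy : (d * q ≠ n * p) → ∃ ι, expo (b + d) (a + n) = IsDanielewski_s11.basisExpo n e d m ι) :
    False := by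
  obtain ⟨⟨c, ⟨i, hi⟩, ⟨j, hj⟩, B⟩, hx⟩ := hx
  obtain ⟨⟨c', ⟨i', hi'⟩, ⟨j', hj'⟩, B'⟩, hs⟩ := hs
  obtain ⟨hb, ha⟩ := expo_inj.1 hx
  obtain ⟨hb', ha'⟩ := expo_inj.1 hs
  dsimp only at hb ha hb' ha'
  have hn' : (1 : ℤ) ≤ n := by exact_mod_cast hn
  have hd' : (2 : ℤ) ≤ d := by exact_mod_cast hd
  have hm' : (2 : ℤ) ≤ m := by exact_mod_cast hm
  have he' : (0 : ℤ) ≤ e := by positivity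
  have hep : 0 ≤ e * p := by positivity
  have hnp : 0 < n * p := by positivity
  have hy' : n * p ≤ d * q := by nlinarith
  have hq : 0 < q := by nlinarith
  have hj0 : (0 : ℤ) ≤ j := by positivity
  have hB0 : (0 : ℤ) ≤ B := by positivity
  have hM : p * (n * j + (n * m + e) * B) ≤ q * (d * j + d * m * B) := by
    nlinarith [mul_le_mul_of_nonneg_right hy' hj0, mul_le_mul_of_nonneg_right hz hB0]
  have hqi : 0 ≤ q * i := by positivity
  push_cast at ha hb ha' hb'
  have haM : (n * j + (n * m + e) * B : ℤ) < a := by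
    by_contra hcon
    have := mul_le_mul_of_nonneg_left (not_lt.1 hcon) hp.le
    rw [hb] at hab
    linarith
  have hi1 : i + 1 = d := by
    by_contra hcon
    obtain ⟨-, rfl, rfl⟩ := IsDanielewski_s11.digits_unique (i := i + 1) (by omega) hj hi' hj'
      (b := B) (b' := B') (by zify; linarith)
    omega
  have haM' : a = n * j + (n * m + e) * B + 1 := by omega
  have hi1' : (i : ℤ) = d - 1 := by omega
  have hqp : q * (d - 1) + 1 ≤ p := by
    rw [haM', hb, hi1'] at hab
    linarith
  obtain rfl : n = 1 :=
    le_antisymm (by exact_mod_cast le_one_of_root he' hd' hm' hp hz hqp) hn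
  have he : (1 : ℤ) ≤ e := by omega
  push_cast at *
  obtain ⟨⟨c₂, ⟨i₂, hi₂⟩, ⟨j₂, hj₂⟩, B₂⟩, hy⟩ := hy (by nlinarith)
  obtain ⟨hb₂, ha₂⟩ := expo_inj.1 hy
  dsimp only at hb₂ ha₂
  push_cast at ha₂ hb₂
  have hj1 : j + 1 = m := by
    by_contra hcon
    obtain ⟨-, rfl, rfl⟩ := IsDanielewski_s11.digits_unique (i := i) (j := j + 1) hi (by omega) hi₂ hj₂
      (b := B) (b' := B₂) (by zify; linarith)
    push_cast at ha₂
    omega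
  have hj1' : (j : ℤ) = m - 1 := by omega
  have hfin : q * (d * m - 1) + 1 ≤ p * m := by
    rw [haM', hb, hi1', hj1'] at hab
    linarith [mul_le_mul_of_nonneg_right hz hB0]
  exact absurd hfin (not_le.2 (lt_of_root he hd' hm' hp (by linarith)))

namespace IsDanielewski_s11

section Derivations

variable {k R : Type*} [Field k] [CommRing R] [Algebra k R] {n e d m : ℕ}
  {f g : ℕ → Polynomial k} {φ : R →ₐ[k] AddMonoidAlgebra k (ℤ ×ₗ ℤ)} {x y z s : R}
  (h : IsDanielewski_s11 n e d m f g φ x y z s)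
include h

theorem single_mul_map_x_pow_s11 (i : ℕ) : .single (expo 0 i) 1 * φ (x ^ i) = 1 := by
  rw [h.map_x_pow, AddMonoidAlgebra.single_mul_single, expo_add]
  simp [expo_zero, ← AddMonoidAlgebra.one_def]

theorem x_pow_ne_zero (i : ℕ) : x ^ i ≠ 0 := fun h0 => by
  simpa [h0] using h.single_mul_map_x_pow_s11 i

theorem eq_top_of_mem {S : Subalgebra k R} (hS : ∀ (i : ℕ) (u : R), x ^ i * u ∈ S → u ∈ S)
    (hx : x ∈ S) (hs : s ∈ S) : S = ⊤ := by
  have hy : y ∈ S := hS n y (h.rel_y ▸ monicAt_mem S f d hx hs)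
  have hz : z ∈ S := hS e z (h.rel_z ▸ sub_mem (monicAt_mem S g m hx hy) hs)
  rw [eq_top_iff, ← h.adjoin_eq_top, Algebra.adjoin_le_iff]
  rintro u (rfl | rfl | rfl) <;> assumption

/-- A `φ`-derivation is determined by its values at `x` and `s`. -/
theorem eq_zero_of_leibniz {δ : R →ₗ[k] AddMonoidAlgebra k (ℤ ×ₗ ℤ)}
    (hδ : ∀ u v, δ (u * v) = φ u * δ v + φ v * δ u) (hx : δ x = 0) (hs : δ s = 0) : δ = 0 := by
  have h1 : δ 1 = 0 := by simpa using hδ 1 1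
  let S : Subalgebra k R :=
    { carrier := {u | δ u = 0}
      mul_mem' := fun {u v} (hu : δ u = 0) (hv : δ v = 0) => by
        simp [hδ, hu, hv]
      add_mem' := fun {u v} (hu : δ u = 0) (hv : δ v = 0) => by simp [hu, hv]
      algebraMap_mem' := fun c => by
        simp [Algebra.algebraMap_eq_smul_one, h1] }
  have hS : S = ⊤ := by
    refine h.eq_top_of_mem (fun i u (hu : δ (x ^ i * u) = 0) => ?_) hx hs
    have hxi : δ (x ^ i) = 0 := S.pow_mem hx i
    rw [hδ, hxi, mul_zero, add_zero] at hu
    change δ u = 0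
    rw [← one_mul (δ u), ← h.single_mul_map_x_pow_s11 i, mul_assoc, hu, mul_zero]
  exact LinearMap.ext fun u => (hS ▸ Algebra.mem_top : u ∈ S)

theorem map_derivation_s11 (E : Derivation k R R) (u : R) :
    φ (E u) = .single (expo 0 1) (-1) * φ (E x) * logDer (expoHom 0 1) (φ u) +
      .single (expo (-1) 0) 1 * φ (E s) * logDer (expoHom 1 0) (φ u) := by
  let δ : R →ₗ[k] AddMonoidAlgebra k (ℤ ×ₗ ℤ) := φ.toLinearMap ∘ₗ E.toLinearMap -
    (LinearMap.mulLeft k (.single (expo 0 1) (-1) * φ (E x)) ∘ₗ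
        (logDer (expoHom 0 1)).toLinearMap ∘ₗ φ.toLinearMap +
      LinearMap.mulLeft k (.single (expo (-1) 0) 1 * φ (E s)) ∘ₗ
        (logDer (expoHom 1 0)).toLinearMap ∘ₗ φ.toLinearMap)
  have hδ (u : R) : δ u = φ (E u) -
      (.single (expo 0 1) (-1) * φ (E x) * logDer (expoHom 0 1) (φ u) +
      .single (expo (-1) 0) 1 * φ (E s) * logDer (expoHom 1 0) (φ u)) := rfl
  have key : δ = 0 := by
    refine h.eq_zero_of_leibniz (fun u v => ?_) ?_ ?_
    · simp only [hδ, map_mul, map_add, Derivation.leibniz, smul_eq_mul]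
      ring
    · rw [hδ, h.map_x, logDer_single, logDer_single, expoHom_expo, expoHom_expo, mul_right_comm,
        AddMonoidAlgebra.single_mul_single, expo_add]
      simp [expo_zero, ← AddMonoidAlgebra.one_def]
    · rw [hδ, h.map_s, logDer_single, logDer_single, expoHom_expo, expoHom_expo,
        mul_right_comm (AddMonoidAlgebra.single (expo (-1) 0) _),
        AddMonoidAlgebra.single_mul_single, expo_add]
      simp [expo_zero, ← AddMonoidAlgebra.one_def]
  exact sub_eq_zero.1 ((hδ u).symm.trans (LinearMap.congr_fun key u))

end Derivations

section LocallyNilpotent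

variable {k R : Type*} [Field k] [CommRing R] [Algebra k R] {n e d m : ℕ}
  {f g : ℕ → Polynomial k} {φ : R →ₐ[k] AddMonoidAlgebra k (ℤ ×ₗ ℤ)} {x y z s : R}

/-- If `E` shifts leading exponents by `δ`, multiplying leading coefficients by `ℓ`, then `ℓ` takes
nonpositive multiples of `ℓ δ` as values on leading exponents. -/
theorem exists_nat_mul {E : Derivation k R R} (hE : IsLND E) {δ : ℤ ×ₗ ℤ} {ℓ : (ℤ ×ₗ ℤ) →+ k}
    (hlead : ∀ u w, Lead (φ u) w → ℓ w ≠ 0 → Lead (φ (E u)) (w + δ)) {u : R} {w : ℤ ×ₗ ℤ}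
    (hu : Lead (φ u) w) : ∃ t : ℕ, ℓ w + t * ℓ δ = 0 := by
  obtain ⟨N, hN⟩ := hE u
  induction N generalizing u w with
  | zero =>
    have hu0 : u = 0 := hN
    exact absurd (by simp [hu0]) hu.ne_zero
  | succ N ih =>
    by_cases hw : ℓ w = 0
    · exact ⟨0, by simp [hw]⟩
    · rw [pow_succ] at hN
      obtain ⟨t, ht⟩ := ih (hlead u w hu hw) hN
      exact ⟨t + 1, by rw [map_add] at ht; push_cast; linear_combination ht⟩

variable (h : IsDanielewski_s11 n e d m f g φ x y z s)
include h

theorem exists_root (hd : 2 ≤ d) (hm : 2 ≤ m) {E : Derivation k R R} (hE : E ≠ 0) :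
    ∃ (b a : ℤ) (β α : k), (β ≠ 0 ∨ α ≠ 0) ∧ ∀ u w, ExpLE (φ u) w →
      ExpLE (φ (E u)) (w + expo b a) ∧
        (φ (E u)).coeff (w + expo b a) = expoHom β α w * (φ u).coeff w := by
  set A : AddMonoidAlgebra k (ℤ ×ₗ ℤ) := .single (expo 0 1) (-1) * φ (E x) with hA
  set B : AddMonoidAlgebra k (ℤ ×ₗ ℤ) := .single (expo (-1) 0) 1 * φ (E s) with hB
  have hAB : B ≠ 0 ∨ A ≠ 0 := by
    by_contra! h0
    refine hE (Derivation.ext fun u => h.injective_s11 hd hm ?_)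
    rw [h.map_derivation_s11 E u, ← hA, ← hB, h0.1, h0.2]
    simp
  obtain ⟨w₀, hB₀, hA₀, h₀⟩ := exists_common_lead hAB
  obtain ⟨b, a, rfl⟩ := exists_expo w₀
  refine ⟨b, a, B.coeff (expo b a), A.coeff (expo b a), h₀, fun u w hu => ?_⟩
  obtain ⟨v, t, rfl⟩ := exists_expo w
  rw [h.map_derivation_s11 E u, ← hA, ← hB, add_comm (expo v t)]
  refine ⟨(hA₀.mul (hu.logDer _)).add (hB₀.mul (hu.logDer _)), ?_⟩
  rw [AddMonoidAlgebra.coeff_add, Finsupp.add_apply, hA₀.coeff_mul_add (hu.logDer _),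
    hB₀.coeff_mul_add (hu.logDer _), coeff_logDer, coeff_logDer]
  simp only [expoHom_expo]
  ring

/-- A locally nilpotent derivation kills `x` and maps `s` into `x ^ (n + e) * k[x]`. -/
theorem map_x_eq_zero_and_expLE [CharZero k] (hn : 1 ≤ n) (hne : ¬(n = 1 ∧ e = 0)) (hd : 2 ≤ d)
    (hm : 2 ≤ m) {E : Derivation k R R} (hE : IsLND E) :
    E x = 0 ∧ ExpLE (φ (E s)) (expo 0 (-(n + e))) := by
  by_cases hE0 : E = 0
  · subst hE0
    exact ⟨rfl, fun t _ => by simp⟩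
  obtain ⟨b, a, β, α, hβα, hroot⟩ := h.exists_root hd hm hE0
  have hlead (u : R) (w : ℤ ×ₗ ℤ) (hu : Lead (φ u) w) (hw : expoHom β α w ≠ 0) :
      Lead (φ (E u)) (w + expo b a) :=
    ⟨(hroot u w hu.1).1, by rw [(hroot u w hu.1).2]; exact mul_ne_zero hw hu.2⟩
  obtain ⟨p, hp⟩ := exists_nat_mul hE hlead h.lead_x
  obtain ⟨q, hq⟩ := exists_nat_mul hE hlead h.lead_s
  obtain ⟨t, ht⟩ := exists_nat_mul hE hlead h.lead_y
  obtain ⟨t', ht'⟩ := exists_nat_mul hE hlead (h.lead_z hd hm)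
  replace hlead (u : R) (v t : ℤ) (hu : Lead (φ u) (expo v t)) (hw : (v * β + t * α : k) ≠ 0) :
      Lead (φ (E u)) (expo (b + v) (a + t)) := by
    simpa only [expo_add, add_comm b, add_comm a] using hlead u _ hu hw
  simp only [expoHom_expo] at hp hq ht ht'
  push_cast at hp hq ht ht'
  obtain ⟨L, hL⟩ : ∃ L : k, (b * β + a * α : k) = L := ⟨_, rfl⟩
  rw [hL] at hp hq ht ht'
  have hα : α = p * L := by linear_combination -hp
  have hβ : β = -(q * L) := by linear_combination hq
  have hL0 : L ≠ 0 := by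
    rintro rfl
    simp [hα, hβ] at hβα
  have cancel {c : ℤ} (hc : (c : k) * L = 0) : c = 0 := by
    simpa [hL0] using hc
  have hab : (p * a - (q * b + 1) : ℤ) = 0 := cancel (by
    push_cast
    rw [hα, hβ] at hL
    linear_combination hL)
  have hy : (-(d * q) + n * p + t : ℤ) = 0 := cancel (by
    push_cast
    rw [hα, hβ] at ht
    linear_combination ht)
  have hz : (-(d * m * q) + (n * m + e) * p + t' : ℤ) = 0 := cancel (by
    push_cast
    rw [hα, hβ] at ht'
    linear_combination ht')
  have ne_zero {v t : ℤ} (hvt : -(v * q) + t * p ≠ (0 : ℤ)) : (v * β + t * α : k) ≠ 0 := by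
    refine fun h0 => hvt (cancel ?_)
    rw [hα, hβ] at h0
    push_cast
    linear_combination h0
  have hn' : (0 : ℤ) < n := by exact_mod_cast hn
  have hd' : (0 : ℤ) < d := by omega
  have hm' : (0 : ℤ) < m := by omega
  rcases Nat.eq_zero_or_pos p with rfl | hp0
  · have hqb : (q : ℤ) * -b = 1 := by push_cast at hab; linarith
    obtain rfl : q = 1 := by
      have := Int.eq_one_or_neg_one_of_mul_eq_one hqb
      omega
    obtain rfl : b = -1 := by push_cast at hqb; omega
    have hEs := (hroot s _ h.lead_s.1).1
    rw [expo_add] at hEs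
    constructor
    · by_contra hne0
      obtain ⟨w, hw⟩ := exists_lead ((map_ne_zero_iff φ (h.injective_s11 hd hm)).2 hne0)
      obtain ⟨ι, rfl⟩ := h.exists_basisExpo hd hm hw
      have hle := hw.le (hroot x _ h.lead_x.1).1
      rw [expo_add, basisExpo, expo_le] at hle
      omega
    · refine hEs.mono ?_
      obtain ⟨⟨c, ⟨i, hi⟩, ⟨j, hj⟩, B⟩, hι⟩ := h.exists_basisExpo hd hm
        (hlead z _ _ (h.lead_z hd hm) (ne_zero (by push_cast; nlinarith)))
      obtain ⟨h1, h2⟩ := expo_inj.1 hι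
      dsimp only at h1 h2
      obtain ⟨-, rfl, rfl⟩ := digits_unique hi hj (i' := d - 1) (j' := m - 1) (b' := 0)
        (by omega) (by omega) (by
          zify [show 1 ≤ d by omega, show 1 ≤ m by omega]
          push_cast at h1
          linarith)
      rw [expo_le]
      right
      zify [show 1 ≤ m by omega] at h2
      constructor
      · omega
      · linarith
  · exfalso
    have hp' : (0 : ℤ) < p := by exact_mod_cast hp0
    have hq0 : (q : ℤ) ≠ 0 := by
      intro hq0
      rw [hq0] at hy
      have := mul_pos hn' hp'
      omega
    refine no_root hn hne hd hm hp' (q := q) (a := a) (b := b) (by linarith) (by linarith) ?_ ?_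
      fun hy0 => ?_
    · exact h.exists_basisExpo hd hm (by
        simpa [sub_eq_add_neg] using hlead x _ _ h.lead_x (ne_zero (by simpa using hp0.ne')))
    · exact h.exists_basisExpo hd hm (by
        simpa using hlead s _ _ h.lead_s (ne_zero (by simpa using hq0)))
    · exact h.exists_basisExpo hd hm (hlead y _ _ h.lead_y (ne_zero fun h0 => hy0 (by linarith)))

end LocallyNilpotent

section CanonicalDerivation

variable {k R : Type*} [Field k] [CommRing R] [Algebra k R] {n e d m : ℕ}
  {f g : ℕ → Polynomial k} {φ : R →ₐ[k] AddMonoidAlgebra k (ℤ ×ₗ ℤ)} {x y z s : R}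

/-- `D` is the derivation induced by `x ^ (n + e) * ∂/∂s` on Laurent polynomials. -/
def IsCanonical (n e : ℕ) (φ : R →ₐ[k] AddMonoidAlgebra k (ℤ ×ₗ ℤ)) (D : Derivation k R R) :
    Prop :=
  ∀ u, φ (D u) = .single (expo (-1) (-(n + e))) 1 * logDer (expoHom 1 0) (φ u)

theorem IsCanonical.expLE {D : Derivation k R R} (hD : IsCanonical n e φ D) {u : R} {v t : ℤ}
    (hu : ExpLE (φ u) (expo v t)) : ExpLE (φ (D u)) (expo (v - 1) (t - (n + e))) := by
  rw [hD u, sub_eq_neg_add, sub_eq_neg_add, ← expo_add]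
  exact (lead_single _).1.mul (hu.logDer _)

theorem eq_zero_of_mem_adjoin {D : Derivation k R R} (hx : D x = 0) {u : R}
    (hu : u ∈ Algebra.adjoin k {x}) : D u = 0 := by
  rw [Algebra.adjoin_singleton_eq_range_aeval] at hu
  obtain ⟨p, rfl⟩ := hu
  exact D.map_aeval_eq_zero hx p

theorem _root_.Derivation.smul_pow_apply {D : Derivation k R R} {c : R} (hc : D c = 0) (i : ℕ)
    (u : R) : (((c • D).toLinearMap : Module.End k R) ^ i) u =
      c ^ i * ((D.toLinearMap : Module.End k R) ^ i) u := by
  have hci (i : ℕ) : D (c ^ i) = 0 := by rw [D.leibniz_pow, hc, smul_zero, smul_zero]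
  induction i with
  | zero => simp
  | succ i ih =>
    rw [pow_succ', Module.End.mul_apply, ih, pow_succ' (D.toLinearMap : Module.End k R),
      Module.End.mul_apply]
    simp [hci, pow_succ']
    ring

variable (h : IsDanielewski_s11 n e d m f g φ x y z s)
include h

theorem exists_isCanonical (hd : 2 ≤ d) (hm : 2 ≤ m) : ∃ D : Derivation k R R,
    IsCanonical n e φ D ∧ D x = 0 ∧ D y = x ^ e * monicDerivAt f d x s ∧
      D z = monicDerivAt g m x y * monicDerivAt f d x s - x ^ n ∧ D s = x ^ (n + e) := by
  have hinj := h.injective_s11 hd hm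
  obtain ⟨δ, hδ⟩ : ∃ δ : Derivation k (AddMonoidAlgebra k (ℤ ×ₗ ℤ)) (AddMonoidAlgebra k (ℤ ×ₗ ℤ)),
      ∀ a, δ a = .single (expo (-1) (-(n + e))) 1 * logDer (expoHom 1 0) a :=
    ⟨AddMonoidAlgebra.single (expo (-1) (-(n + e))) (1 : k) • logDer (expoHom 1 0), fun _ => rfl⟩
  have hδx : δ (φ x) = 0 := by
    rw [hδ, h.map_x, logDer_single, expoHom_expo]
    simp
  have hδs : δ (φ s) = φ (x ^ (n + e)) := by
    rw [hδ, h.map_s, logDer_single, expoHom_expo, h.map_x_pow, AddMonoidAlgebra.single_mul_single,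
      expo_add]
    simp
  have cancel {i : ℕ} {u v : R} (huv : δ (φ (x ^ i * u)) = φ (x ^ i * v)) : δ (φ u) = φ v := by
    have hxi : δ (φ (x ^ i)) = 0 := by rw [map_pow, δ.leibniz_pow, hδx, smul_zero, smul_zero]
    rw [map_mul φ, map_mul φ, δ.leibniz, hxi, smul_zero, add_zero, smul_eq_mul] at huv
    rw [← one_mul (δ (φ u)), ← one_mul (φ v), ← h.single_mul_map_x_pow_s11 i, mul_assoc, huv, mul_assoc]
  have hδy : δ (φ y) = φ (x ^ e * monicDerivAt f d x s) := by
    refine cancel (i := n) ?_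
    rw [h.rel_y, map_monicAt, δ.map_monicAt f d hδx, hδs, ← map_monicDerivAt, ← map_mul]
    congr 1
    ring
  have hδz : δ (φ z) = φ (monicDerivAt g m x y * monicDerivAt f d x s - x ^ n) := by
    refine cancel (i := e) ?_
    rw [h.rel_z, map_sub, map_monicAt, map_sub, δ.map_monicAt g m hδx, hδs, hδy,
      ← map_monicDerivAt, ← map_mul, ← map_sub]
    congr 1
    ring
  let S : Subalgebra k R :=
    { carrier := {u | ∃ v, δ (φ u) = φ v}
      mul_mem' := by
        rintro u v ⟨u', hu⟩ ⟨v', hv⟩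
        exact ⟨u * v' + v * u', by simp [hu, hv]⟩
      add_mem' := by
        rintro u v ⟨u', hu⟩ ⟨v', hv⟩
        exact ⟨u' + v', by simp [hu, hv]⟩
      algebraMap_mem' := fun c => ⟨0, by rw [φ.commutes, δ.map_algebraMap, map_zero]⟩ }
  have hS : S = ⊤ := by
    rw [eq_top_iff, ← h.adjoin_eq_top, Algebra.adjoin_le_iff]
    rintro u (rfl | rfl | rfl)
    exacts [⟨0, by rw [hδx, map_zero]⟩, ⟨_, hδy⟩, ⟨_, hδz⟩]
  choose F hF using fun u => (hS ▸ Algebra.mem_top : u ∈ S)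
  let F' : R →ₗ[k] R :=
    { toFun := F
      map_add' := fun u v => hinj (by simp [← hF])
      map_smul' := fun c u => hinj (by simp [← hF]) }
  let D : Derivation k R R := Derivation.mk' F' fun u v => hinj (by
    change φ (F (u * v)) = φ (u * F v + v * F u)
    simp [← hF])
  exact ⟨D, fun u => (hF u).symm.trans (hδ _), hinj ((hF x).symm.trans (hδx.trans (map_zero φ).symm)),
    hinj ((hF y).symm.trans hδy), hinj ((hF z).symm.trans hδz), hinj ((hF s).symm.trans hδs)⟩

theorem isLND (hd : 2 ≤ d) (hm : 2 ≤ m) {D : Derivation k R R} (hD : IsCanonical n e φ D)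
    (hx : D x = 0) : IsLND D := by
  have key (N : ℕ) : ∀ (u : R) (t : ℤ), ExpLE (φ u) (expo N t) →
      ((D.toLinearMap : Module.End k R) ^ (N + 1)) u = 0 := by
    induction N with
    | zero =>
      intro u t hu
      rw [zero_add, pow_one]
      exact eq_zero_of_mem_adjoin hx (h.mem_adjoin_of_expLE hd hm hu)
    | succ N ih =>
      intro u t hu
      rw [pow_succ]
      refine ih (D u) (t - (n + e)) ?_
      simpa using hD.expLE hu
  intro u
  by_cases hu : u = 0
  · exact ⟨0, hu⟩
  obtain ⟨w, hw⟩ := exists_lead ((map_ne_zero_iff φ (h.injective_s11 hd hm)).2 hu)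
  obtain ⟨ι, rfl⟩ := h.exists_basisExpo hd hm hw
  exact ⟨_, key _ u _ hw.1⟩

theorem mem_adjoin_of_eq_zero [CharZero k] (hd : 2 ≤ d) (hm : 2 ≤ m) {D : Derivation k R R}
    (hD : IsCanonical n e φ D) {u : R} (hu : D u = 0) : u ∈ Algebra.adjoin k {x} := by
  by_cases hu0 : u = 0
  · exact hu0 ▸ zero_mem _
  obtain ⟨w, hw⟩ := exists_lead ((map_ne_zero_iff φ (h.injective_s11 hd hm)).2 hu0)
  obtain ⟨v, t, rfl⟩ := exists_expo w
  have hcoeff := (lead_single (k := k) (expo (-1) (-(n + e)))).1.coeff_mul_add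
    (hw.1.logDer (expoHom 1 0))
  rw [← hD u, hu, coeff_logDer, expoHom_expo] at hcoeff
  obtain rfl : v = 0 := by simpa [hw.2] using hcoeff
  exact h.mem_adjoin_of_expLE hd hm hw.1

theorem eq_smul [CharZero k] (hn : 1 ≤ n) (hne : ¬(n = 1 ∧ e = 0)) (hd : 2 ≤ d) (hm : 2 ≤ m)
    {D : Derivation k R R} (hx : D x = 0) (hs : D s = x ^ (n + e)) {E : Derivation k R R}
    (hE : IsLND E) : ∃ c ∈ Algebra.adjoin k {x}, E = c • D := by
  obtain ⟨hEx, hEs⟩ := h.map_x_eq_zero_and_expLE hn hne hd hm hE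
  have hmem := h.mem_adjoin_of_expLE hd hm hEs
  rw [Algebra.adjoin_singleton_eq_range_aeval] at hmem
  obtain ⟨p, hp : Polynomial.aeval x p = E s⟩ := hmem
  obtain ⟨q, rfl⟩ : Polynomial.X ^ (n + e) ∣ p := by
    refine Polynomial.X_pow_dvd_iff.2 fun i hi => ?_
    rw [← h.coeff_aeval p i, hp]
    refine hEs _ (expo_lt.2 (.inr ⟨rfl, ?_⟩))
    omega
  refine ⟨Polynomial.aeval x q, Polynomial.aeval_mem_adjoin_singleton k x, ?_⟩
  have key : φ.toLinearMap ∘ₗ (E - Polynomial.aeval x q • D).toLinearMap = 0 := by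
    refine h.eq_zero_of_leibniz (fun u v => ?_) ?_ ?_
    · simp only [LinearMap.comp_apply, AlgHom.toLinearMap_apply, Derivation.coeFn_coe,
        Derivation.leibniz, smul_eq_mul, map_add, map_mul]
    · simp [hEx, hx]
    · simp [← hp, hs, mul_comm]
  rw [← sub_eq_zero]
  refine Derivation.ext fun u => h.injective_s11 hd hm ?_
  simpa using LinearMap.congr_fun key u

theorem ker_pow_eq [CharZero k] (hn : 1 ≤ n) (hne : ¬(n = 1 ∧ e = 0)) (hd : 2 ≤ d) (hm : 2 ≤ m)
    {D : Derivation k R R} (hx : D x = 0) (hs : D s = x ^ (n + e)) {E : Derivation k R R}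
    (hE : IsLND E) (hE0 : E ≠ 0) (i : ℕ) :
    LinearMap.ker ((E.toLinearMap : Module.End k R) ^ i) =
      LinearMap.ker ((D.toLinearMap : Module.End k R) ^ i) := by
  have : IsDomain R := (h.injective_s11 hd hm).isDomain φ.toRingHom
  obtain ⟨c, hc, rfl⟩ := h.eq_smul hn hne hd hm hx hs hE
  have hc0 : c ≠ 0 := by
    rintro rfl
    exact hE0 (zero_smul _ _)
  ext u
  rw [LinearMap.mem_ker, LinearMap.mem_ker, D.smul_pow_apply (eq_zero_of_mem_adjoin hx hc)]
  simp [hc0]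

theorem ML_eq [CharZero k] (hn : 1 ≤ n) (hne : ¬(n = 1 ∧ e = 0)) (hd : 2 ≤ d) (hm : 2 ≤ m) :
    ML k R = (Algebra.adjoin k {x} : Set R) := by
  obtain ⟨D, hD, hx, -⟩ := h.exists_isCanonical hd hm
  ext u
  exact ⟨fun hu => h.mem_adjoin_of_eq_zero hd hm hD (hu D (h.isLND hd hm hD hx)),
    fun hu E hE => eq_zero_of_mem_adjoin (h.map_x_eq_zero_and_expLE hn hne hd hm hE).1 hu⟩

end CanonicalDerivation

end IsDanielewski_s11

section Instance

variable {k : Type*} [Field k] (n e d m : ℕ) (f g : ℕ → Polynomial k)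

/-- The images of `X`, `Y`, `Z` in the Laurent polynomials in `s` and `x`. -/
noncomputable def laurentGen : Fin 3 → AddMonoidAlgebra k (ℤ ×ₗ ℤ) :=
  let x := .single (expo 0 (-1)) 1
  let y := .single (expo 0 n) 1 * monicAt f d x (.single (expo 1 0) 1)
  ![x, y, .single (expo 0 e) 1 * (monicAt g m x y - .single (expo 1 0) 1)]

theorem laurentGen_pow_mul (i : ℕ) (a : AddMonoidAlgebra k (ℤ ×ₗ ℤ)) :
    laurentGen n e d m f g 0 ^ i * (.single (expo 0 i) 1 * a) = a := by
  change AddMonoidAlgebra.single (expo 0 (-1)) (1 : k) ^ i * _ = a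
  rw [AddMonoidAlgebra.single_pow, nsmul_expo, ← mul_assoc, AddMonoidAlgebra.single_mul_single,
    expo_add]
  simp [expo_zero, ← AddMonoidAlgebra.one_def]

theorem aeval_laurentGen_sel :
    aeval (laurentGen n e d m f g) (Qpoly k m g - X 0 ^ e * X 2) = .single (expo 1 0) 1 := by
  have hQ : Qpoly k m g = monicAt g m (X 0) (X 1) := rfl
  rw [hQ, map_sub, map_mul, map_pow, map_monicAt, aeval_X, aeval_X, aeval_X]
  exact (congrArg _ (laurentGen_pow_mul n e d m f g e _)).trans (sub_sub_cancel _ _)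

/-- The embedding of `R_{n,e,P,Q}` into the Laurent polynomials in `s` and `x`. -/
noncomputable def toLaurent : RRing k n e d m f g →ₐ[k] AddMonoidAlgebra k (ℤ ×ₗ ℤ) :=
  Ideal.Quotient.liftₐ (RIdeal k n e d m f g) (aeval (laurentGen n e d m f g)) fun p hp => by
    refine (Ideal.span_le (I := RingHom.ker (aeval (laurentGen n e d m f g)))).2 ?_ hp
    rintro _ rfl
    have hP (T : MvPolynomial (Fin 3) k) : Pat k d f T = monicAt f d (X 0) T := rfl
    rw [SetLike.mem_coe, RingHom.mem_ker, hP, map_sub, map_mul, map_pow, map_monicAt,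
      aeval_laurentGen_sel, aeval_X, aeval_X]
    exact sub_eq_zero.2 (laurentGen_pow_mul n e d m f g n _)

theorem isDanielewski : IsDanielewski_s11 n e d m f g (toLaurent n e d m f g) (xel k n e d m f g)
    (yel k n e d m f g) (zel k n e d m f g) (sel k n e d m f g) where
  adjoin_eq_top := by
    have h := congrArg (Subalgebra.map (Ideal.Quotient.mkₐ k (RIdeal k n e d m f g)))
      (MvPolynomial.adjoin_range_X (R := k) (σ := Fin 3))
    rw [AlgHom.map_adjoin, Algebra.map_top, (AlgHom.range_eq_top _).2
      (Ideal.Quotient.mkₐ_surjective k _), ← Set.range_comp] at h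
    refine Eq.trans (congrArg _ ?_) h
    ext u
    constructor
    · rintro (rfl | rfl | rfl)
      exacts [⟨0, rfl⟩, ⟨1, rfl⟩, ⟨2, rfl⟩]
    · rintro ⟨i, rfl⟩
      fin_cases i
      exacts [.inl rfl, .inr (.inl rfl), .inr (.inr rfl)]
  rel_y := by
    have h : Ideal.Quotient.mkₐ k (RIdeal k n e d m f g) (X 0 ^ n * X 1) =
        Ideal.Quotient.mkₐ k (RIdeal k n e d m f g)
          (monicAt f d (X 0) (Qpoly k m g - X 0 ^ e * X 2)) :=
      Ideal.Quotient.eq.2 (Ideal.subset_span rfl)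
    rwa [map_mul, map_pow, map_monicAt] at h
  rel_z := by
    have h : Ideal.Quotient.mkₐ k (RIdeal k n e d m f g) (X 0 ^ e * X 2) =
        Ideal.Quotient.mkₐ k (RIdeal k n e d m f g)
          (monicAt g m (X 0) (X 1) - (Qpoly k m g - X 0 ^ e * X 2)) :=
      congrArg _ (sub_sub_cancel _ _).symm
    rwa [map_mul, map_pow, map_sub, map_monicAt] at h
  map_x := aeval_X _ _
  map_s := aeval_laurentGen_sel n e d m f g

end Instance

theorem stmt11 {k : Type*} [Field k] [CharZero k]
    (n e d m : ℕ) (hn : 1 ≤ n) (hne : ¬(n = 1 ∧ e = 0)) (hd : 2 ≤ d) (hm : 2 ≤ m)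
    (f g : ℕ → Polynomial k) :
    ∃ D : Derivation k (RRing k n e d m f g) (RRing k n e d m f g),
      -- `D` is the derivation `∂` determined by the following values
      D (xel k n e d m f g) = 0 ∧
      D (yel k n e d m f g) = xel k n e d m f g ^ e * PSel k n e d m f g ∧
      D (zel k n e d m f g) =
        QYel k n e d m f g * PSel k n e d m f g - xel k n e d m f g ^ n ∧
      D (sel k n e d m f g) = xel k n e d m f g ^ (n + e) ∧
      IsLND D ∧ D ≠ 0 ∧
      -- (1) ML(R) = k[x]
      ML k (RRing k n e d m f g) =
        ((Algebra.adjoin k {xel k n e d m f g} : Subalgebra k (RRing k n e d m f g)) :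
          Set (RRing k n e d m f g)) ∧
      -- consequently `R` is semi-rigid and its unique LND-filtration is the `∂`-filtration
      SemiRigid k (RRing k n e d m f g) ∧
      (∀ E : Derivation k (RRing k n e d m f g) (RRing k n e d m f g),
        IsLND E → E ≠ 0 → ∀ i : ℕ,
          LinearMap.ker ((E.toLinearMap : Module.End k (RRing k n e d m f g)) ^ (i + 1)) =
            LinearMap.ker ((D.toLinearMap : Module.End k (RRing k n e d m f g)) ^ (i + 1))) ∧
      -- (2) every LND of `R` is of the form `f(x)·∂`; in particular `R` is almost rigid
      (∀ E : Derivation k (RRing k n e d m f g) (RRing k n e d m f g), IsLND E →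
        ∃ c : RRing k n e d m f g, c ∈ Algebra.adjoin k {xel k n e d m f g} ∧ E = c • D) := by
  have h := isDanielewski n e d m f g
  obtain ⟨D, hD, hx, hy, hz, hs⟩ := h.exists_isCanonical hd hm
  have hker (E : Derivation k (RRing k n e d m f g) (RRing k n e d m f g)) (hE : IsLND E)
      (hE0 : E ≠ 0) (i : ℕ) := h.ker_pow_eq hn hne hd hm hx hs hE hE0 (i + 1)
  refine ⟨D, hx, hy, hz, hs, h.isLND hd hm hD hx, ?_, h.ML_eq hn hne hd hm,
    fun E E' hE hE' hE0 hE0' i => (hker E hE hE0 i).trans (hker E' hE' hE0' i).symm, hker,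
    fun E hE => h.eq_smul hn hne hd hm hx hs hE⟩
  rintro rfl
  exact h.x_pow_ne_zero (n + e) hs.symm
end
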